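/- Let P be a regular Schur labeled skew shape poset on {1,…,n}. Then the 0-Hecke module M_P (with basis Σ_L(P)) admits a filtration 0 = M₀ ⊂ M₁ ⊂ ⋯ ⊂ M_l = M_P by H_n(0)-submodules such that each quotient M_k/M_{k-1} has quasisymmetric characteristic equal to a Schur function. Concretely, for a total order T₁, …, T_l on the set {Q(γ) : γ ∈ Σ_L(P)} of recording tableaux refining the reverse dominance order on shapes, the spans M_k = C·{γ ∈ Σ_L(P) : Q(γ) ∈ {T₁,…,T_k}} are H_n(0)-submodules, and ch([M_k/M_{k-1}]) = s_{sh(T_k)ᵗ}. -/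

import Mathlib

/-- A skew partition `λ/μ`: a pair of Young diagrams with `μ ⊆ λ`. -/
structure SkewShape where
  outer : YoungDiagram
  inner : YoungDiagram
  le : inner ≤ outer

/-- The cells of the skew diagram `λ/μ` (pairs `(row, column)`). -/
def SkewShape.cells (s : SkewShape) : Finset (ℕ × ℕ) := s.outer.cells \ s.inner.cells

/-- A bijective tableau of shape `λ/μ` of size `n`: a filling of the cells with the
`n` distinct entries of `Fin n`. -/
def IsBijFilling (s : SkewShape) (n : ℕ) (τ : ℕ × ℕ → Fin n) : Prop :=
  Set.BijOn τ ↑s.cells Set.univ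

/-- A standard Young tableau of shape `λ/μ`: a bijective filling whose rows increase
left to right and whose columns increase top to bottom. -/
def IsSYT (s : SkewShape) (n : ℕ) (T : ℕ × ℕ → Fin n) : Prop :=
  IsBijFilling s n T ∧
  (∀ i j, (i, j) ∈ s.cells → (i, j + 1) ∈ s.cells → T (i, j) < T (i, j + 1)) ∧
  (∀ i j, (i, j) ∈ s.cells → (i + 1, j) ∈ s.cells → T (i, j) < T (i + 1, j))

/-- A Schur labeling: a bijective filling whose rows strictly decrease left to right
and whose columns strictly increase top to bottom. -/
def IsSchurLabeling (s : SkewShape) (n : ℕ) (τ : ℕ × ℕ → Fin n) : Prop :=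
  IsBijFilling s n τ ∧
  (∀ i j, (i, j) ∈ s.cells → (i, j + 1) ∈ s.cells → τ (i, j + 1) < τ (i, j)) ∧
  (∀ i j, (i, j) ∈ s.cells → (i + 1, j) ∈ s.cells → τ (i, j) < τ (i + 1, j))

/-- A distinguished Schur labeling: `τ_B ≥ τ_{B'}` whenever `B` is weakly below and
weakly left of `B'`. -/
def IsDistinguished (s : SkewShape) (n : ℕ) (τ : ℕ × ℕ → Fin n) : Prop :=
  IsSchurLabeling s n τ ∧
  ∀ B ∈ s.cells, ∀ B' ∈ s.cells, B'.1 ≤ B.1 → B.2 ≤ B'.2 → τ B' ≤ τ B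

/-- `π = read_τ(T)`, i.e. `π(τ(B)) = T(B)` for every box `B`; since `τ` is a bijective
filling this determines `π` completely. -/
def IsReading (s : SkewShape) {n : ℕ} (τ T : ℕ × ℕ → Fin n) (π : Equiv.Perm (Fin n)) : Prop :=
  ∀ B ∈ s.cells, π (τ B) = T B

/-- The poset `poset(τ)` on labels: `x ≤ y` iff the box of `x` is weakly upper-left of
the box of `y`. -/
def posetRel (s : SkewShape) {n : ℕ} (τ : ℕ × ℕ → Fin n) (x y : Fin n) : Prop :=
  ∃ B ∈ s.cells, ∃ B' ∈ s.cells, τ B = x ∧ τ B' = y ∧ B.1 ≤ B'.1 ∧ B.2 ≤ B'.2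

/-- Two boxes are adjacent (share an edge). -/
def AdjBox (B B' : ℕ × ℕ) : Prop :=
  (B.1 = B'.1 ∧ (B.2 + 1 = B'.2 ∨ B'.2 + 1 = B.2)) ∨
  (B.2 = B'.2 ∧ (B.1 + 1 = B'.1 ∨ B'.1 + 1 = B.1))

/-- Two boxes lie in the same connected component of the skew diagram. -/
def SameComp (s : SkewShape) (B B' : ℕ × ℕ) : Prop :=
  Relation.ReflTransGen (fun x y => x ∈ s.cells ∧ y ∈ s.cells ∧ AdjBox x y) B B'

/-- The skew diagram is basic: it contains no empty rows and no empty columns. -/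
def IsBasic (s : SkewShape) : Prop :=
  (∀ i i' : ℕ, i ≤ i' → (∃ j, (i', j) ∈ s.cells) → ∃ j, (i, j) ∈ s.cells) ∧
  (∀ j j' : ℕ, j ≤ j' → (∃ i, (i, j') ∈ s.cells) → ∃ i, (i, j) ∈ s.cells)

/-- Condition (iii) in the definition of the canonical Schur labeling `τ_P`: the minimal
entries of the connected components, ordered from the top, increase. -/
def CompMinCond (s : SkewShape) {n : ℕ} (τ : ℕ × ℕ → Fin n) : Prop :=
  ∀ B ∈ s.cells, ∀ B' ∈ s.cells, ¬ SameComp s B B' → B.1 < B'.1 →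
    ∃ B₀ ∈ s.cells, SameComp s B B₀ ∧ ∀ B₁ ∈ s.cells, SameComp s B' B₁ → τ B₀ < τ B₁

/-- A binary relation on `{1,…,n}` is regular if for all `x ≤_P z` and `y` between `x`
and `z` as integers, `x ≤_P y` or `y ≤_P z`. -/
def RegularRel {n : ℕ} (r : Fin n → Fin n → Prop) : Prop :=
  ∀ x y z : Fin n, r x z → ((x < y ∧ y < z) ∨ (z < y ∧ y < x)) → r x y ∨ r y z

/-- Schensted row insertion: insert `x` into a row, returning the new row and the
bumped entry (if any). -/
def insRow (x : ℕ) : List ℕ → List ℕ × Option ℕ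
  | [] => ([x], none)
  | y :: ys =>
    if y ≤ x then
      let p := insRow x ys
      (y :: p.1, p.2)
    else (x :: ys, some y)

/-- Schensted insertion of an entry into a tableau (a list of rows). -/
def insTab : List (List ℕ) → ℕ → List (List ℕ)
  | [], x => [[x]]
  | row :: rest, x =>
    match insRow x row with
    | (row', none) => row' :: rest
    | (row', some y) => row' :: insTab rest y

/-- The Robinson–Schensted insertion tableau `P(σ)` of a permutation, obtained by
inserting the one-line word of `σ` from left to right. -/
def Ptab {n : ℕ} (σ : Equiv.Perm (Fin n)) : List (List ℕ) :=
  (List.ofFn fun i => (σ i : ℕ)).foldl insTab []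

/-- The shape of a tableau: the list of its row lengths. -/
def shapeOf (t : List (List ℕ)) : List ℕ := t.map List.length

/-- Dominance order on partitions (as lists): `domList a b` means `b` dominates `a`,
i.e. every partial sum of `b` is at least the corresponding partial sum of `a`. -/
def domList (a b : List ℕ) : Prop := ∀ i, (a.take i).sum ≤ (b.take i).sum

open scoped Classical

/-- The Robinson–Schensted recording tableau, via `Q(σ) = P(σ⁻¹)`. -/
def Qtab {n : ℕ} (σ : Equiv.Perm (Fin n)) : List (List ℕ) := Ptab σ⁻¹

/-- The left descent set of `σ` (`0`-indexed): `i ∈ Des_L(σ)` iff the value `i+1`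
appears to the right of `i+2` in one-line notation, i.e. `σ⁻¹(i) > σ⁻¹(i+1)`. -/
def DesL0 {n : ℕ} (σ : Equiv.Perm (Fin n)) : Set ℕ :=
  {i | ∃ h : i + 1 < n, σ⁻¹ ⟨i + 1, h⟩ < σ⁻¹ ⟨i, Nat.lt_of_succ_lt h⟩}

/-- The fundamental quasisymmetric function of degree `n` with strictness set `S`,
truncated to `m` variables: the sum over weakly increasing words `f` of length `n`
that increase strictly at each position of `S`, of the corresponding monomials. -/
noncomputable def FundPoly (m n : ℕ) (S : Set ℕ) : MvPolynomial (Fin m) ℤ :=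
  ∑ f : Fin n → Fin m,
    if (∀ (j : ℕ) (h : j + 1 < n),
        f ⟨j, Nat.lt_of_succ_lt h⟩ ≤ f ⟨j + 1, h⟩ ∧
        (j ∈ S → f ⟨j, Nat.lt_of_succ_lt h⟩ < f ⟨j + 1, h⟩)) then
      ∏ i, MvPolynomial.X (f i)
    else 0

/-- The generating function of semistandard fillings of a set of cells (rows weakly
increasing, columns strictly increasing) in `m` variables; for the cells of a partition
`λ` this is the Schur polynomial `s_λ(x_1,…,x_m)`. -/
noncomputable def ssytSum (cells : Finset (ℕ × ℕ)) (m : ℕ) : MvPolynomial (Fin m) ℤ :=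
  ∑ T : {x // x ∈ cells} → Fin m,
    if (∀ p q : {x // x ∈ cells},
        ((p.1.1 = q.1.1 ∧ p.1.2 + 1 = q.1.2) → T p ≤ T q) ∧
        ((p.1.1 + 1 = q.1.1 ∧ p.1.2 = q.1.2) → T p < T q)) then
      ∏ c, MvPolynomial.X (T c)
    else 0

/-- The cells of the Young diagram of a partition given as a list of row lengths. -/
def cellsOfPart (ν : List ℕ) : Finset (ℕ × ℕ) :=
  (Finset.range ν.length).biUnion fun i => (Finset.range (ν.getD i 0)).image fun j => (i, j)

/-- The conjugate (transpose) of a partition given as a list. -/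
def conjPart (ν : List ℕ) : List ℕ :=
  (List.range (ν.foldr max 0)).map fun j => (ν.filter fun a => decide (j < a)).length

section Helpers
open Module Matrix
open Module

section FlagStep
variable {K V : Type*} [Field K] [AddCommGroup V] [Module K V] [FiniteDimensional K V]

/-- dimension of `f^m E`. -/
noncomputable def sdim (f : V →ₗ[K] V) (E : Submodule K V) (m : ℕ) : ℕ :=
  finrank K (E.map (f ^ m))

theorem map_pow_succ' (f : V →ₗ[K] V) (E : Submodule K V) (m : ℕ) :
    E.map (f ^ (m+1)) = (E.map (f ^ m)).map f := by
  rw [pow_succ', Module.End.mul_eq_comp, Submodule.map_comp]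

theorem map_pow_succ_in (f : V →ₗ[K] V) (E : Submodule K V) (m : ℕ) :
    E.map (f ^ (m+1)) = (E.map f).map (f ^ m) := by
  rw [pow_succ, Module.End.mul_eq_comp, Submodule.map_comp]

theorem kdim_add (f : V →ₗ[K] V) (E : Submodule K V) (m : ℕ) :
    finrank K (LinearMap.ker (f ^ m) ⊓ E : Submodule K V) + sdim f E m = finrank K E := by
  have h := LinearMap.finrank_range_add_finrank_ker ((f ^ m).domRestrict E)
  have h1 : LinearMap.range ((f ^ m).domRestrict E) = E.map (f ^ m) := by
    rw [LinearMap.domRestrict, LinearMap.range_comp, Submodule.range_subtype]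
  have h2 : LinearMap.ker ((f ^ m).domRestrict E) = (LinearMap.ker (f ^ m)).comap E.subtype := by
    rw [LinearMap.domRestrict, LinearMap.ker_comp]
  have h3 : finrank K ((LinearMap.ker (f ^ m)).comap E.subtype) = 
     finrank K (LinearMap.ker (f ^ m) ⊓ E : Submodule K V) := by
    rw [inf_comm, ← Submodule.map_comap_subtype]
    exact (Submodule.finrank_map_subtype_eq E _).symm
  rw [h1, h2, h3] at h
  unfold sdim; omega

theorem sdim_zero (f : V →ₗ[K] V) (E : Submodule K V) : sdim f E 0 = finrank K E := by
  unfold sdim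
  rw [pow_zero, Module.End.one_eq_id, Submodule.map_id]

theorem map_le_self_pow (f : V →ₗ[K] V) (E : Submodule K V) (hE : E.map f ≤ E) (m : ℕ) :
    E.map (f ^ (m+1)) ≤ E.map (f ^ m) := by
  rw [map_pow_succ_in]; exact Submodule.map_mono hE

theorem sdim_anti (f : V →ₗ[K] V) (E : Submodule K V) (hE : E.map f ≤ E) (m : ℕ) :
    sdim f E (m+1) ≤ sdim f E m := Submodule.finrank_mono (map_le_self_pow f E hE m)

/-- dimension of `f E + ker f^{c-1} ∩ E`, here `c = d+1`. -/
theorem dim_sum (f : V →ₗ[K] V) (E : Submodule K V) (hE : E.map f ≤ E) (d : ℕ) :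
    finrank K (E.map f ⊔ (LinearMap.ker (f ^ d) ⊓ E) : Submodule K V) + sdim f E d
      = finrank K E + sdim f E (d+1) := by
  have h := Submodule.finrank_sup_add_finrank_inf_eq (E.map f) (LinearMap.ker (f ^ d) ⊓ E)
  have e1 : E.map f ⊓ (LinearMap.ker (f ^ d) ⊓ E) = LinearMap.ker (f ^ d) ⊓ (E.map f) := by
    rw [inf_comm, inf_assoc, inf_eq_right.mpr hE]
  rw [e1] at h
  have k1 := kdim_add f E d
  have k2 := kdim_add f (E.map f) d
  have k3 : sdim f (E.map f) d = sdim f E (d+1) := by unfold sdim; rw [map_pow_succ_in]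
  omega

theorem step_le (f : V →ₗ[K] V) (E E' : Submodule K V) (e : V) (hE' : E' = E ⊔ K ∙ e) (m : ℕ) :
    sdim f E m ≤ sdim f E' m ∧ sdim f E' m ≤ sdim f E m + 1 := by
  subst hE'
  refine ⟨Submodule.finrank_mono (Submodule.map_mono le_sup_left), ?_⟩
  unfold sdim
  rw [Submodule.map_sup]
  have := Submodule.finrank_add_le_finrank_add_finrank (E.map (f^m)) ((K ∙ e).map (f^m))
  have h1 : finrank K ((K ∙ e).map (f^m)) ≤ 1 := by
    rw [Submodule.map_span, Set.image_singleton]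
    exact (finrank_span_le_card _).trans (by simp)
  omega

theorem step_mono (f : V →ₗ[K] V) (E E' : Submodule K V) (hEE : E ≤ E') (m : ℕ) 
    (h : sdim f E m = sdim f E' m) : sdim f E (m+1) = sdim f E' (m+1) := by
  unfold sdim at *
  have : E.map (f^m) = E'.map (f^m) := 
    Submodule.eq_of_le_of_finrank_eq (Submodule.map_mono hEE) h
  rw [map_pow_succ', map_pow_succ', this]

theorem step_exists (f : V →ₗ[K] V) (E E' : Submodule K V) (e : V) (hE' : E' = E ⊔ K ∙ e)
    (he : e ∉ E) (M : ℕ) (hM : sdim f E' (M+1) = 0) :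
    ∃ d ≤ M, ∀ m, sdim f E' m = sdim f E m + (if m ≤ d then 1 else 0) := by
  have hle : E ≤ E' := hE' ▸ le_sup_left
  have hex : ∃ m, sdim f E m = sdim f E' m := ⟨M+1, by
    have := (step_le f E E' e hE' (M+1)).1; omega⟩
  classical
  have h0 : sdim f E 0 ≠ sdim f E' 0 := by
    intro h
    rw [sdim_zero, sdim_zero] at h
    have := Submodule.eq_of_le_of_finrank_eq hle h
    apply he; rw [this, hE']
    exact Submodule.mem_sup_right (Submodule.mem_span_singleton_self e)
  set c := Nat.find hex with hc
  have hcs : sdim f E c = sdim f E' c := Nat.find_spec hex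
  have hc0 : c ≠ 0 := by intro h; rw [h] at hcs; exact h0 hcs
  have hcM : c ≤ M+1 := Nat.find_min' hex (by 
    have := (step_le f E E' e hE' (M+1)).1; omega)
  have hge : ∀ m, c ≤ m → sdim f E m = sdim f E' m := by
    intro m hm
    induction m, hm using Nat.le_induction with
    | base => exact hcs
    | succ m hm ih => exact step_mono f E E' hle m ih
  refine ⟨c-1, by omega, fun m => ?_⟩
  have h1 := step_le f E E' e hE' m
  split_ifs with h
  · have : ¬ (sdim f E m = sdim f E' m) := Nat.find_min hex (by omega)
    omega
  · have := hge m (by omega)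
    omega

/-- (U) -/
theorem step_U (f : V →ₗ[K] V) (E E' : Submodule K V) (e : V) (hE' : E' = E ⊔ K ∙ e)
    (he : e ∉ E) (hf : E'.map f ≤ E) (d : ℕ) 
    (hd : ∀ m, sdim f E' m = sdim f E m + (if m ≤ d then 1 else 0)) :
    f e ∈ (E.map f ⊔ (LinearMap.ker (f ^ d) ⊓ E) : Submodule K V) := by
  have k1 := kdim_add f E (d+1)
  have k2 := kdim_add f E' (d+1)
  have h1 := hd (d+1)
  have h0 := hd 0
  simp [sdim_zero] at h0
  simp at h1
  have hlt : ¬ (LinearMap.ker (f ^ (d+1)) ⊓ E' ≤ E) := by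
    intro hle
    have : LinearMap.ker (f ^ (d+1)) ⊓ E' ≤ LinearMap.ker (f ^ (d+1)) ⊓ E := 
      le_inf inf_le_left hle
    have := Submodule.finrank_mono this
    omega
  rw [SetLike.not_le_iff_exists] at hlt
  obtain ⟨a, ⟨ha1, ha2⟩, ha3⟩ := hlt
  have ha2' : a ∈ E' := ha2
  rw [SetLike.mem_coe, hE', Submodule.mem_sup] at ha2
  obtain ⟨b, hb, b', hb', rfl⟩ := ha2
  obtain ⟨t, rfl⟩ := Submodule.mem_span_singleton.mp hb'
  have ht : t ≠ 0 := by rintro rfl; apply ha3; simpa using hb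
  have hfa : f (b + t • e) ∈ (LinearMap.ker (f ^ d) ⊓ E : Submodule K V) := by
    refine ⟨?_, hf (Submodule.mem_map_of_mem ha2')⟩
    rw [SetLike.mem_coe, LinearMap.mem_ker] at ha1 ⊢
    rw [pow_succ] at ha1; exact ha1
  have : f e = t⁻¹ • (f (b + t • e) - f b) := by
    rw [map_add, map_smul]; simp [ht]
  rw [this]
  apply Submodule.smul_mem
  apply Submodule.sub_mem
  · exact Submodule.mem_sup_right hfa
  · exact Submodule.mem_sup_left (Submodule.mem_map_of_mem hb)

/-- (V) -/
theorem step_V (f : V →ₗ[K] V) (E E' : Submodule K V) (hE' : E ≤ E')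
    (d : ℕ) 
    (hd : ∀ m, sdim f E' m = sdim f E m + (if m ≤ d then 1 else 0)) :
    LinearMap.ker (f ^ d) ⊓ E' ≤ E := by
  have k1 := kdim_add f E d
  have k2 := kdim_add f E' d
  have h1 := hd d
  have h0 := hd 0
  simp [sdim_zero] at h0
  simp at h1
  have hle : LinearMap.ker (f ^ d) ⊓ E ≤ LinearMap.ker (f ^ d) ⊓ E' := inf_le_inf le_rfl hE'
  have := Submodule.eq_of_le_of_finrank_eq hle (by omega)
  rw [← this]; exact inf_le_right

/-- the statistic `n(λ)` in terms of the dimensions. -/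
def nnS (M : ℕ) (s : ℕ → ℕ) : ℕ := ∑ m ∈ Finset.range M, (s m - s (m+1)).choose 2

theorem nnS_step (M : ℕ) (s s' : ℕ → ℕ) (d : ℕ) (hdM : d < M) (hs : ∀ m, s (m+1) ≤ s m)
    (hd : ∀ m, s' m = s m + (if m ≤ d then 1 else 0)) :
    nnS M s' = nnS M s + (s d - s (d+1)) := by
  unfold nnS
  have key : ∀ m, (s' m - s' (m+1)).choose 2 = (s m - s (m+1)).choose 2 + 
      if m = d then (s d - s (d+1)) else 0 := by
    intro m
    rw [hd, hd]
    have := hs m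
    rcases lt_trichotomy m d with h | h | h
    · rw [if_pos (by omega), if_pos (by omega), if_neg (by omega)]
      congr 1; omega
    · subst h
      rw [if_pos (by omega), if_neg (by omega), if_pos rfl]
      have : s m + 1 - (s (m+1) + 0) = (s m - s (m+1)) + 1 := by omega
      rw [this, Nat.choose_succ_succ' _ 1, Nat.choose_one_right, add_comm]
    · rw [if_neg (by omega), if_neg (by omega), if_neg (by omega)]; rfl
  rw [Finset.sum_congr rfl (fun m _ => key m), Finset.sum_add_distrib]
  simp [hdM]
end FlagStep

open Module

section DefOverSec
variable {K : Type*} [Field K] [Algebra ℚ K] {ι : Type*} [Fintype ι]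

/-- The subfield generated by a set. -/
noncomputable abbrev Fl (T : Set K) : IntermediateField ℚ K := IntermediateField.adjoin ℚ T

/-- The subspace `W` is spanned by vectors with entries in `Fl T`. -/
def DefOver (T : Set K) (W : Submodule K (ι → K)) : Prop :=
  W ≤ Submodule.span K {v | v ∈ W ∧ ∀ i, v i ∈ Fl T}

def annSub (S : Set (ι → K)) : Submodule K (ι → K) where
  carrier := {v | ∀ s ∈ S, s ⬝ᵥ v = 0}
  zero_mem' := by intro s _; simp
  add_mem' := by intro a b ha hb s hs; rw [dotProduct_add, ha s hs, hb s hs, add_zero]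
  smul_mem' := by intro c a ha s hs; rw [dotProduct_smul, ha s hs, smul_zero]

theorem mem_annSub {S : Set (ι → K)} {v : ι → K} : v ∈ annSub S ↔ ∀ s ∈ S, s ⬝ᵥ v = 0 := Iff.rfl

theorem Fl_mono {S T : Set K} (h : S ⊆ T) : Fl S ≤ Fl T := IntermediateField.adjoin.mono ℚ S T h

theorem defOver_ann (T : Set K) (S : Set (ι → K)) (hS : ∀ s ∈ S, ∀ i, s i ∈ Fl T) :
    DefOver T (annSub S) := by
  classical
  intro v hv
  let b := Basis.ofVectorSpace (Fl T) K
  let vc : Basis.ofVectorSpaceIndex (Fl T) K → ι → K := fun k i => ((b.repr (v i) k : Fl T) : K)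
  have hmem : ∀ k, vc k ∈ annSub S := by
    intro k s hs
    have h0 := hv s hs
    have : b.repr (s ⬝ᵥ v) k = 0 := by rw [h0]; simp
    rw [dotProduct, map_sum, Finsupp.finsetSum_apply] at this
    have h2 : ∀ i, b.repr (s i * v i) k = (⟨s i, hS s hs i⟩ : Fl T) * b.repr (v i) k := by
      intro i
      have : s i * v i = (⟨s i, hS s hs i⟩ : Fl T) • v i := rfl
      rw [this, map_smul]; rfl
    simp_rw [h2] at this
    have h3 := congrArg (fun x : Fl T => (x : K)) this
    rw [dotProduct]
    push_cast at h3
    exact h3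
  let supp : Finset _ := Finset.univ.biUnion fun i => (b.repr (v i)).support
  have hv' : v = ∑ k ∈ supp, (b k) • vc k := by
    funext i
    rw [Finset.sum_apply]
    conv_lhs => rw [← b.linearCombination_repr (v i)]
    rw [Finsupp.linearCombination_apply, Finsupp.sum]
    rw [Finset.sum_subset (s₂ := supp)]
    · apply Finset.sum_congr rfl
      intro k _
      simp only [Pi.smul_apply, smul_eq_mul, vc]
      rw [mul_comm]; rfl
    · intro k hk
      exact Finset.mem_biUnion.mpr ⟨i, Finset.mem_univ _, hk⟩
    · intro k _ hk
      rw [Finsupp.notMem_support_iff] at hk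
      rw [hk, zero_smul]
  rw [hv']
  apply Submodule.sum_mem
  intro k _
  apply Submodule.smul_mem
  apply Submodule.subset_span
  exact ⟨hmem k, fun i => (b.repr (v i) k).2⟩

theorem DefOver.sup {T : Set K} {W W' : Submodule K (ι → K)} (h : DefOver T W) (h' : DefOver T W') :
    DefOver T (W ⊔ W') := by
  refine sup_le (h.trans (Submodule.span_mono ?_)) (h'.trans (Submodule.span_mono ?_))
  · rintro v ⟨h1, h2⟩; exact ⟨Submodule.mem_sup_left h1, h2⟩
  · rintro v ⟨h1, h2⟩; exact ⟨Submodule.mem_sup_right h1, h2⟩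

theorem defOver_span {T : Set K} {S : Set (ι → K)} (h : ∀ s ∈ S, ∀ i, s i ∈ Fl T) :
    DefOver T (Submodule.span K S) :=
  Submodule.span_mono fun s hs => ⟨Submodule.subset_span hs, h s hs⟩

theorem DefOver.param {T : Set K} {W : Submodule K (ι → K)} (h : DefOver T W) {v : ι → K}
    (hv : v ∈ W) : ∃ B : Finset K, B.card ≤ finrank K W ∧ ∀ i, v i ∈ Fl (T ∪ B) := by
  classical
  obtain ⟨b, hb, hspan, hli⟩ := exists_linearIndependent K {v | v ∈ W ∧ ∀ i, v i ∈ Fl T}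
  have hbf : b.Finite := LinearIndependent.setFinite hli
  have hWle : Submodule.span K b = W := by
    rw [hspan]
    apply le_antisymm
    · rw [Submodule.span_le]; rintro x ⟨hx, _⟩; exact hx
    · exact h
  have hcard : hbf.toFinset.card = finrank K W := by
    rw [← hWle]
    haveI := hbf.fintype
    rw [finrank_span_set_eq_card hli]
    congr 1
    ext; simp
  have hv2 : v ∈ Submodule.span K (hbf.toFinset : Set (ι → K)) := by
    rw [hbf.coe_toFinset, hWle]; exact hv
  rw [Submodule.mem_span_finset] at hv2
  obtain ⟨c, hc, hsum⟩ := hv2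
  refine ⟨hbf.toFinset.image c, hcard ▸ Finset.card_image_le, fun i => ?_⟩
  rw [← hsum, Finset.sum_apply]
  apply sum_mem
  intro a ha
  apply mul_mem
  · apply IntermediateField.subset_adjoin
    right; exact Finset.mem_coe.mpr (Finset.mem_image_of_mem c ha)
  · exact Fl_mono Set.subset_union_left ((hb (hbf.mem_toFinset.mp ha)).2 i)

/-- Affine version: a vector with prescribed coordinate `v j = 1`. -/
theorem defOver_param_affine {T : Set K} (S : Set (ι → K)) (hS : ∀ s ∈ S, ∀ i, s i ∈ Fl T)
    [DecidableEq ι] (j : ι) {v : ι → K} (hv : v ∈ annSub S) (hj : v j = 1) :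
    ∃ B : Finset K, B.card ≤ finrank K (annSub (insert (Pi.single j 1) S)) ∧
      ∀ i, v i ∈ Fl (T ∪ B) := by
  have h := defOver_ann T S hS
  have hex : ∃ v0 ∈ annSub S, (∀ i, v0 i ∈ Fl T) ∧ v0 j ≠ 0 := by
    by_contra hcon
    push Not at hcon
    have : annSub S ≤ LinearMap.ker (LinearMap.proj (R := K) (φ := fun _ : ι => K) j) := by
      refine h.trans (Submodule.span_le.mpr ?_)
      rintro x ⟨hx1, hx2⟩
      exact hcon x hx1 hx2
    have := this hv
    rw [LinearMap.mem_ker, LinearMap.proj_apply, hj] at this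
    exact one_ne_zero this
  obtain ⟨v0, h1, h2, h3⟩ := hex
  have hd : v - (v0 j)⁻¹ • v0 ∈ annSub (insert (Pi.single j 1) S) := by
    rintro s (rfl | hs)
    · simp [hj, h3]
    · exact (annSub S).sub_mem hv ((annSub S).smul_mem _ h1) s hs
  have hdef : DefOver T (annSub (insert (Pi.single j (1:K)) S)) := by
    apply defOver_ann
    rintro s (rfl | hs) i
    · by_cases hij : i = j
      · subst hij; simp
      · simp [hij]
    · exact hS s hs i
  obtain ⟨B, hB, hB2⟩ := hdef.param hd
  refine ⟨B, hB, fun i => ?_⟩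
  have : v i = (v - (v0 j)⁻¹ • v0) i + (v0 j)⁻¹ * v0 i := by simp
  rw [this]
  have hle : Fl T ≤ Fl (T ∪ (B : Set K)) := Fl_mono Set.subset_union_left
  exact add_mem (hB2 i) (mul_mem (inv_mem (hle (h2 j))) (hle (h2 i)))
end DefOverSec

open Module

section RankS
theorem exists_rows {F : Type*} [Field F] {m n : Type*} [Fintype m] [Fintype n]
    (A : Matrix m n F) :
    ∃ a : Fin A.rank → m, LinearIndependent F (A.submatrix a (id : n → n)).row := by
  obtain ⟨κ, a, ha, hspan, hli⟩ := exists_linearIndependent' F A.row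
  have : Finite κ := Finite.of_injective a ha
  have := Fintype.ofFinite κ
  have hc : Fintype.card κ = A.rank := by
    rw [Matrix.rank_eq_finrank_span_row, ← hspan]
    exact (finrank_span_eq_card hli).symm
  let e : Fin A.rank ≃ κ := (finCongr hc.symm).trans (Fintype.equivFin κ).symm
  refine ⟨a ∘ e, ?_⟩
  exact hli.comp e e.injective

/-- Matrices over a field: there is an invertible square submatrix of size the rank. -/
theorem exists_minor {F : Type*} [Field F] {m n : Type*} [Fintype m] [Fintype n]
    (A : Matrix m n F) :
    ∃ (a : Fin A.rank → m) (b : Fin A.rank → n), (A.submatrix a b).det ≠ 0 := by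
  obtain ⟨a, ha⟩ := exists_rows A
  have h1 : (A.submatrix a (id : n → n)).rank = A.rank := by
    rw [ha.rank_matrix, Fintype.card_fin]
  obtain ⟨b, hb⟩ := exists_rows (A.submatrix a (id : n → n)).transpose
  have h2 : ((A.submatrix a (id : n → n)).transpose).rank = A.rank := by rw [Matrix.rank_transpose, h1]
  refine ⟨a, b ∘ (finCongr h2.symm), ?_⟩
  have hb' := hb.comp (finCongr h2.symm) (finCongr h2.symm).injective
  have : (A.submatrix a (b ∘ (finCongr h2.symm))).transpose = 
     (((A.submatrix a (id : n → n)).transpose.submatrix b id).submatrix (finCongr h2.symm) id) := by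
    ext i j; rfl
  rw [← Matrix.det_transpose, this]
  have hu := Matrix.linearIndependent_rows_iff_isUnit.mp hb'
  exact ((Matrix.isUnit_iff_isUnit_det _).mp hu).ne_zero

theorem rank_spec {R F K : Type*} [CommRing R] [Field F] [Field K] (f : R →+* F) (g : R →+* K)
    (hg : Function.Injective g) {m n : Type*} [Fintype m] [Fintype n] [DecidableEq m]
    [DecidableEq n] (A : Matrix m n R) : (A.map f).rank ≤ (A.map g).rank := by
  obtain ⟨a, b, h⟩ := exists_minor (A.map f)
  have h0 : (A.submatrix a b).det ≠ 0 := by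
    intro h0
    apply h
    have : (A.map f).submatrix a b = f.mapMatrix (A.submatrix a b) := rfl
    rw [this, ← RingHom.map_det, h0, map_zero]
  have h1 : ((A.map g).submatrix a b).det ≠ 0 := by
    have : (A.map g).submatrix a b = g.mapMatrix (A.submatrix a b) := rfl
    rw [this, ← RingHom.map_det]
    exact fun h => h0 (hg (h.trans (map_zero g).symm))
  have h2 : ((A.map g).submatrix a b).rank = (A.map f).rank := by
    rw [Matrix.rank_of_isUnit _ ((Matrix.isUnit_iff_isUnit_det _).mpr (isUnit_iff_ne_zero.mpr h1)),
      Fintype.card_fin]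
  rw [← h2]
  have e : (A.map g).submatrix a b = ((A.map g).submatrix a id) * ((1 : Matrix n n K).submatrix id b) := by
    ext i j; simp [Matrix.mul_apply, Matrix.one_apply]
  have e2 : (A.map g).submatrix a id = ((1 : Matrix m m K).submatrix a id) * (A.map g) := by
    ext i j; simp [Matrix.mul_apply, Matrix.one_apply]
  rw [e, e2]
  exact (Matrix.rank_mul_le_left _ _).trans (Matrix.rank_mul_le_right _ _)
end RankS


section USec
variable {K : Type*} [Field K] [Algebra ℚ K] {n : ℕ}

/-- coordinate flag -/
def Efl (K : Type*) [Field K] (n j : ℕ) : Submodule K (Fin n → K) :=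
  annSub {v | ∃ i : Fin n, j ≤ i.val ∧ v = Pi.single i 1}

theorem mem_Efl {j : ℕ} {v : Fin n → K} : v ∈ Efl K n j ↔ ∀ i : Fin n, j ≤ i.val → v i = 0 := by
  rw [Efl, mem_annSub]
  constructor
  · intro h i hi
    have := h _ ⟨i, hi, rfl⟩
    simpa using this
  · rintro h _ ⟨i, hi, rfl⟩
    simpa using h i hi

theorem Efl_succ (j : ℕ) (hj : j < n) :
    Efl K n (j+1) = Efl K n j ⊔ K ∙ (Pi.single (⟨j, hj⟩ : Fin n) (1:K)) := by
  apply le_antisymm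
  · intro v hv
    rw [mem_Efl] at hv
    have : v = (v - v ⟨j,hj⟩ • Pi.single (⟨j, hj⟩ : Fin n) (1:K)) + v ⟨j,hj⟩ • Pi.single (⟨j, hj⟩ : Fin n) (1:K) := by simp
    rw [this]
    apply Submodule.add_mem_sup
    · rw [mem_Efl]
      intro i hi
      by_cases h : i = ⟨j, hj⟩
      · subst h; simp
      · have : i.val ≠ j := fun h' => h (Fin.ext h')
        simp [h, hv i (by omega)]
    · exact Submodule.smul_mem _ _ (Submodule.mem_span_singleton_self _)
  · apply sup_le
    · intro v hv
      rw [mem_Efl] at hv ⊢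
      exact fun i hi => hv i (by omega)
    · rw [Submodule.span_singleton_le_iff_mem, mem_Efl]
      intro i hi
      have : i ≠ ⟨j, hj⟩ := by rintro rfl; simp at hi
      simp [this]

theorem single_notMem_Efl (j : ℕ) (hj : j < n) : Pi.single (⟨j, hj⟩ : Fin n) (1:K) ∉ Efl K n j := by
  rw [mem_Efl]; intro h; have := h ⟨j, hj⟩ le_rfl; simp at this

theorem Efl_map (X : Matrix (Fin n) (Fin n) K) (hX : ∀ a b, X a b ≠ 0 → a < b) (j : ℕ) :
    (Efl K n (j+1)).map (toLin' X) ≤ Efl K n j := by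
  rintro _ ⟨v, hv, rfl⟩
  rw [SetLike.mem_coe, mem_Efl] at hv
  rw [mem_Efl]
  intro i hi
  rw [toLin'_apply, mulVec, dotProduct]
  apply Finset.sum_eq_zero
  intro k _
  by_cases h : X i k = 0
  · simp [h]
  · have := hX i k h
    rw [hv k (by have : i.val < k.val := this; omega), mul_zero]

theorem Efl_mono {i j : ℕ} (h : i ≤ j) : Efl K n i ≤ Efl K n j := by
  intro v hv
  rw [mem_Efl] at hv ⊢
  exact fun a ha => hv a (by omega)

theorem Efl_zero : Efl K n 0 = ⊥ := by
  rw [eq_bot_iff]; intro v hv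
  rw [mem_Efl] at hv
  rw [Submodule.mem_bot]; funext i; exact hv i (by omega)

theorem Efl_top {j : ℕ} (h : n ≤ j) : Efl K n j = ⊤ := by
  rw [eq_top_iff]; intro v _
  rw [mem_Efl]; intro i hi; omega

theorem Efl_map' (X : Matrix (Fin n) (Fin n) K) (hX : ∀ a b, X a b ≠ 0 → a < b) (j : ℕ) :
    (Efl K n j).map (toLin' X) ≤ Efl K n j := by
  cases j with
  | zero => rw [Efl_zero]; simp
  | succ j => exact (Efl_map X hX j).trans (Efl_mono (by omega))

theorem Efl_map_pow (X : Matrix (Fin n) (Fin n) K) (hX : ∀ a b, X a b ≠ 0 → a < b) (m j : ℕ) :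
    (Efl K n (j+m)).map (toLin' X ^ m) ≤ Efl K n j := by
  induction m with
  | zero => rw [pow_zero, Module.End.one_eq_id, Submodule.map_id]; rfl
  | succ m ih => 
    rw [map_pow_succ_in]
    exact (Submodule.map_mono (Efl_map X hX (j+m))).trans ih

theorem pow_entries {T : Set K} (A : Matrix (Fin n) (Fin n) K) (hA : ∀ a b, A a b ∈ Fl T) (d : ℕ) :
    ∀ a b, (A ^ d) a b ∈ Fl T := by
  induction d with
  | zero => 
    intro a b; rw [pow_zero, one_apply]; split_ifs
    · exact one_mem _
    · exact zero_mem _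
  | succ d ih =>
    intro a b
    rw [pow_succ, mul_apply]
    exact sum_mem fun k _ => mul_mem (ih a k) (hA k b)

theorem boundU (X : Matrix (Fin n) (Fin n) K) (hX : ∀ a b, X a b ≠ 0 → a < b) :
    ∀ j, j ≤ n → finrank K (Efl K n j) = j ∧ ∃ T : Finset K,
      T.card + nnS n (sdim (toLin' X) (Efl K n j)) ≤ ∑ i ∈ Finset.range j, i ∧ 
      ∀ a b : Fin n, b.val < j → X a b ∈ Fl (T : Set K) := by
  classical
  intro j
  induction j with
  | zero =>
    intro _
    refine ⟨by rw [Efl_zero]; simp, ∅, ?_, by simp⟩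
    have h0 : ∀ m, sdim (toLin' X) (Efl K n 0) m = 0 := by
      intro m
      unfold sdim; rw [Efl_zero, Submodule.map_bot]; simp
    simp [nnS, h0]
  | succ j ih =>
    intro hj
    obtain ⟨hfr, T, hT, hTX⟩ := ih (by omega)
    set f := toLin' X with hf
    set e : Fin n → K := Pi.single (⟨j, hj⟩ : Fin n) (1:K) with he
    have hn : n ≠ 0 := by omega
    have h0 : sdim f (Efl K n (j+1)) ((n-1)+1) = 0 := by
      have h1 : (Efl K n (j+1)).map (f ^ n) ≤ ⊥ := by
        rw [← Efl_zero]
        refine le_trans (Submodule.map_mono ?_) (Efl_map_pow X hX n 0)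
        rw [Efl_top (by omega : n ≤ 0 + n)]; exact le_top
      rw [Nat.sub_add_cancel (by omega), sdim, eq_bot_iff.mpr h1]; simp
    obtain ⟨d, hdn, hd⟩ := step_exists f (Efl K n j) (Efl K n (j+1)) e (Efl_succ j hj)
      (single_notMem_Efl j hj) (n-1) h0
    have hfr' : finrank K (Efl K n (j+1)) = j+1 := by
      have := hd 0
      simpa [sdim_zero, hfr] using this
    refine ⟨hfr', ?_⟩
    have hmem := step_U f _ _ e (Efl_succ j hj) (single_notMem_Efl j hj) (Efl_map X hX j) d hd
    have hdef1 : DefOver (T : Set K) ((Efl K n j).map f) := by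
      have : (Efl K n j).map f = Submodule.span K {v | ∃ b : Fin n, b.val < j ∧ v = X.col b} := by
        apply le_antisymm
        · rintro _ ⟨v, hv, rfl⟩
          rw [SetLike.mem_coe, mem_Efl] at hv
          have : f v = ∑ b, v b • X.col b := by
            funext a
            simp [hf, mulVec, dotProduct, Finset.sum_apply, mul_comm]
          rw [this]
          apply Submodule.sum_mem
          intro b _
          by_cases hb : b.val < j
          · exact Submodule.smul_mem _ _ (Submodule.subset_span ⟨b, hb, rfl⟩)
          · rw [hv b (by omega), zero_smul]; exact Submodule.zero_mem _
        · rw [Submodule.span_le]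
          rintro _ ⟨b, hb, rfl⟩
          refine ⟨Pi.single b 1, ?_, ?_⟩
          · rw [SetLike.mem_coe, mem_Efl]
            intro i hi
            have : i ≠ b := by rintro rfl; omega
            simp [this]
          · rw [hf, toLin'_apply, mulVec_single_one]
      rw [this]
      apply defOver_span
      rintro _ ⟨b, hb, rfl⟩ i
      exact hTX i b hb
    have hdef2 : DefOver (T : Set K) (LinearMap.ker (f ^ d) ⊓ Efl K n j) := by
      let Y : Matrix (Fin n) (Fin n) K := fun a b => if b.val < j then X a b else 0
      have hY : ∀ v ∈ Efl K n j, Y *ᵥ v = X *ᵥ v := by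
        intro v hv
        rw [mem_Efl] at hv
        funext a
        simp only [mulVec, dotProduct]
        apply Finset.sum_congr rfl
        intro b _
        simp only [Y]
        split_ifs with h
        · rfl
        · rw [hv b (by omega)]; simp
      have hYd : ∀ d, ∀ v ∈ Efl K n j, (Y ^ d) *ᵥ v = (X ^ d) *ᵥ v := by
        intro d
        induction d with
        | zero => intro v _; simp
        | succ d ih => 
          intro v hv
          rw [pow_succ, pow_succ, ← mulVec_mulVec, ← mulVec_mulVec, hY v hv]
          apply ih
          exact Efl_map' X hX j ⟨v, hv, toLin'_apply X v⟩
      have : LinearMap.ker (f ^ d) ⊓ Efl K n j = 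
        annSub ({v | ∃ a, v = (Y ^ d).row a} ∪ {v | ∃ i : Fin n, j ≤ i.val ∧ v = Pi.single i 1}) := by
        have hu : annSub ({v | ∃ a, v = (Y ^ d).row a} ∪ {v | ∃ i : Fin n, j ≤ i.val ∧ v = Pi.single i 1})
           = annSub {v | ∃ a, v = (Y ^ d).row a} ⊓ Efl K n j := by
          ext v
          simp only [Efl, Submodule.mem_inf, mem_annSub, Set.mem_union, or_imp, forall_and]
        rw [hu]
        ext v
        rw [Submodule.mem_inf, Submodule.mem_inf]
        apply and_congr_left
        intro hv
        rw [LinearMap.mem_ker, hf, ← toLin'_pow, toLin'_apply, ← hYd d v hv, mem_annSub]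
        constructor
        · rintro h _ ⟨a, rfl⟩
          exact congrFun h a
        · intro h; funext a; exact h _ ⟨a, rfl⟩
      rw [this]
      apply defOver_ann
      rintro s (⟨a, rfl⟩ | ⟨i, _, rfl⟩) k
      · apply pow_entries
        intro a b
        simp only [Y]
        split_ifs with h
        · exact hTX a b h
        · exact zero_mem _
      · by_cases hk : k = i
        · subst hk; simp
        · simp [hk]
    obtain ⟨B, hB, hBv⟩ := (hdef1.sup hdef2).param hmem
    have hdim := dim_sum f (Efl K n j) (Efl_map' X hX j) d
    refine ⟨T ∪ B, ?_, ?_⟩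
    · rw [nnS_step n _ _ d (by omega) (sdim_anti f _ (Efl_map' X hX j)) hd, Finset.sum_range_succ]
      have := Finset.card_union_le T B
      have := sdim_anti f _ (Efl_map' X hX j) d
      omega
    · intro a b hb
      rw [Finset.coe_union]
      by_cases h : b.val < j
      · exact Fl_mono Set.subset_union_left (hTX a b h)
      · have : b = ⟨j, hj⟩ := Fin.ext (by simp; omega)
        subst this
        have := hBv a
        rw [hf, he, toLin'_apply, mulVec_single_one] at this
        exact this
end USec


section VSec
variable {K : Type*} [Field K] [Algebra ℚ K] {n : ℕ}

/-- flag adapted to the word `w`. -/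
def Ffl (v : Matrix (Fin n) (Fin n) K) (w : Equiv.Perm (Fin n)) (p : ℕ) : Submodule K (Fin n → K) :=
  annSub {s | ∃ q : Fin n, p ≤ q.val ∧ s = v.row (w q)}

theorem mem_Ffl {v : Matrix (Fin n) (Fin n) K} {w : Equiv.Perm (Fin n)} {p : ℕ} {x : Fin n → K} :
    x ∈ Ffl v w p ↔ ∀ q : Fin n, p ≤ q.val → (v *ᵥ x) (w q) = 0 := by
  rw [Ffl, mem_annSub]
  constructor
  · intro h q hq; exact h _ ⟨q, hq, rfl⟩
  · rintro h _ ⟨q, hq, rfl⟩; exact h q hq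

theorem Ffl_mono {v : Matrix (Fin n) (Fin n) K} {w : Equiv.Perm (Fin n)} {i j : ℕ} (h : i ≤ j) :
    Ffl v w i ≤ Ffl v w j := by
  intro x hx
  rw [mem_Ffl] at hx ⊢
  exact fun a ha => hx a (by omega)

theorem mulVec_col_of_mul_eq_one {v u : Matrix (Fin n) (Fin n) K} (hvu : v * u = 1) (k : Fin n) :
    v *ᵥ u.col k = Pi.single k 1 := by
  rw [← mulVec_single_one, mulVec_mulVec, hvu, one_mulVec]

theorem Ffl_succ {v u : Matrix (Fin n) (Fin n) K} (hvu : v * u = 1) (w : Equiv.Perm (Fin n))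
    (p : ℕ) (hp : p < n) :
    Ffl v w (p+1) = Ffl v w p ⊔ K ∙ (u.col (w ⟨p, hp⟩)) := by
  apply le_antisymm
  · intro x hx
    rw [mem_Ffl] at hx
    have : x = (x - (v *ᵥ x) (w ⟨p, hp⟩) • u.col (w ⟨p, hp⟩)) + (v *ᵥ x) (w ⟨p, hp⟩) • u.col (w ⟨p, hp⟩) := by simp
    rw [this]
    apply Submodule.add_mem_sup
    · rw [mem_Ffl]
      intro i hi
      rw [mulVec_sub, mulVec_smul, mulVec_col_of_mul_eq_one hvu]
      by_cases h : i = ⟨p, hp⟩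
      · subst h; simp
      · have : i.val ≠ p := fun h' => h (Fin.ext h')
        simp [h, hx i (by omega)]
    · exact Submodule.smul_mem _ _ (Submodule.mem_span_singleton_self _)
  · apply sup_le
    · exact Ffl_mono (by omega)
    · rw [Submodule.span_singleton_le_iff_mem, mem_Ffl]
      intro i hi
      rw [mulVec_col_of_mul_eq_one hvu]
      have : i ≠ ⟨p, hp⟩ := by rintro rfl; simp at hi
      simp [this]

theorem col_notMem_Ffl {v u : Matrix (Fin n) (Fin n) K} (hvu : v * u = 1) (w : Equiv.Perm (Fin n))
    (p : ℕ) (hp : p < n) : u.col (w ⟨p, hp⟩) ∉ Ffl v w p := by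
  rw [mem_Ffl]; intro h; have := h ⟨p, hp⟩ le_rfl
  rw [mulVec_col_of_mul_eq_one hvu] at this; simp at this

theorem Ffl_top {v : Matrix (Fin n) (Fin n) K} {w : Equiv.Perm (Fin n)} : Ffl v w n = ⊤ := by
  rw [eq_top_iff]; intro x _
  rw [mem_Ffl]; intro i hi; omega

theorem Ffl_zero {v u : Matrix (Fin n) (Fin n) K} (huv : u * v = 1) {w : Equiv.Perm (Fin n)} :
    Ffl v w 0 = ⊥ := by
  rw [eq_bot_iff]; intro x hx
  rw [mem_Ffl] at hx
  rw [Submodule.mem_bot]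
  have : v *ᵥ x = 0 := by
    funext i
    have := hx (w.symm i) (by omega)
    simpa using this
  have h2 : u *ᵥ (v *ᵥ x) = x := by rw [mulVec_mulVec, huv, one_mulVec]
  rw [← h2, this, mulVec_zero]

theorem Ffl_map {v u N : Matrix (Fin n) (Fin n) K} (hvu : v * u = 1) (w : Equiv.Perm (Fin n))
    (hN : ∀ a b, N a b ≠ 0 → w.symm a < w.symm b) (p : ℕ) :
    (Ffl v w (p+1)).map (toLin' (u * N * v)) ≤ Ffl v w p := by
  rintro _ ⟨x, hx, rfl⟩
  rw [SetLike.mem_coe, mem_Ffl] at hx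
  rw [mem_Ffl]
  intro i hi
  have : v *ᵥ (toLin' (u * N * v)) x = N *ᵥ (v *ᵥ x) := by
    rw [toLin'_apply, mulVec_mulVec, mulVec_mulVec, ← mul_assoc, ← mul_assoc, hvu, one_mul]
  rw [this]
  generalize v *ᵥ x = y at hx
  rw [mulVec, dotProduct]
  apply Finset.sum_eq_zero
  intro k _
  by_cases h : N (w i) k = 0
  · simp [h]
  · have := hN _ k h
    rw [Equiv.symm_apply_apply] at this
    have h2 := hx (w.symm k) (by have : i.val < (w.symm k).val := this; omega)
    rw [Equiv.apply_symm_apply] at h2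
    rw [h2, mul_zero]

theorem Ffl_map_pow {v u N : Matrix (Fin n) (Fin n) K} (hvu : v * u = 1) (w : Equiv.Perm (Fin n))
    (hN : ∀ a b, N a b ≠ 0 → w.symm a < w.symm b) (m j : ℕ) :
    (Ffl v w (j+m)).map (toLin' (u * N * v) ^ m) ≤ Ffl v w j := by
  induction m with
  | zero => rw [pow_zero, Module.End.one_eq_id, Submodule.map_id]; rfl
  | succ m ih => 
    rw [map_pow_succ_in]
    exact (Submodule.map_mono (Ffl_map hvu w hN (j+m))).trans ih

theorem Ffl_map' {v u N : Matrix (Fin n) (Fin n) K} (huv : u * v = 1) (hvu : v * u = 1) 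
    (w : Equiv.Perm (Fin n))
    (hN : ∀ a b, N a b ≠ 0 → w.symm a < w.symm b) (j : ℕ) :
    (Ffl v w j).map (toLin' (u * N * v)) ≤ Ffl v w j := by
  cases j with
  | zero => rw [Ffl_zero huv]; simp
  | succ j => exact (Ffl_map hvu w hN j).trans (Ffl_mono (by omega))

theorem finrank_annSub (A : Submodule K (Fin n → K)) :
    finrank K (annSub (A : Set (Fin n → K))) + finrank K A = n := by
  have h := Subspace.finrank_add_finrank_dualAnnihilator_eq A
  have h2 : A.dualAnnihilator = (annSub (A : Set (Fin n → K))).map 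
      (dotProductEquiv K (Fin n) : (Fin n → K) →ₗ[K] _) := by
    ext φ
    rw [Submodule.mem_dualAnnihilator]
    constructor
    · intro hφ
      refine ⟨(dotProductEquiv K (Fin n)).symm φ, ?_, by simp⟩
      intro s hs
      have := hφ s hs
      conv at this => rw [← (dotProductEquiv K (Fin n)).apply_symm_apply φ, dotProductEquiv_apply_apply]
      rw [dotProduct_comm]; exact this
    · rintro ⟨x, hx, rfl⟩ s hs
      have := hx s hs
      rw [dotProduct_comm] at this
      exact this
  rw [h2, LinearEquiv.finrank_map_eq] at h
  simp at h
  omega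

theorem annSub_span (S : Set (Fin n → K)) : annSub (Submodule.span K S : Set (Fin n → K)) = annSub S := by
  ext x
  rw [mem_annSub, mem_annSub]
  constructor
  · exact fun h s hs => h s (Submodule.subset_span hs)
  · intro h s hs
    induction hs using Submodule.span_induction with
    | mem s hs => exact h s hs
    | zero => simp
    | add a b _ _ ha hb => rw [add_dotProduct, ha, hb, add_zero]
    | smul c a _ ha => rw [smul_dotProduct, ha, smul_zero]


theorem boundV (u v N : Matrix (Fin n) (Fin n) K) (huv : u * v = 1) (hvu : v * u = 1)
    (hv0 : ∀ a b, b < a → v a b = 0) (hv1 : ∀ a, v a a = 1) (hu0 : ∀ a b, b < a → u a b = 0)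
    (w : Equiv.Perm (Fin n)) (hN : ∀ a b, N a b ≠ 0 → w.symm a < w.symm b) (T0 : Set K)
    (hT0 : ∀ a b, (u * N * v) a b ∈ Fl T0) :
    ∀ k p, p + k = n → finrank K (Ffl v w p) = p ∧ ∃ T : Finset K,
      T.card + nnS n (sdim (toLin' (u * N * v)) (Ffl v w p)) ≤ 
        nnS n (sdim (toLin' (u * N * v)) ⊤) + ∑ p' ∈ Finset.univ.filter (fun p' : Fin n => p ≤ p'.val),
          (Finset.univ.filter (fun q : Fin n => p' < q ∧ w p' < w q)).card ∧ 
      ∀ q : Fin n, p ≤ q.val → ∀ b, v (w q) b ∈ Fl (T0 ∪ T) := by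
  classical
  intro k
  induction k with
  | zero =>
    intro p hp
    obtain rfl : p = n := by omega
    refine ⟨by rw [Ffl_top]; simp, ∅, ?_, fun q hq => by omega⟩
    rw [Ffl_top]; simp
  | succ k ih =>
    intro p hp
    obtain ⟨hfr, T, hT, hTv⟩ := ih (p+1) (by omega)
    have hpn : p < n := by omega
    set X := u * N * v with hXdef
    set f := toLin' X with hf
    set P : Fin n := ⟨p, hpn⟩ with hP
    have h0 : sdim f (Ffl v w (p+1)) ((n-1)+1) = 0 := by
      have h1 : (Ffl v w (p+1)).map (f ^ n) ≤ ⊥ := by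
        rw [← Ffl_zero huv (w := w)]
        refine le_trans (Submodule.map_mono ?_) (Ffl_map_pow hvu w hN n 0)
        rw [zero_add, Ffl_top]; exact le_top
      rw [Nat.sub_add_cancel (by omega), sdim, eq_bot_iff.mpr h1]; simp
    obtain ⟨d, hdn, hd⟩ := step_exists f (Ffl v w p) (Ffl v w (p+1)) _ (Ffl_succ hvu w p hpn)
      (col_notMem_Ffl hvu w p hpn) (n-1) h0
    have hfr' : finrank K (Ffl v w p) = p := by
      have := hd 0
      simp [sdim_zero, hfr] at this
      omega
    refine ⟨hfr', ?_⟩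
    have hinv := Ffl_map' huv hvu w hN (p+1)
    have hinvp := Ffl_map' huv hvu w hN p
    have hker := step_V f _ _ (Ffl_mono (v := v) (w := w) (by omega : p ≤ p+1)) d hd
    set F := Ffl v w (p+1) with hF
    set A : Submodule K (Fin n → K) := F.map f ⊔ (LinearMap.ker (f ^ d) ⊓ F) with hA
    have hAF : A ≤ Ffl v w p := sup_le (Ffl_map hvu w hN p) hker
    have hle0 : Fl T0 ≤ Fl (T0 ∪ (T : Set K)) := Fl_mono Set.subset_union_left
    have hdefF : DefOver (T0 ∪ (T : Set K)) F := by
      apply defOver_ann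
      rintro s ⟨q, hq, rfl⟩ i
      exact hTv q hq i
    have hdef1 : DefOver (T0 ∪ (T : Set K)) (F.map f) := by
      intro x hx
      obtain ⟨y, hy, rfl⟩ := hx
      have hy2 := hdefF hy
      have := Submodule.mem_map_of_mem (f := f) hy2
      rw [Submodule.map_span] at this
      refine Submodule.span_mono ?_ this
      rintro _ ⟨z, ⟨hz1, hz2⟩, rfl⟩
      refine ⟨Submodule.mem_map_of_mem hz1, fun i => ?_⟩
      rw [hf, toLin'_apply, mulVec, dotProduct]
      exact sum_mem fun j _ => mul_mem (hle0 (hT0 i j)) (hz2 j)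
    have hdef2 : DefOver (T0 ∪ (T : Set K)) (LinearMap.ker (f ^ d) ⊓ F) := by
      have : LinearMap.ker (f ^ d) ⊓ F = 
        annSub ({s | ∃ a, s = (X ^ d).row a} ∪ {s | ∃ q : Fin n, p + 1 ≤ q.val ∧ s = v.row (w q)}) := by
        have hu : annSub ({s | ∃ a, s = (X ^ d).row a} ∪ {s | ∃ q : Fin n, p + 1 ≤ q.val ∧ s = v.row (w q)})
           = annSub {s | ∃ a, s = (X ^ d).row a} ⊓ F := by
          ext x
          simp only [hF, Ffl, Submodule.mem_inf, mem_annSub, Set.mem_union, or_imp, forall_and]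
        rw [hu]
        congr 1
        ext x
        rw [LinearMap.mem_ker, hf, ← toLin'_pow, toLin'_apply, mem_annSub]
        constructor
        · rintro h _ ⟨a, rfl⟩
          exact congrFun h a
        · intro h; funext a; exact h _ ⟨a, rfl⟩
      rw [this]
      apply defOver_ann
      rintro s (⟨a, rfl⟩ | ⟨q, hq, rfl⟩) i
      · exact hle0 (pow_entries X hT0 d a i)
      · exact hTv q hq i
    have hdefA : DefOver (T0 ∪ (T : Set K)) A := hdef1.sup hdef2
    set S0 : Set (Fin n → K) := {x | x ∈ A ∧ ∀ i, x i ∈ Fl (T0 ∪ (T : Set K))} with hS0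
    have hspan : Submodule.span K S0 = A := by
      apply le_antisymm
      · rw [Submodule.span_le]; rintro x ⟨hx, _⟩; exact hx
      · exact hdefA
    have hannS0 : annSub S0 = annSub (A : Set (Fin n → K)) := by
      rw [← annSub_span S0, hspan]
    set S : Set (Fin n → K) := S0 ∪ {x | ∃ i : Fin n, i < w P ∧ x = Pi.single i 1} with hS
    have hrowA : ∀ q : Fin n, p ≤ q.val → v.row (w q) ∈ annSub (A : Set (Fin n → K)) := by
      intro q hq s hs
      have := mem_Ffl.mp (hAF hs) q hq
      rw [dotProduct_comm]; exact this
    have hvS : v.row (w P) ∈ annSub S := by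
      rintro s (hs | ⟨i, hi, rfl⟩)
      · have := hrowA P (le_refl _)
        rw [← hannS0] at this
        exact this s hs
      · simpa using hv0 _ _ hi
    obtain ⟨B, hB, hBv⟩ := defOver_param_affine (T := T0 ∪ (T : Set K)) S (by
      rintro s (hs | ⟨i, hi, rfl⟩) j
      · exact hs.2 j
      · by_cases hk : j = i
        · subst hk; simp
        · simp [hk]) (w P) hvS (hv1 _)
    set W0 := annSub (insert (Pi.single (w P) 1) S) with hW0
    have hW0A : W0 ≤ annSub (A : Set (Fin n → K)) := by
      rw [← hannS0]
      intro x hx s hs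
      exact hx s (Or.inr (Or.inl hs))
    have hW0z : ∀ x ∈ W0, ∀ i, i ≤ w P → x i = 0 := by
      intro x hx i hi
      rcases hi.lt_or_eq with h | h
      · have := hx (Pi.single i 1) (Or.inr (Or.inr ⟨i, h, rfl⟩))
        simpa using this
      · subst h
        have := hx _ (Or.inl rfl)
        simpa using this
    let Q : Finset (Fin n) := Finset.univ.filter (fun q => P ≤ q ∧ w q ≤ w P)
    let C : Submodule K (Fin n → K) := Submodule.span K (Set.range fun q : Q => v.row (w q))
    have hli0 : LinearIndependent K v.row := by
      rw [linearIndependent_rows_iff_isUnit]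
      exact IsUnit.of_mul_eq_one u hvu
    have hCdim : finrank K C = Q.card := by
      have : LinearIndependent K (fun q : Q => v.row (w q)) :=
        hli0.comp (fun q : Q => w q) (fun a b h => Subtype.ext (w.injective h))
      rw [finrank_span_eq_card this, Fintype.card_coe]
    have hCA : C ≤ annSub (A : Set (Fin n → K)) := by
      rw [Submodule.span_le]
      rintro _ ⟨q, rfl⟩
      exact hrowA q (Finset.mem_filter.mp q.2).2.1
    have hCW : C ⊓ W0 = ⊥ := by
      rw [eq_bot_iff]
      rintro x ⟨hxC, hxW⟩
      rw [Submodule.mem_bot]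
      have h1 : ∀ i, w P < i → (x ᵥ* u) i = 0 := by
        have : C ≤ (annSub {s | ∃ i, w P < i ∧ s = u.col i}) := by
          rw [Submodule.span_le]
          rintro _ ⟨q, rfl⟩ _ ⟨i, hi, rfl⟩
          rw [dotProduct_comm]
          change (v * u) (w q) i = 0
          rw [hvu, one_apply_ne]
          have := (Finset.mem_filter.mp q.2).2.2
          intro h; rw [h] at this; exact absurd hi (not_lt.mpr this)
        intro i hi
        have := this hxC _ ⟨i, hi, rfl⟩
        rw [dotProduct_comm] at this; exact this
      have h2 : ∀ i, i ≤ w P → (x ᵥ* u) i = 0 := by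
        intro i hi
        rw [vecMul, dotProduct]
        apply Finset.sum_eq_zero
        intro j _
        by_cases hj : j ≤ w P
        · rw [hW0z x hxW j hj, zero_mul]
        · rw [hu0 j i (by omega), mul_zero]
      have h3 : x ᵥ* u = 0 := by
        funext i
        by_cases hi : i ≤ w P
        · exact h2 i hi
        · exact h1 i (by omega)
      have h4 : (x ᵥ* u) ᵥ* v = x := by rw [vecMul_vecMul, huv, vecMul_one]
      rw [← h4, h3, zero_vecMul]
    have hdimW : finrank K W0 + Q.card ≤ finrank K (annSub (A : Set (Fin n → K))) := by
      have h1 := Submodule.finrank_sup_add_finrank_inf_eq C W0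
      rw [hCW, finrank_bot, hCdim] at h1
      have h2 := Submodule.finrank_mono (sup_le hCA hW0A)
      omega
    have hAdim := dim_sum f F hinv d
    rw [← hA] at hAdim
    have hAnn := finrank_annSub A
    have hQ : Q.card + (Finset.univ.filter (fun q : Fin n => P < q ∧ w P < w q)).card + p = n := by
      have h1 : Disjoint Q (Finset.univ.filter (fun q : Fin n => P < q ∧ w P < w q)) := by
        rw [Finset.disjoint_left]
        intro a ha hb
        exact absurd (Finset.mem_filter.mp hb).2.2 (not_lt.mpr (Finset.mem_filter.mp ha).2.2)
      rw [← Finset.card_union_of_disjoint h1]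
      have h2 : Q ∪ (Finset.univ.filter (fun q : Fin n => P < q ∧ w P < w q)) = Finset.Ici P := by
        ext q
        simp only [Q, Finset.mem_union, Finset.mem_filter, Finset.mem_univ, true_and, Finset.mem_Ici]
        constructor
        · rintro (h | h)
          · exact h.1
          · exact h.1.le
        · intro h
          by_cases hq : w q ≤ w P
          · exact Or.inl ⟨h, hq⟩
          · right
            refine ⟨lt_of_le_of_ne h ?_, not_le.mp hq⟩
            rintro rfl; exact hq le_rfl
      rw [h2, Fin.card_Ici]
      simp [hP]; omega
    refine ⟨T ∪ B, ?_, ?_⟩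
    · have hs := nnS_step n _ _ d (by omega) (sdim_anti f _ hinvp) hd
      have h1 := Finset.card_union_le T B
      have h2 := sdim_anti f _ hinvp d
      have h3 : Finset.univ.filter (fun p' : Fin n => p ≤ p'.val) = 
          insert P (Finset.univ.filter (fun p' : Fin n => p + 1 ≤ p'.val)) := by
        ext q
        simp only [Finset.mem_filter, Finset.mem_univ, true_and, Finset.mem_insert, hP, Fin.ext_iff]
        omega
      rw [h3, Finset.sum_insert (by simp [hP])]
      have e1 := hd d
      have e2 := hd (d+1)
      simp at e1 e2
      omega
    · intro q hq b
      rw [Finset.coe_union, ← Set.union_assoc]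
      by_cases h : p + 1 ≤ q.val
      · exact Fl_mono Set.subset_union_left (hTv q h b)
      · have : q = P := Fin.ext (by simp [hP]; omega)
        subst this
        exact hBv b
end VSec


theorem inj_of_indep {R : Type*} [CommRing R] [IsDomain R] [Algebra ℚ R] {ι : Type*} [Fintype ι]
    (θ : R →ₐ[ℚ] R) (x : ι → R) (J : Finset ι) 
    (hJ : AlgebraicIndepOn ℚ (θ ∘ x) (J : Set ι))
    (hmax : ∀ J' : Finset ι, AlgebraicIndepOn ℚ x (J' : Set ι) → J'.card ≤ J.card) :
    ∀ a ∈ Algebra.adjoin ℚ (Set.range x), θ a = 0 → a = 0 := by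
  classical
  have hJx : AlgebraicIndepOn ℚ x (J : Set ι) := by
    exact AlgebraicIndependent.of_comp θ hJ
  have halg : ∀ i, IsAlgebraic (Algebra.adjoin ℚ (x '' (J : Set ι))) (x i) := by
    intro i
    by_contra hcon
    have h1 := AlgebraicIndepOn.insert hJx hcon
    have hi : i ∉ J := by
      intro hi
      apply hcon
      exact isAlgebraic_algebraMap (⟨x i, Algebra.subset_adjoin ⟨i, hi, rfl⟩⟩ : Algebra.adjoin ℚ (x '' (J : Set ι)))
    have := hmax (insert i J) (by rw [Finset.coe_insert]; exact h1)
    rw [Finset.card_insert_of_notMem hi] at this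
    omega
  intro a ha hθ
  have haa : IsAlgebraic (Algebra.adjoin ℚ (x '' (J : Set ι))) a := by
    have hle : Algebra.adjoin ℚ (Set.range x) ≤ 
        (Subalgebra.algebraicClosure (Algebra.adjoin ℚ (x '' (J : Set ι))) R).restrictScalars ℚ := by
      rw [Algebra.adjoin_le_iff]
      rintro _ ⟨i, rfl⟩
      exact halg i
    exact hle ha
  by_contra hne
  obtain ⟨b, hb0, hb⟩ := haa.exists_nonzero_dvd (mem_nonZeroDivisors_of_ne_zero hne)
  have hθb : θ b = 0 := by
    have := map_dvd θ hb
    rw [hθ, zero_dvd_iff] at this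
    exact this
  apply hb0
  obtain ⟨b, hb2⟩ := b
  have himg : x '' (J : Set ι) = Set.range (fun i : (J : Set ι) => x i) := by
    ext y; simp
  have hb3 := hb2
  rw [himg, Algebra.adjoin_range_eq_range_aeval] at hb3
  obtain ⟨q, hq⟩ := hb3
  have h0 : q = 0 := by
    apply (algebraicIndependent_iff.mp hJ)
    have : MvPolynomial.aeval (fun i : (J : Set ι) => (θ ∘ x) i) q = θ b := by
      rw [← hq]
      change _ = θ (MvPolynomial.aeval _ q)
      rw [← AlgHom.comp_apply, MvPolynomial.comp_aeval]; rfl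
    rw [this]; exact hθb
  apply Subtype.ext
  change b = 0
  rw [← hq, h0]; simp

theorem Fl_le_closure {K : Type*} [Field K] [Algebra ℚ K] (T : Set K) :
    ∀ x ∈ Fl T, x ∈ (AlgebraicIndependent.matroid ℚ K).closure T := by
  intro x hx
  rw [AlgebraicIndependent.matroid_closure_eq]
  rw [SetLike.mem_coe, Subalgebra.mem_algebraicClosure]
  induction hx using IntermediateField.adjoin_induction with
  | mem x hx => exact isAlgebraic_algebraMap (⟨x, Algebra.subset_adjoin hx⟩ : Algebra.adjoin ℚ T)
  | algebraMap c => exact isAlgebraic_algebraMap (algebraMap ℚ (Algebra.adjoin ℚ T) c)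
  | add a b _ _ ha hb => exact ha.add hb
  | mul a b _ _ ha hb => exact ha.mul hb
  | inv a _ ha => exact ha.inv

theorem eRk_Fl {K : Type*} [Field K] [Algebra ℚ K] (T S : Set K) (h : ∀ x ∈ S, x ∈ Fl T) :
    (AlgebraicIndependent.matroid ℚ K).eRk S ≤ (AlgebraicIndependent.matroid ℚ K).eRk T := by
  rw [← Matroid.eRk_closure_eq _ T]
  exact Matroid.eRk_mono _ fun x hx => Fl_le_closure T x (h x hx)


section CoreSec
open Classical in
/-- generic matrix with support `S`, over a ring, with given entries -/
noncomputable def Gm {n : ℕ} {R : Type*} [Zero R] (z : Fin n → Fin n → R) (S : Fin n → Fin n → Prop) :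
    Matrix (Fin n) (Fin n) R := fun a b => if S a b then z a b else 0

def Dm (n : ℕ) (R : Type*) [Zero R] [One R] (j : ℕ) : Matrix (Fin n) (Fin n) R :=
  Matrix.diagonal fun i => if i.val < j then 1 else 0

theorem Dm_map {n : ℕ} {R K : Type*} [CommRing R] [CommRing K] (f : R →+* K) (j : ℕ) :
    (Dm n R j).map f = Dm n K j := by
  ext a b
  simp only [Dm, map_apply, diagonal_apply]
  split_ifs <;> simp

theorem upper_mul_Dm {n : ℕ} {K : Type*} [CommRing K] (v : Matrix (Fin n) (Fin n) K)
    (hv : ∀ a b, b < a → v a b = 0) (j : ℕ) : Dm n K j * (v * Dm n K j) = v * Dm n K j := by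
  ext a b
  simp only [Dm, diagonal_mul, mul_diagonal]
  by_cases ha : a.val < j
  · simp [ha]
  · by_cases hb : b.val < j
    · rw [hv a b (by rw [Fin.lt_def]; omega)]; simp
    · simp [hb]

theorem conjM_pow {n : ℕ} {K : Type*} [CommRing K] (u v N : Matrix (Fin n) (Fin n) K)
    (huv : u * v = 1) (hvu : v * u = 1) (m : ℕ) : (u * N * v) ^ m = u * N ^ m * v := by
  induction m with
  | zero => simp [huv]
  | succ m ih =>
    rw [pow_succ, ih, pow_succ]
    calc u * N ^ m * v * (u * N * v) = u * N ^ m * (v * u) * N * v := by simp only [mul_assoc]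
      _ = _ := by rw [hvu, mul_one]; simp only [mul_assoc]

theorem conj_rank_le {n : ℕ} {K : Type*} [Field K] (u v N : Matrix (Fin n) (Fin n) K)
    (huv : u * v = 1) (hvu : v * u = 1)
    (hv : ∀ a b, b < a → v a b = 0) (m j : ℕ) :
    ((u * N * v) ^ m * Dm n K j).rank ≤ (N ^ m * Dm n K j).rank := by
  rw [conjM_pow u v N huv hvu]
  have : u * N ^ m * v * Dm n K j = u * ((N ^ m * Dm n K j) * (v * Dm n K j)) := by
    rw [mul_assoc (N ^ m), upper_mul_Dm v hv]; simp only [mul_assoc]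
  rw [this]
  exact (rank_mul_le_right _ _).trans (rank_mul_le_left _ _)

theorem conj_rank {n : ℕ} {K : Type*} [Field K] (u v N : Matrix (Fin n) (Fin n) K)
    (huv : u * v = 1) (hvu : v * u = 1) (hu : ∀ a b, b < a → u a b = 0)
    (hv : ∀ a b, b < a → v a b = 0) (m j : ℕ) :
    ((u * N * v) ^ m * Dm n K j).rank = (N ^ m * Dm n K j).rank := by
  apply le_antisymm (conj_rank_le u v N huv hvu hv m j)
  have h := conj_rank_le v u (u * N * v) hvu huv hu m j
  have e : v * (u * N * v) * u = N := by
    calc v * (u * N * v) * u = (v * u) * N * (v * u) := by simp only [mul_assoc]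
      _ = N := by rw [hvu]; simp
  rwa [e] at h

theorem Dm_full {n : ℕ} {K : Type*} [CommRing K] : Dm n K n = 1 := by
  ext a b; simp [Dm]

theorem sdim_rank {n : ℕ} {K : Type*} [Field K] (X : Matrix (Fin n) (Fin n) K) (m : ℕ) :
    sdim (toLin' X) ⊤ m = (X ^ m).rank := by
  rw [sdim, ← toLin'_pow, Matrix.rank, Submodule.map_top]
  rfl

abbrev Rg (n : ℕ) := MvPolynomial (Bool × Fin n × Fin n) ℚ

/-- generic unipotent matrix -/
noncomputable def vg (n : ℕ) : Matrix (Fin n) (Fin n) (Rg n) := fun a b =>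
  if a = b then 1 else if a < b then MvPolynomial.X (false, a, b) else 0

noncomputable def zg (n : ℕ) : Fin n → Fin n → Rg n := fun a b => MvPolynomial.X (true, a, b)

theorem vg_det (n : ℕ) : (vg n).det = 1 := by
  rw [det_of_isUpperTriangular]
  · simp [vg]
  · intro a b h
    have h : b < a := h
    simp [vg, h.ne', h.not_gt]

noncomputable def ug (n : ℕ) : Matrix (Fin n) (Fin n) (Rg n) := (vg n)⁻¹

theorem vu (n : ℕ) : vg n * ug n = 1 := mul_nonsing_inv _ (by rw [vg_det]; exact isUnit_one)
theorem uv (n : ℕ) : ug n * vg n = 1 := nonsing_inv_mul _ (by rw [vg_det]; exact isUnit_one)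

theorem ug_upper (n : ℕ) (a b : Fin n) (h : b < a) : ug n a b = 0 := by
  have : Invertible (vg n) := ⟨ug n, uv n, vu n⟩
  have hb : BlockTriangular (vg n) id := by
    intro a b h
    have h : b < a := h
    simp [vg, h.ne', h.not_gt]
  exact blockTriangular_inv_of_blockTriangular hb h

noncomputable def Xg {n : ℕ} (S : Fin n → Fin n → Prop) : Matrix (Fin n) (Fin n) (Rg n) :=
  ug n * Gm (zg n) S * vg n

open Classical in
noncomputable def θg {n : ℕ} (S' : Fin n → Fin n → Prop) : Rg n →ₐ[ℚ] Rg n :=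
  MvPolynomial.aeval fun x => if x.1 = true ∧ ¬ S' x.2.1 x.2.2 then 0 else MvPolynomial.X x

theorem θg_v {n : ℕ} (S' : Fin n → Fin n → Prop) : (vg n).map (θg S') = vg n := by
  ext a b : 2
  simp only [map_apply, vg]
  split_ifs
  · simp
  · simp [θg]
  · simp

theorem θg_u {n : ℕ} (S' : Fin n → Fin n → Prop) : (ug n).map (θg S') = ug n := by
  have h : (ug n).map (θg S') * vg n = 1 := by
    have := congrArg (fun M => M.map (θg S')) (uv n)
    simp only [Matrix.map_mul] at this
    rw [θg_v] at this
    rw [this]; ext a b : 2; simp [one_apply]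
  calc (ug n).map (θg S') = (ug n).map (θg S') * (vg n * ug n) := by rw [vu, mul_one]
    _ = ug n := by rw [← mul_assoc, h, one_mul]

theorem θg_G {n : ℕ} (S S' : Fin n → Fin n → Prop) (h : ∀ a b, S' a b → S a b) :
    (Gm (zg n) S).map (θg S') = Gm (zg n) S' := by
  ext a b : 2
  simp only [map_apply, Gm, zg]
  by_cases h1 : S' a b
  · simp [h1, h a b h1, θg]
  · by_cases h2 : S a b
    · simp [h1, h2, θg]
    · simp [h1, h2]

theorem θg_X {n : ℕ} (S S' : Fin n → Fin n → Prop) (h : ∀ a b, S' a b → S a b) :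
    (Xg S).map (θg S') = Xg S' := by
  rw [Xg, Matrix.map_mul, Matrix.map_mul, θg_v, θg_u, θg_G S S' h, Xg]

theorem mul_upper_strict {n : ℕ} {K : Type*} [CommRing K] (u N v : Matrix (Fin n) (Fin n) K)
   (hu : ∀ a b, b < a → u a b = 0) (hv : ∀ a b, b < a → v a b = 0) (hN : ∀ a b, N a b ≠ 0 → a < b) :
   ∀ a b, (u * N * v) a b ≠ 0 → a < b := by
  intro a b hab
  by_contra hcon
  apply hab
  rw [mul_apply]
  apply Finset.sum_eq_zero
  intro c _
  rw [mul_apply, Finset.sum_mul]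
  apply Finset.sum_eq_zero
  intro d _
  by_cases h1 : d < a
  · rw [hu a d h1]; simp
  · by_cases h2 : b < c
    · rw [hv c b h2]; simp
    · by_cases h3 : N d c = 0
      · rw [h3]; simp
      · have := hN d c h3
        omega
end CoreSec


section CoreSec2

theorem inj_of_eRk {R K : Type*} [CommRing R] [IsDomain R] [Algebra ℚ R] [Field K] [Algebra ℚ K]
    (g : R →ₐ[ℚ] K) (hg : Function.Injective g) {ι : Type*} [Fintype ι]
    (θ : R →ₐ[ℚ] R) (x : ι → R) 
    (h : (AlgebraicIndependent.matroid ℚ K).eRk (Set.range (g ∘ x)) ≤ 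
      (AlgebraicIndependent.matroid ℚ K).eRk (Set.range (g ∘ θ ∘ x))) :
    ∀ a ∈ Algebra.adjoin ℚ (Set.range x), θ a = 0 → a = 0 := by
  classical
  obtain ⟨I, hI⟩ := (AlgebraicIndependent.matroid ℚ K).exists_isBasis (Set.range (g ∘ θ ∘ x))
    (by simp)
  have hIr := hI.subset
  obtain ⟨J, hJ⟩ : ∃ J : Set ι, Set.BijOn (g ∘ θ ∘ x) J I := by
    have : Set.SurjOn (g ∘ θ ∘ x) Set.univ I := by
      intro y hy
      obtain ⟨i, hi⟩ := hIr hy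
      exact ⟨i, trivial, hi⟩
    obtain ⟨J, _, hJ⟩ := Set.SurjOn.exists_bijOn_subset this
    exact ⟨J, hJ⟩
  have hind := hI.indep
  rw [AlgebraicIndependent.matroid_indep_iff, ← hJ.image_eq] at hind
  have hind2 : AlgebraicIndepOn ℚ (g ∘ θ ∘ x) J := (algebraicIndependent_image hJ.injOn).mpr hind
  have hind3 : AlgebraicIndepOn ℚ (θ ∘ x) J := AlgebraicIndependent.of_comp g hind2
  have hIc : I.encard = J.encard := by rw [← hJ.image_eq, hJ.injOn.encard_image]
  apply inj_of_indep θ x J.toFinset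
  · simpa using hind3
  · intro J' hJ'
    have h1 : AlgebraicIndepOn ℚ (g ∘ x) (J' : Set ι) := AlgebraicIndependent.map' (f := g) hJ' hg
    have h2 := (AlgebraicIndependent.image h1)
    have hinj : Set.InjOn (g ∘ x) (J' : Set ι) := by
      intro a ha b hb hab
      have := h1.injective (a₁ := ⟨a, ha⟩) (a₂ := ⟨b, hb⟩) hab
      simpa using this
    have h3 : (AlgebraicIndependent.matroid ℚ K).Indep ((g ∘ x) '' (J' : Set ι)) := 
      AlgebraicIndependent.matroid_indep_iff.mpr h2
    have h4 := h3.encard_le_eRk_of_subset (X := Set.range (g ∘ x)) (Set.image_subset_range _ _)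
    rw [hinj.encard_image] at h4
    rw [hI.eRk_eq_encard, hIc] at h
    have h5 := h4.trans h
    rw [Set.encard_eq_coe_toFinset_card, Set.encard_eq_coe_toFinset_card] at h5
    have := ENat.natCast_le_natCast.mp h5
    simpa using this

theorem eRk_upper {K : Type*} [Field K] [Algebra ℚ K] {n : ℕ} (X : Matrix (Fin n) (Fin n) K) 
    (hX : ∀ a b, X a b ≠ 0 → a < b) : 
    (AlgebraicIndependent.matroid ℚ K).eRk (Set.range (fun p : Fin n × Fin n => X p.1 p.2)) + 
      (nnS n (fun m => (X^m).rank) : ℕ) ≤ ((∑ i ∈ Finset.range n, i : ℕ) : ℕ∞) := by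
  obtain ⟨_, T, hT, hX2⟩ := boundU X hX n le_rfl
  rw [Efl_top le_rfl] at hT
  have e : sdim (toLin' X) ⊤ = fun m => (X^m).rank := by
    funext m; rw [sdim_rank]
  rw [e] at hT
  refine le_trans ?_ (ENat.natCast_le_natCast.mpr hT)
  rw [Nat.cast_add]
  gcongr
  refine (eRk_Fl T _ ?_).trans ((Matroid.eRk_le_encard _ _).trans (by simp))
  rintro _ ⟨⟨a, b⟩, rfl⟩
  exact hX2 a b b.2

theorem adj_mem {K : Type*} [Field K] [Algebra ℚ K] {n : ℕ} (F : IntermediateField ℚ K) 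
    (u v : Matrix (Fin n) (Fin n) K) (hvu : v * u = 1) (hdet : v.det = 1)
    (hv : ∀ a b, v a b ∈ F) (a b : Fin n) : u a b ∈ F := by
  have hu : u = v.adjugate := by
    calc u = (v.adjugate * v) * u := by rw [adjugate_mul, hdet]; simp
      _ = _ := by rw [mul_assoc, hvu, mul_one]
  let v' : Matrix (Fin n) (Fin n) F := fun a b => ⟨v a b, hv a b⟩
  have : v = v'.map F.val := rfl
  rw [hu, this]
  have h2 : (v'.map F.val).adjugate = v'.adjugate.map F.val := 
    ((F.val : F →+* K).map_adjugate v').symm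
  rw [h2]
  exact (v'.adjugate a b).2

theorem mul_mem_mat {K : Type*} [Field K] [Algebra ℚ K] {n : ℕ} (F : IntermediateField ℚ K) 
    (u v : Matrix (Fin n) (Fin n) K) (hu : ∀ a b, u a b ∈ F)
    (hv : ∀ a b, v a b ∈ F) (a b : Fin n) : (u * v) a b ∈ F := by
  rw [mul_apply]
  exact sum_mem fun c _ => mul_mem (hu _ _) (hv _ _)

theorem eRk_lower {n : ℕ} {K : Type*} [Field K] [Algebra ℚ K] [Algebra (Rg n) K] 
    [IsFractionRing (Rg n) K] [IsScalarTower ℚ (Rg n) K] (w : Equiv.Perm (Fin n)) (S : Fin n → Fin n → Prop)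
    (hS : ∀ a b, S a b ↔ a < b ∧ w.symm a < w.symm b) (X : Matrix (Fin n) (Fin n) K)
    (hX : X = (Xg S).map (algebraMap _ _)) :
    ((∑ i ∈ Finset.range n, i : ℕ) : ℕ∞) ≤ 
    (AlgebraicIndependent.matroid ℚ K).eRk 
      (Set.range (fun p : Fin n × Fin n => X p.1 p.2)) + 
      (nnS n (fun m => (X^m).rank) : ℕ) := by
  classical
  set f : Rg n →+* K := algebraMap _ _ with hf
  have hfinj : Function.Injective f := IsFractionRing.injective (Rg n) K
  set v := (vg n).map f with hvdef
  set u := (ug n).map f with hudef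
  set N := (Gm (zg n) S).map f with hNdef
  have hvu : v * u = 1 := by rw [hvdef, hudef, ← Matrix.map_mul, vu]; ext a b; simp [one_apply]
  have huv : u * v = 1 := by rw [hvdef, hudef, ← Matrix.map_mul, uv]; ext a b; simp [one_apply]
  have hXe : u * N * v = X := by rw [hX, Xg, Matrix.map_mul, Matrix.map_mul]
  have hdet : v.det = 1 := by
    have := f.map_det (vg n)
    rw [vg_det, map_one] at this
    exact this.symm
  set T0 : Set K := Set.range (fun p : Fin n × Fin n => X p.1 p.2) with hT0
  have hbV := boundV u v N huv hvu
    (fun a b h => by simp [v, vg, h.ne', h.not_gt]) (fun a => by simp [v, vg])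
    (fun a b h => by simp [u, ug_upper n a b h]) w
    (fun a b h => by
      by_contra hcon
      apply h
      have : ¬ S a b := fun h' => hcon ((hS a b).mp h').2
      simp [N, Gm, this]) T0
    (fun a b => by rw [hXe]; exact IntermediateField.subset_adjoin _ _ ⟨(a, b), rfl⟩) n 0 (by simp)
  obtain ⟨_, T, hT, hv⟩ := hbV
  have hvmem : ∀ a b, v a b ∈ Fl (T0 ∪ T) := by
    intro a b
    have := hv (w.symm a) (Nat.zero_le _) b
    simpa using this
  have humem := adj_mem (Fl (T0 ∪ T)) u v hvu hdet hvmem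
  have hXmem : ∀ a b, X a b ∈ Fl (T0 ∪ T) := fun a b => 
    IntermediateField.subset_adjoin _ _ (Or.inl ⟨(a, b), rfl⟩)
  have hNmem : ∀ a b, N a b ∈ Fl (T0 ∪ T) := by
    have e : N = v * X * u := by
      rw [← hXe]
      calc N = (v * u) * N * (v * u) := by rw [hvu]; simp
        _ = _ := by simp only [mul_assoc]
    rw [e]
    exact mul_mem_mat _ _ _ (mul_mem_mat _ _ _ hvmem hXmem) humem
  let A : Finset (Bool × Fin n × Fin n) := 
    Finset.univ.filter fun x => x.2.1 < x.2.2 ∧ (x.1 = true → S x.2.1 x.2.2)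
  have hindX : AlgebraicIndependent ℚ (fun x : Bool × Fin n × Fin n => f (MvPolynomial.X x)) := 
    AlgebraicIndependent.map' (f := IsScalarTower.toAlgHom ℚ (Rg n) K) 
      (MvPolynomial.algebraicIndependent_X _ ℚ) hfinj
  have hind : (AlgebraicIndependent.matroid ℚ K).Indep 
      ((fun x : Bool × Fin n × Fin n => f (MvPolynomial.X x)) '' (A : Set _)) := by
    rw [AlgebraicIndependent.matroid_indep_iff]
    apply AlgebraicIndependent.image
    exact hindX.comp (fun x : (A : Set (Bool × Fin n × Fin n)) => x.1) Subtype.val_injective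
  have hcard : (A.card : ℕ∞) ≤ (AlgebraicIndependent.matroid ℚ K).eRk (T0 ∪ T) := by
    have h1 := hind.encard_le_eRk_of_subset subset_rfl
    rw [hindX.injective.injOn.encard_image, Set.encard_coe_eq_coe_finsetCard] at h1
    refine h1.trans (eRk_Fl _ _ ?_)
    rintro _ ⟨⟨b, i, j⟩, hx, rfl⟩
    simp only [A, Finset.coe_filter, Finset.mem_univ, true_and, Set.mem_ofPred_eq] at hx
    cases b with
    | false => 
      have := hvmem i j
      simpa [v, vg, hx.1.ne, hx.1] using this
    | true =>
      have := hNmem i j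
      simpa [N, Gm, zg, hx.2 rfl] using this
  have hTc : (AlgebraicIndependent.matroid ℚ K).eRk (T0 ∪ T) ≤ 
      (AlgebraicIndependent.matroid ℚ K).eRk T0 + T.card := by
    have := Matroid.eRk_union_le_eRk_add_encard (AlgebraicIndependent.matroid ℚ K) T0 (T : Set K)
    rwa [Set.encard_coe_eq_coe_finsetCard] at this
  have hA : A.card = (∑ i ∈ Finset.range n, i) + ∑ p' : Fin n,
          (Finset.univ.filter (fun q : Fin n => p' < q ∧ w p' < w q)).card := by
    have hpairs : (Finset.univ.filter fun x : Fin n × Fin n => x.1 < x.2).card = ∑ i ∈ Finset.range n, i := by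
      rw [Finset.card_filter, Fintype.sum_prod_type_right, Finset.sum_range]
      apply Finset.sum_congr rfl
      intro j _
      rw [← Finset.card_filter]
      exact Fin.card_Iio j ▸ (by congr 1; ext x; simp)
    have hS2 : (Finset.univ.filter fun x : Fin n × Fin n => S x.1 x.2).card = ∑ p' : Fin n,
          (Finset.univ.filter (fun q : Fin n => p' < q ∧ w p' < w q)).card := by
      simp_rw [Finset.card_filter]
      rw [Fintype.sum_prod_type, ← Equiv.sum_comp w]
      apply Finset.sum_congr rfl
      intro i _
      rw [← Equiv.sum_comp w]
      apply Finset.sum_congr rfl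
      intro j _
      simp [hS, and_comm]
    rw [← hpairs, ← hS2]
    simp only [A]
    rw [Finset.card_filter, Fintype.sum_prod_type]
    simp only [Fintype.sum_bool, ← Finset.card_filter]
    rw [add_comm]
    congr 1
    · congr 1; ext x; simp
    · congr 1; ext x; simp only [Finset.mem_filter, Finset.mem_univ, true_and, forall_const]
      exact ⟨fun h => h.2, fun h => ⟨((hS _ _).mp h).1, h⟩⟩
  have hfin : (nnS n (sdim (toLin' X) ⊤)) = nnS n (fun m => (X^m).rank) := by
    congr 1; funext m; rw [sdim_rank]
  rw [hXe, hfin] at hT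
  simp only [zero_le, Finset.filter_true] at hT
  set s := ∑ p' : Fin n, (Finset.univ.filter (fun q : Fin n => p' < q ∧ w p' < w q)).card
  have hT' : T.card ≤ nnS n (fun m => (X^m).rank) + s := by omega
  have h6 := hcard.trans hTc
  rw [hA] at h6
  rcases eq_or_ne ((AlgebraicIndependent.matroid ℚ K).eRk T0) ⊤ with h7 | h7
  · rw [h7]; simp
  · obtain ⟨e, he⟩ := ENat.ne_top_iff_exists.mp h7
    rw [← he] at h6 ⊢
    norm_cast at h6 ⊢
    omega

theorem core {n : ℕ} {K : Type*} [Field K] [Algebra ℚ K] [Algebra (Rg n) K] 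
    [IsFractionRing (Rg n) K] [IsScalarTower ℚ (Rg n) K] (S S' : Fin n → Fin n → Prop) (w : Equiv.Perm (Fin n)) 
    (hS : ∀ a b, S a b → a < b) (hS' : ∀ a b, S' a b ↔ a < b ∧ w.symm a < w.symm b)
    (hsub : ∀ a b, S' a b → S a b)
    (hrank : ∀ m, (((Gm (zg n) S).map (algebraMap (Rg n) K))^m).rank = 
      (((Gm (zg n) S').map (algebraMap (Rg n) K))^m).rank) (m j : ℕ) :
    (((Gm (zg n) S).map (algebraMap (Rg n) K))^m * Dm n _ j).rank = 
      (((Gm (zg n) S').map (algebraMap (Rg n) K))^m * Dm n _ j).rank := by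
  classical
  set f : Rg n →+* K := algebraMap _ _ with hf
  have hfinj : Function.Injective f := IsFractionRing.injective (Rg n) K
  set v := (vg n).map f with hvdef
  set u := (ug n).map f with hudef
  have hvu : v * u = 1 := by rw [hvdef, hudef, ← Matrix.map_mul, vu]; ext a b; simp [one_apply]
  have huv : u * v = 1 := by rw [hvdef, hudef, ← Matrix.map_mul, uv]; ext a b; simp [one_apply]
  have hXe : ∀ S, (Xg S).map f = u * (Gm (zg n) S).map f * v := by
    intro S; rw [Xg, Matrix.map_mul, Matrix.map_mul]
  have hv0 : ∀ a b, b < a → v a b = 0 := fun a b h => by simp [v, vg, h.ne', h.not_gt]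
  have hu0 : ∀ a b, b < a → u a b = 0 := fun a b h => by simp [u, ug_upper n a b h]
  have hcr : ∀ S m j, (((Xg S).map f)^m * Dm n K j).rank = (((Gm (zg n) S).map f)^m * Dm n K j).rank := by
    intro S m j
    rw [hXe, conj_rank u v _ huv hvu hu0 hv0]
  have hcr1 : ∀ S m, (((Xg S).map f)^m).rank = (((Gm (zg n) S).map f)^m).rank := by
    intro S m
    have := hcr S m n
    rwa [Dm_full, mul_one, mul_one] at this
  rw [← hcr, ← hcr]
  have hup := eRk_upper ((Xg S).map f) (by
    rw [hXe]
    apply mul_upper_strict _ _ _ hu0 hv0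
    intro a b h
    apply hS
    by_contra hcon
    exact h (by simp [Gm, hcon]))
  have hlow := eRk_lower w S' hS' ((Xg S').map f) rfl
  have hnn : nnS n (fun m => (((Xg S).map f)^m).rank) = nnS n (fun m => (((Xg S').map f)^m).rank) := by
    congr 1; funext m; rw [hcr1, hcr1, hrank]
  rw [hnn] at hup
  have hle := hup.trans hlow
  rw [ENat.add_le_add_iff_right (ENat.natCast_ne_top _)] at hle
  set x : Fin n × Fin n → Rg n := fun p => Xg S p.1 p.2
  have hθx : ∀ p : Fin n × Fin n, θg S' (x p) = Xg S' p.1 p.2 := by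
    intro p
    rw [← θg_X S S' hsub]; rfl
  have hinj := inj_of_eRk (IsScalarTower.toAlgHom ℚ (Rg n) K) hfinj (θg S') x (by
    have e1 : (IsScalarTower.toAlgHom ℚ (Rg n) K) ∘ (θg S') ∘ x = fun p => (Xg S').map f p.1 p.2 := by
      funext p
      simp only [Function.comp_apply, hθx, IsScalarTower.coe_toAlgHom', map_apply]
      rfl
    rw [e1]; exact hle)
  set A := Algebra.adjoin ℚ (Set.range x)
  let XA : Matrix (Fin n) (Fin n) A := fun a b => ⟨Xg S a b, Algebra.subset_adjoin ⟨(a, b), rfl⟩⟩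
  let g1 : A →+* K := f.comp A.val.toRingHom
  let g2 : A →+* K := f.comp ((θg S').toRingHom.comp A.val.toRingHom)
  have hg1 : Function.Injective g1 := hfinj.comp Subtype.val_injective
  have hg2 : Function.Injective g2 := by
    rw [injective_iff_map_eq_zero]
    intro a ha
    have h0 : θg S' a.1 = 0 := hfinj (by rw [map_zero]; exact ha)
    exact Subtype.ext (hinj a.1 a.2 h0)
  have e1 : (XA ^ m * Dm n A j).map g1 = ((Xg S).map f)^m * Dm n K j := by
    rw [Matrix.map_mul, Dm_map]
    congr 1
    have := map_pow (g1.mapMatrix) XA m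
    exact this
  have e2 : (XA ^ m * Dm n A j).map g2 = ((Xg S').map f)^m * Dm n K j := by
    rw [Matrix.map_mul, Dm_map]
    congr 1
    have := map_pow (g2.mapMatrix) XA m
    refine this.trans ?_
    congr 1
    ext a b
    change f (θg S' (x (a, b))) = _
    rw [hθx]; rfl
  rw [← e1, ← e2]
  exact le_antisymm (rank_spec g1 g2 hg2 _) (rank_spec g2 g1 hg1 _)
end CoreSec2


section WordSec

abbrev Kg (n : ℕ) := FractionRing (Rg n)

/-- `a` occurs before `b` in the word -/
def Bef : List ℕ → ℕ → ℕ → Prop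
  | [], _, _ => False
  | c :: w, a, b => (c = a ∧ b ∈ w) ∨ Bef w a b

theorem Bef_append (u v : List ℕ) (a b : ℕ) : 
    Bef (u ++ v) a b ↔ Bef u a b ∨ Bef v a b ∨ (a ∈ u ∧ b ∈ v) := by
  induction u with
  | nil => simp [Bef]
  | cons c u ih => 
    simp only [List.cons_append, Bef, List.mem_append, ih, List.mem_cons]
    constructor
    · rintro (⟨h, h1 | h1⟩ | h1 | h1 | h1) <;> simp_all
    · rintro ((⟨h, h1⟩ | h1) | h1 | ⟨h1 | h1, h2⟩) <;> simp_all

theorem Bef.mem_left {w : List ℕ} {a b : ℕ} (h : Bef w a b) : a ∈ w := by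
  induction w with
  | nil => exact h.elim
  | cons c w ih => 
    rcases h with h | h
    · simp [h.1]
    · simp [ih h]

theorem Bef.mem_right {w : List ℕ} {a b : ℕ} (h : Bef w a b) : b ∈ w := by
  induction w with
  | nil => exact h.elim
  | cons c w ih => 
    rcases h with h | h
    · simp [h.2]
    · simp [ih h]

theorem Bef_iff (w : List ℕ) (a b : ℕ) : 
    Bef w a b ↔ ∃ i j : ℕ, i < j ∧ w[i]? = some a ∧ w[j]? = some b := by
  induction w with
  | nil => simp [Bef]
  | cons c w ih =>
    simp only [Bef, ih]
    constructor
    · rintro (⟨rfl, h⟩ | ⟨i, j, h, h1, h2⟩)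
      · obtain ⟨k, hk⟩ := List.mem_iff_getElem?.mp h
        exact ⟨0, k+1, by omega, by simp, by simpa using hk⟩
      · exact ⟨i+1, j+1, by omega, by simpa using h1, by simpa using h2⟩
    · rintro ⟨i, j, h, h1, h2⟩
      obtain ⟨j, rfl⟩ : ∃ j', j = j' + 1 := ⟨j - 1, by omega⟩
      rcases i with _ | i
      · left
        simp at h1 h2
        exact ⟨h1, List.mem_of_getElem? h2⟩
      · right
        exact ⟨i, j, by omega, by simpa using h1, by simpa using h2⟩

theorem Bef_filter (p : ℕ → Bool) (w : List ℕ) (a b : ℕ) : 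
    Bef (w.filter p) a b ↔ Bef w a b ∧ p a ∧ p b := by
  induction w with
  | nil => simp [Bef]
  | cons c w ih =>
    rw [List.filter_cons]
    by_cases h : p c = true
    · simp only [h, if_true, Bef, ih, List.mem_filter]
      constructor
      · rintro (⟨rfl, h1⟩ | h1) <;> simp_all
      · rintro ⟨⟨rfl, h1⟩ | h1, h2⟩ <;> simp_all
    · simp only [h, Bef, ih]
      simp only [Bool.false_eq_true, if_false, ih]
      constructor
      · rintro ⟨h1, h2⟩; exact ⟨Or.inr h1, h2⟩
      · rintro ⟨⟨rfl, h1⟩ | h1, h2⟩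
        · exact absurd h2.1 h
        · exact ⟨h1, h2⟩

def Inc (n : ℕ) (w : List ℕ) (a b : Fin n) : Prop := a < b ∧ Bef w a b

/-- generic matrix over the fraction field -/
noncomputable def GK {n : ℕ} (S : Fin n → Fin n → Prop) : Matrix (Fin n) (Fin n) (Kg n) :=
  (Gm (zg n) S).map (algebraMap (Rg n) (Kg n))

noncomputable def grk (n : ℕ) (m : ℕ) (w : List ℕ) : ℕ := (GK (Inc n w) ^ m).rank

theorem rank_le_gr {n : ℕ} (S : Fin n → Fin n → Prop) (N : Matrix (Fin n) (Fin n) (Kg n))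
    (hN : ∀ a b, N a b ≠ 0 → S a b) (m : ℕ) : (N ^ m).rank ≤ (GK S ^ m).rank := by
  classical
  let e : Rg n →ₐ[ℚ] Kg n := MvPolynomial.aeval fun x => N x.2.1 x.2.2
  have h := rank_spec e.toRingHom (algebraMap (Rg n) (Kg n)) (IsFractionRing.injective _ _) (Gm (zg n) S ^ m)
  have e1 : (Gm (zg n) S ^ m).map (algebraMap (Rg n) (Kg n)) = GK S ^ m := 
    map_pow ((algebraMap (Rg n) (Kg n)).mapMatrix) _ m
  have e2 : (Gm (zg n) S ^ m).map e.toRingHom = N ^ m := by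
    refine (map_pow (e.toRingHom.mapMatrix) _ m).trans ?_
    congr 1
    ext a b
    simp only [RingHom.mapMatrix_apply, map_apply, Gm]
    by_cases h : S a b
    · simp only [h, if_true, zg]
      change e _ = _
      simp [e]
    · simp only [h, if_false, map_zero]
      by_contra hc
      exact h (hN a b (Ne.symm hc))
  rwa [e1, e2] at h

theorem GK_supp {n : ℕ} (S : Fin n → Fin n → Prop) (a b : Fin n) (h : GK S a b ≠ 0) : S a b := by
  by_contra hc
  exact h (by simp [GK, Gm, hc])

theorem GK_ne {n : ℕ} (S : Fin n → Fin n → Prop) (a b : Fin n) (h : S a b) : GK S a b ≠ 0 := by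
  simp only [GK, Gm, map_apply, h, if_true, zg]
  intro h
  have := (IsFractionRing.injective (Rg n) (Kg n)) (h.trans (map_zero _).symm)
  exact MvPolynomial.X_ne_zero _ this

theorem grk_mono {n m : ℕ} {w w' : List ℕ} (h : ∀ a b, Inc n w a b → Inc n w' a b) : 
    grk n m w ≤ grk n m w' :=
  rank_le_gr _ _ (fun a b hab => h a b (GK_supp _ a b hab)) m

theorem transv_conj {n : ℕ} {K : Type*} [Field K] (N : Matrix (Fin n) (Fin n) K) (p q : Fin n) (hpq : p ≠ q)
    (t : K) (h0 : N q p = 0) (m : ℕ) : 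
    ∃ N' : Matrix (Fin n) (Fin n) K, (N'^m).rank = (N^m).rank ∧ 
      ∀ a b, N' a b = N a b + (if a = p then t * N q b else 0) - (if b = q then t * N a p else 0) := by
  have h1 : transvection p q t * transvection p q (-t) = 1 := by
    rw [transvection_mul_transvection_same _ _ hpq]; simp
  have h2 : transvection p q (-t) * transvection p q t = 1 := by
    rw [transvection_mul_transvection_same _ _ hpq]; simp
  refine ⟨transvection p q t * N * transvection p q (-t), ?_, ?_⟩
  · rw [conjM_pow _ _ _ h1 h2]
    rw [rank_mul_eq_left_of_isUnit_det, rank_mul_eq_right_of_isUnit_det]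
    · simp [det_transvection_of_ne _ _ hpq]
    · simp [det_transvection_of_ne _ _ hpq]
  · intro a b
    by_cases hb : b = q
    · subst hb
      rw [mul_transvection_apply_same]
      by_cases ha : a = p
      · subst ha
        simp [h0]; ring
      · simp [ha]; ring
    · rw [mul_transvection_apply_of_ne _ _ _ _ hb]
      by_cases ha : a = p
      · subst ha; simp [hb]
      · simp [ha, hb]

inductive KStep : List ℕ → List ℕ → Prop
  | k1 (u v : List ℕ) (x y z : ℕ) : x < y → y < z → KStep (u ++ y :: x :: z :: v) (u ++ y :: z :: x :: v)
  | k2 (u v : List ℕ) (x y z : ℕ) : x < y → y < z → KStep (u ++ x :: z :: y :: v) (u ++ z :: x :: y :: v)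

theorem KStep.perm {w w' : List ℕ} (h : KStep w w') : w.Perm w' := by
  cases h with
  | k1 u v x y z =>
    apply List.Perm.append_left
    apply List.Perm.cons
    exact List.Perm.swap _ _ _
  | k2 u v x y z =>
    apply List.Perm.append_left
    exact List.Perm.swap _ _ _

theorem k1_key {u v : List ℕ} {x y z a b : ℕ} (h : Bef (u ++ y :: x :: z :: v) a b)
    (hne : ¬ (a = x ∧ b = z)) : Bef (u ++ y :: z :: x :: v) a b := by
  simp only [Bef_append, Bef, List.mem_cons] at h ⊢
  grind

theorem k1_key' {u v : List ℕ} {x y z a b : ℕ} (h : Bef (u ++ y :: z :: x :: v) a b)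
    (hne : ¬ (a = z ∧ b = x)) : Bef (u ++ y :: x :: z :: v) a b := by
  simp only [Bef_append, Bef, List.mem_cons] at h ⊢
  grind

theorem k2_key {u v : List ℕ} {x y z a b : ℕ} (h : Bef (u ++ x :: z :: y :: v) a b)
    (hne : ¬ (a = x ∧ b = z)) : Bef (u ++ z :: x :: y :: v) a b := by
  simp only [Bef_append, Bef, List.mem_cons] at h ⊢
  grind

theorem k2_key' {u v : List ℕ} {x y z a b : ℕ} (h : Bef (u ++ z :: x :: y :: v) a b)
    (hne : ¬ (a = z ∧ b = x)) : Bef (u ++ x :: z :: y :: v) a b := by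
  simp only [Bef_append, Bef, List.mem_cons] at h ⊢
  grind

theorem nodup_split {u v : List ℕ} {y : ℕ} (hn : (u ++ y :: v).Nodup) : y ∉ u ∧ y ∉ v := by
  rw [List.nodup_append] at hn
  exact ⟨fun h => hn.2.2 y h y (by simp) rfl, (List.nodup_cons.mp hn.2.1).1⟩

theorem Bef_after {u v : List ℕ} {y c : ℕ} (hn : (u ++ y :: v).Nodup) (h : Bef (u ++ y :: v) y c) : c ∈ v := by
  obtain ⟨h1, h2⟩ := nodup_split hn
  simp only [Bef_append, Bef, List.mem_cons] at h
  rcases h with h | (h | h) | h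
  · exact absurd h.mem_left h1
  · exact h.2
  · exact absurd h.mem_left h2
  · exact absurd h.1 h1

theorem Bef_before {u v : List ℕ} {y c : ℕ} (hn : (u ++ y :: v).Nodup) (h : Bef (u ++ y :: v) c y) : c ∈ u := by
  obtain ⟨h1, h2⟩ := nodup_split hn
  simp only [Bef_append, Bef, List.mem_cons] at h
  rcases h with h | (h | h) | h
  · exact absurd h.mem_right h1
  · exact absurd h.2 h2
  · exact absurd h.mem_right h2
  · exact h.1

/-- kill the entry `(x,z)` by a transvection -/
theorem rank_kill {n m : ℕ} (S S' : Fin n → Fin n → Prop) (p q x z : Fin n) (hpq : p ≠ q) (hqp : ¬ S q p)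
    (t : Kg n) 
    (hkill : GK S x z + (if x = p then t * GK S q z else 0) - (if z = q then t * GK S x p else 0) = 0)
    (h1 : ∀ a b, S a b → ¬ (a = x ∧ b = z) → S' a b)
    (h2 : ∀ b, S q b → ¬ (p = x ∧ b = z) → S' p b)
    (h3 : ∀ a, S a p → ¬ (a = x ∧ q = z) → S' a q) :
    (GK S ^ m).rank ≤ (GK S' ^ m).rank := by
  classical
  obtain ⟨N', hN', hN2⟩ := transv_conj (GK S) p q hpq t (by
    by_contra hc
    exact hqp (GK_supp _ _ _ hc)) m
  rw [← hN']
  apply rank_le_gr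
  intro a b hab
  rw [hN2] at hab
  by_cases hxz : a = x ∧ b = z
  · obtain ⟨rfl, rfl⟩ := hxz
    exact absurd hkill hab
  · by_contra hc
    apply hab
    have e1 : GK S a b = 0 := by
      by_contra h; exact hc (h1 a b (GK_supp _ _ _ h) hxz)
    have e2 : (if a = p then t * GK S q b else 0) = 0 := by
      split_ifs with h
      · subst h
        by_cases h' : GK S q b = 0
        · rw [h', mul_zero]
        · exact absurd (h2 b (GK_supp _ _ _ h') hxz) hc
      · rfl
    have e3 : (if b = q then t * GK S a p else 0) = 0 := by
      split_ifs with h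
      · subst h
        by_cases h' : GK S a p = 0
        · rw [h', mul_zero]
        · exact absurd (h3 a (GK_supp _ _ _ h') hxz) hc
      · rfl
    rw [e1, e2, e3]; simp

theorem grk_KStep {n m : ℕ} {w w' : List ℕ} (h : KStep w w') (hn : w.Nodup) (hlt : ∀ a ∈ w, a < n) :
    grk n m w = grk n m w' := by
  cases h with
  | k1 u v x y z hxy hyz =>
    apply le_antisymm
    · have hx : x < n := hlt x (by simp)
      have hy : y < n := hlt y (by simp)
      have hz : z < n := hlt z (by simp)
      have hNz : GK (Inc n (u ++ y :: x :: z :: v)) ⟨y, hy⟩ ⟨z, hz⟩ ≠ 0 := by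
        apply GK_ne
        exact ⟨hyz, by simp [Bef_append, Bef]⟩
      apply rank_kill _ _ ⟨x, hx⟩ ⟨y, hy⟩ ⟨x, hx⟩ ⟨z, hz⟩ (by simp; omega) _ 
        (- GK (Inc n (u ++ y :: x :: z :: v)) ⟨x, hx⟩ ⟨z, hz⟩ / GK (Inc n (u ++ y :: x :: z :: v)) ⟨y, hy⟩ ⟨z, hz⟩)
      · have : (⟨z, hz⟩ : Fin n) ≠ ⟨y, hy⟩ := by simp; omega
        simp only [this, if_true, if_false]
        field_simp
        ring
      · intro a b hab hne
        refine ⟨hab.1, k1_key hab.2 ?_⟩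
        rintro ⟨h1, h2⟩; exact hne ⟨Fin.ext h1, Fin.ext h2⟩
      · intro b hb hne
        have c4 := Bef_after hn hb.2
        have c5 : y < b.val := hb.1
        have c6 : b.val ≠ z := fun h => hne ⟨rfl, Fin.ext h⟩
        have c7 : b.val ≠ x := by omega
        refine ⟨by rw [Fin.lt_def]; simp; omega, ?_⟩
        simp only [Bef_append, Bef]
        simp only [List.mem_cons] at c4
        have : b.val ∈ v := by simpa [c6, c7] using c4
        exact Or.inr (Or.inl (Or.inr (Or.inr (Or.inl ⟨trivial, this⟩))))
      · intro a ha hne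
        have c4 := Bef_before (u := u ++ [y]) (v := z :: v) (y := x) (by simpa using hn) (by simpa using ha.2)
        have c5 : a.val < x := ha.1
        have c7 : a.val ≠ y := by omega
        refine ⟨by rw [Fin.lt_def]; simp; omega, ?_⟩
        simp only [Bef_append]
        have : a.val ∈ u := by simpa [c7] using c4
        exact Or.inr (Or.inr ⟨this, by simp⟩)
      · intro h
        have : y < x := h.1
        omega
    · apply grk_mono
      intro a b hab
      refine ⟨hab.1, k1_key' hab.2 ?_⟩
      have : a.val < b := hab.1
      omega
  | k2 u v x y z hxy hyz =>
    apply le_antisymm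
    · have hx : x < n := hlt x (by simp)
      have hy : y < n := hlt y (by simp)
      have hz : z < n := hlt z (by simp)
      have hNz : GK (Inc n (u ++ x :: z :: y :: v)) ⟨x, hx⟩ ⟨y, hy⟩ ≠ 0 := by
        apply GK_ne
        exact ⟨hxy, by simp [Bef_append, Bef]⟩
      apply rank_kill _ _ ⟨y, hy⟩ ⟨z, hz⟩ ⟨x, hx⟩ ⟨z, hz⟩ (by simp; omega) _ 
        (GK (Inc n (u ++ x :: z :: y :: v)) ⟨x, hx⟩ ⟨z, hz⟩ / GK (Inc n (u ++ x :: z :: y :: v)) ⟨x, hx⟩ ⟨y, hy⟩)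
      · have : (⟨x, hx⟩ : Fin n) ≠ ⟨y, hy⟩ := by simp; omega
        simp only [this, if_true, if_false]
        field_simp
        ring
      · intro a b hab hne
        refine ⟨hab.1, k2_key hab.2 ?_⟩
        rintro ⟨h1, h2⟩; exact hne ⟨Fin.ext h1, Fin.ext h2⟩
      · intro b hb hne
        have c4 := Bef_after (u := u ++ [x]) (v := y :: v) (y := z) (by simpa using hn) (by simpa using hb.2)
        have c5 : z < b.val := hb.1
        have c7 : b.val ≠ y := by omega
        refine ⟨by rw [Fin.lt_def]; simp; omega, ?_⟩
        simp only [Bef_append, Bef]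
        have : b.val ∈ v := by simpa [c7] using c4
        exact Or.inr (Or.inl (Or.inr (Or.inr (Or.inl ⟨trivial, this⟩))))
      · intro a ha hne
        have c4 := Bef_before (u := u ++ [x, z]) (v := v) (y := y) (by simpa using hn) (by simpa using ha.2)
        have c5 : a.val < y := ha.1
        have c7 : a.val ≠ z := by omega
        have c6 : a.val ≠ x := fun h => hne ⟨Fin.ext h, rfl⟩
        refine ⟨by rw [Fin.lt_def]; simp; omega, ?_⟩
        simp only [Bef_append]
        have : a.val ∈ u := by simpa [c6, c7] using c4
        exact Or.inr (Or.inr ⟨this, by simp⟩)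
      · intro h
        have : z < y := h.1
        omega
    · apply grk_mono
      intro a b hab
      refine ⟨hab.1, k2_key' hab.2 ?_⟩
      have : a.val < b := hab.1
      omega

/-- Knuth equivalence -/
def KEq : List ℕ → List ℕ → Prop := Relation.EqvGen KStep

theorem KEq.perm {w w' : List ℕ} (h : KEq w w') : w.Perm w' := by
  induction h with
  | rel x y h => exact h.perm
  | refl x => exact List.Perm.refl _
  | symm x y h ih => exact ih.symm
  | trans x y z h1 h2 ih1 ih2 => exact ih1.trans ih2

theorem grk_KEq {n m : ℕ} {w w' : List ℕ} (h : KEq w w') (hn : w.Nodup) (hlt : ∀ a ∈ w, a < n) :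
    grk n m w = grk n m w' := by
  induction h with
  | rel x y h => exact grk_KStep h hn hlt
  | refl x => rfl
  | symm x y h ih => 
    have hp := KEq.perm h
    exact (ih (hp.nodup_iff.mpr hn) (fun a ha => hlt a (hp.mem_iff.mp ha))).symm
  | trans x y z h1 h2 ih1 ih2 => 
    have hp := KEq.perm h1
    exact (ih1 hn hlt).trans (ih2 (hp.nodup_iff.mp hn) (fun a ha => hlt a (hp.mem_iff.mpr ha)))

theorem KStep.filter {w w' : List ℕ} (j : ℕ) (h : KStep w w') : 
    KEq (w.filter (fun a => decide (a < j))) (w'.filter (fun a => decide (a < j))) := by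
  cases h with
  | k1 u v x y z hxy hyz =>
    by_cases hz : z < j
    · have hy : y < j := by omega
      have hx : x < j := by omega
      simp only [List.filter_append, List.filter_cons, hz, hy, hx, decide_true, if_true]
      exact Relation.EqvGen.rel _ _ (KStep.k1 _ _ _ _ _ hxy hyz)
    · simp only [List.filter_append, List.filter_cons, hz, decide_false, Bool.false_eq_true, if_false]
      exact Relation.EqvGen.refl _
  | k2 u v x y z hxy hyz =>
    by_cases hz : z < j
    · have hy : y < j := by omega
      have hx : x < j := by omega
      simp only [List.filter_append, List.filter_cons, hz, hy, hx, decide_true, if_true]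
      exact Relation.EqvGen.rel _ _ (KStep.k2 _ _ _ _ _ hxy hyz)
    · simp only [List.filter_append, List.filter_cons, hz, decide_false, Bool.false_eq_true, if_false]
      exact Relation.EqvGen.refl _

theorem KEq.filter {w w' : List ℕ} (j : ℕ) (h : KEq w w') : 
    KEq (w.filter (fun a => decide (a < j))) (w'.filter (fun a => decide (a < j))) := by
  induction h with
  | rel x y h => exact h.filter j
  | refl x => exact Relation.EqvGen.refl _
  | symm x y h ih => exact Relation.EqvGen.symm _ _ ih
  | trans x y z h1 h2 ih1 ih2 => exact Relation.EqvGen.trans _ _ _ ih1 ih2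

theorem KStep.ctx {w w' : List ℕ} (a b : List ℕ) (h : KStep w w') : KStep (a ++ w ++ b) (a ++ w' ++ b) := by
  cases h with
  | k1 u v x y z hxy hyz =>
    have := KStep.k1 (a ++ u) (v ++ b) x y z hxy hyz
    simpa using this
  | k2 u v x y z hxy hyz =>
    have := KStep.k2 (a ++ u) (v ++ b) x y z hxy hyz
    simpa using this

theorem KEq.ctx {w w' : List ℕ} (a b : List ℕ) (h : KEq w w') : KEq (a ++ w ++ b) (a ++ w' ++ b) := by
  induction h with
  | rel x y h => exact Relation.EqvGen.rel _ _ (h.ctx a b)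
  | refl x => exact Relation.EqvGen.refl _
  | symm x y h ih => exact Relation.EqvGen.symm _ _ ih
  | trans x y z h1 h2 ih1 ih2 => exact Relation.EqvGen.trans _ _ _ ih1 ih2
end WordSec


section TabSec

/-- row reading word -/
def rd : List (List ℕ) → List ℕ
  | [] => []
  | r :: rs => rd rs ++ r

def DomR : List ℕ → List ℕ → Prop
  | _, [] => True
  | [], _ :: _ => False
  | a :: r, b :: s => a < b ∧ DomR r s

theorem DomR_nil (r : List ℕ) : DomR r [] := by cases r <;> simp [DomR]

def IsTab (T : List (List ℕ)) : Prop := (∀ r ∈ T, r.Pairwise (· < ·)) ∧ T.Pairwise DomR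

theorem DomR.trans {r s t : List ℕ} (h1 : DomR r s) (h2 : DomR s t) : DomR r t := by
  induction t generalizing r s with
  | nil => exact DomR_nil r
  | cons c t ih =>
    cases s with
    | nil => exact h2.elim
    | cons b s => 
      cases r with
      | nil => exact h1.elim
      | cons a r => exact ⟨h1.1.trans h2.1, ih h1.2 h2.2⟩

theorem DomR.length {r s : List ℕ} (h : DomR r s) : s.length ≤ r.length := by
  induction s generalizing r with
  | nil => simp
  | cons b s ih =>
    cases r with
    | nil => exact h.elim
    | cons a r => simpa using ih h.2

theorem DomR.get {r s : List ℕ} (h : DomR r s) (i : ℕ) (b : ℕ) (hb : s[i]? = some b) : 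
    ∃ a, r[i]? = some a ∧ a < b := by
  induction s generalizing r i with
  | nil => simp at hb
  | cons b' s ih =>
    cases r with
    | nil => exact h.elim
    | cons a r => 
      cases i with
      | zero => simp at hb; subst hb; exact ⟨a, by simp, h.1⟩
      | succ i => simpa using ih h.2 i (by simpa using hb)

theorem insRow_spec (x : ℕ) (row : List ℕ) (hx : x ∉ row) :
    (insRow x row = (row ++ [x], none) ∧ ∀ a ∈ row, a < x) ∨ 
    ∃ A y B, row = A ++ y :: B ∧ insRow x row = (A ++ x :: B, some y) ∧ (∀ a ∈ A, a < x) ∧ x < y := by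
  induction row with
  | nil => left; simp [insRow]
  | cons c row ih =>
    simp only [List.mem_cons, not_or] at hx
    by_cases h : c ≤ x
    · have hc : c < x := lt_of_le_of_ne h (Ne.symm hx.1)
      rcases ih hx.2 with ⟨h1, h2⟩ | ⟨A, y, B, h1, h2, h3, h4⟩
      · left
        simp only [insRow, h, if_true, h1]
        refine ⟨rfl, ?_⟩
        intro a ha
        rcases List.mem_cons.mp ha with rfl | ha
        · exact hc
        · exact h2 a ha
      · right
        refine ⟨c :: A, y, B, by rw [h1]; rfl, ?_, ?_, h4⟩
        · simp only [insRow, h, if_true, h2]; rfl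
        · intro a ha
          rcases List.mem_cons.mp ha with rfl | ha
          · exact hc
          · exact h3 a ha
    · right
      exact ⟨[], c, row, rfl, by simp [insRow, h], by simp, by omega⟩

theorem insTab_none {x : ℕ} {row row' : List ℕ} (rest : List (List ℕ)) (h : insRow x row = (row', none)) :
    insTab (row :: rest) x = row' :: rest := by
  simp [insTab, h]

theorem insTab_some {x y : ℕ} {row row' : List ℕ} (rest : List (List ℕ)) (h : insRow x row = (row', some y)) :
    insTab (row :: rest) x = row' :: insTab rest y := by
  simp [insTab, h]

theorem KEq.rfl' {w : List ℕ} : KEq w w := Relation.EqvGen.refl _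
theorem KEq.symm' {w w' : List ℕ} (h : KEq w w') : KEq w' w := Relation.EqvGen.symm _ _ h
theorem KEq.trans' {w w' w'' : List ℕ} (h : KEq w w') (h' : KEq w' w'') : KEq w w'' := Relation.EqvGen.trans _ _ _ h h'
theorem KEq.of {w w' : List ℕ} (h : KStep w w') : KEq w w' := Relation.EqvGen.rel _ _ h

theorem pull1 (x : ℕ) (y : ℕ) (B : List ℕ) (hs : (y :: B).Pairwise (· < ·)) (hxy : x < y) :
    KEq (y :: B ++ [x]) (y :: x :: B) := by
  induction B generalizing y with
  | nil => exact KEq.rfl'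
  | cons b B ih =>
    have h1 := (List.pairwise_cons.mp hs)
    have hyb : y < b := h1.1 b (by simp)
    have h2 := (ih b h1.2 (by omega)).ctx [y] []
    simp only [List.append_nil, List.cons_append, List.nil_append] at h2
    refine KEq.trans' h2 (KEq.symm' (KEq.of ?_))
    exact KStep.k1 [] B x y b hxy hyb

theorem pull2 (y : ℕ) (A : List ℕ) (h : ℕ) (B : List ℕ) (hs : (A ++ [h]).Pairwise (· < ·)) (hxy : h < y) :
    KEq (A ++ y :: h :: B) (y :: A ++ h :: B) := by
  induction A with
  | nil => exact KEq.rfl'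
  | cons a A ih =>
    have h1 := (List.pairwise_cons.mp hs)
    have h2 := (ih h1.2).ctx [a] []
    simp only [List.append_nil, List.cons_append, List.nil_append] at h2
    refine KEq.trans' h2 (KEq.of ?_)
    cases A with
    | nil => exact KStep.k2 [] B a h y (h1.1 h (by simp)) hxy
    | cons c A => 
      have hc : c < h := by
        have := (List.pairwise_cons.mp h1.2).1 h (by simp)
        exact this
      exact KStep.k2 [] (A ++ h :: B) a c y (h1.1 c (by simp)) (by omega)

theorem KEq_insRow {A B : List ℕ} {x y : ℕ} (hs : (A ++ y :: B).Pairwise (· < ·)) 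
    (hA : ∀ a ∈ A, a < x) (hxy : x < y) : KEq (A ++ y :: B ++ [x]) (y :: (A ++ x :: B)) := by
  have h := List.pairwise_append.mp hs
  have h1 := (pull1 x y B h.2.1 hxy).ctx A []
  simp only [List.append_nil] at h1
  have h2 := pull2 y A x B (by
    rw [List.pairwise_append]
    exact ⟨h.1, by simp, by simpa using hA⟩) hxy
  have e : A ++ y :: B ++ [x] = A ++ (y :: B ++ [x]) := by simp
  rw [e]
  exact KEq.trans' h1 h2

theorem KEq_insTab (T : List (List ℕ)) (x : ℕ) (hs : ∀ r ∈ T, r.Pairwise (· < ·)) 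
    (hn : (rd T ++ [x]).Nodup) : KEq (rd T ++ [x]) (rd (insTab T x)) := by
  induction T generalizing x with
  | nil => simp [rd, insTab]; exact KEq.rfl'
  | cons row rest ih =>
    have hx : x ∉ row := by
      intro h
      simp only [rd] at hn
      rw [List.nodup_append] at hn
      exact hn.2.2 x (by simp [h]) x (by simp) rfl
    rcases insRow_spec x row hx with ⟨h1, h2⟩ | ⟨A, y, B, h1, h2, h3, h4⟩
    · rw [insTab_none rest h1]
      simp [rd]; exact KEq.rfl'
    · rw [insTab_some rest h2]
      have hk := (KEq_insRow (B := B) (by rw [← h1]; exact hs row (by simp)) h3 h4).ctx (rd rest) []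
      rw [← h1] at hk
      simp only [List.append_nil] at hk
      have hk' : KEq (rd (row :: rest) ++ [x]) (rd rest ++ [y] ++ (A ++ x :: B)) := by
        simpa [rd] using hk
      have hn2 : (rd rest ++ [y]).Nodup := by
        have := hk'.perm.nodup_iff.mp hn
        exact (List.nodup_append.mp this).1
      have hk2 := (ih y (fun r hr => hs r (by simp [hr])) hn2).ctx [] (A ++ x :: B)
      simp only [List.nil_append] at hk2
      exact KEq.trans' hk' hk2

theorem DomR.append {r s : List ℕ} (h : DomR r s) (x : List ℕ) : DomR (r ++ x) s := by
  induction s generalizing r with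
  | nil => exact DomR_nil _
  | cons b s ih =>
    cases r with
    | nil => exact h.elim
    | cons a r => exact ⟨h.1, ih h.2⟩

theorem DomR.dec {A B s : List ℕ} {x y : ℕ} (h : DomR (A ++ y :: B) s) (hxy : x < y) : DomR (A ++ x :: B) s := by
  induction s generalizing A with
  | nil => exact DomR_nil _
  | cons b s ih =>
    cases A with
    | nil => exact ⟨hxy.trans h.1, h.2⟩
    | cons a r => exact ⟨h.1, ih h.2⟩

theorem DomR_bump {A B s s' : List ℕ} {x y : ℕ} (h : DomR (A ++ y :: B) s) (hA : ∀ a ∈ A, a < x) (hxy : x < y)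
    (hs' : (insRow y s).1 = s') : DomR (A ++ x :: B) s' := by
  induction A generalizing s s' with
  | nil =>
    cases s with
    | nil => simp [insRow] at hs'; subst hs'; exact ⟨hxy, DomR_nil _⟩
    | cons b s => 
      have : ¬ b ≤ y := not_le.mpr h.1
      simp [insRow, this] at hs'; subst hs'
      exact ⟨hxy, h.2⟩
  | cons a A ih =>
    have ha := hA a (by simp)
    cases s with
    | nil => simp [insRow] at hs'; subst hs'; exact ⟨by omega, DomR_nil _⟩
    | cons b s => 
      by_cases hb : b ≤ y
      · simp [insRow, hb] at hs'; subst hs'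
        exact ⟨h.1, ih h.2 (fun a ha => hA a (by simp [ha])) rfl⟩
      · simp [insRow, hb] at hs'; subst hs'
        exact ⟨by omega, DomR.dec h.2 hxy⟩

theorem insTab_head (T : List (List ℕ)) (x : ℕ) : 
    (insTab T x).head? = some (insRow x (T.headD [])).1 := by
  cases T with
  | nil => simp [insTab, insRow]
  | cons r T => 
    rcases h : insRow x r with ⟨r', _ | y⟩
    · simp [insTab_none T h, h]
    · simp [insTab_some T h, h]

theorem IsTab.cons_head {r : List ℕ} {T : List (List ℕ)} (hr : r.Pairwise (· < ·)) (hT : IsTab T) 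
    (h : DomR r (T.headD [])) : IsTab (r :: T) := by
  refine ⟨?_, ?_⟩
  · intro s hs
    rcases List.mem_cons.mp hs with rfl | hs
    · exact hr
    · exact hT.1 s hs
  · rw [List.pairwise_cons]
    refine ⟨?_, hT.2⟩
    intro s hs
    cases T with
    | nil => simp at hs
    | cons t T =>
      simp at h
      rcases List.mem_cons.mp hs with rfl | hs
      · exact h
      · exact h.trans ((List.pairwise_cons.mp hT.2).1 s hs)

theorem IsTab.tail {r : List ℕ} {T : List (List ℕ)} (h : IsTab (r :: T)) : IsTab T :=
  ⟨fun s hs => h.1 s (by simp [hs]), (List.pairwise_cons.mp h.2).2⟩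

theorem IsTab_insTab (T : List (List ℕ)) (x : ℕ) (hT : IsTab T) (hn : (rd T ++ [x]).Nodup) : 
    IsTab (insTab T x) := by
  induction T generalizing x with
  | nil => simp [insTab, IsTab]
  | cons row rest ih =>
    have hx : x ∉ row := by
      intro h
      simp only [rd] at hn
      rw [List.nodup_append] at hn
      exact hn.2.2 x (by simp [h]) x (by simp) rfl
    have hrow := hT.1 row (by simp)
    have hdom : DomR row (rest.headD []) := by
      cases rest with
      | nil => exact DomR_nil _
      | cons s rest => exact (List.pairwise_cons.mp hT.2).1 s (by simp)
    rcases insRow_spec x row hx with ⟨h1, h2⟩ | ⟨A, y, B, h1, h2, h3, h4⟩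
    · rw [insTab_none rest h1]
      apply IsTab.cons_head _ hT.tail (hdom.append _)
      rw [List.pairwise_append]
      exact ⟨hrow, by simp, by simpa using h2⟩
    · rw [insTab_some rest h2]
      have hn2 : (rd rest ++ [y]).Nodup := by
        simp only [rd, List.append_assoc] at hn
        rw [List.nodup_append] at hn ⊢
        refine ⟨hn.1, by simp, ?_⟩
        intro a ha b hb
        simp at hb; subst hb
        exact hn.2.2 a ha b (by simp [h1])
      apply IsTab.cons_head _ (ih y hT.tail hn2)
      · have : (insTab rest y).headD [] = (insRow y (rest.headD [])).1 := by
          have := insTab_head rest y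
          rw [List.headD_eq_head?_getD, this]; rfl
        rw [this]
        rw [h1] at hdom
        exact DomR_bump hdom h3 h4 rfl
      · rw [h1] at hrow
        rw [List.pairwise_append, List.pairwise_cons] at hrow ⊢
        refine ⟨hrow.1, ⟨fun b hb => h4.trans (hrow.2.1.1 b hb), hrow.2.1.2⟩, ?_⟩
        intro a ha b hb
        rcases List.mem_cons.mp hb with rfl | hb
        · exact h3 a ha
        · exact hrow.2.2 a ha b (by simp [hb])

def ptab (w : List ℕ) : List (List ℕ) := w.foldl insTab []

theorem ptab_append (w : List ℕ) (x : ℕ) : ptab (w ++ [x]) = insTab (ptab w) x := by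
  simp [ptab]

theorem insTab_ne_nil (T : List (List ℕ)) (x : ℕ) (h : ∀ r ∈ T, r ≠ []) : ∀ r ∈ insTab T x, r ≠ [] := by
  induction T generalizing x with
  | nil => simp [insTab]
  | cons row rest ih =>
    have hr : (insRow x row).1 ≠ [] := by
      cases row with
      | nil => simp [insRow]
      | cons a row => simp only [insRow]; split_ifs <;> simp
    rcases h' : insRow x row with ⟨r', _ | y⟩
    · rw [insTab_none rest h']; rw [h'] at hr
      intro r hr2
      rcases List.mem_cons.mp hr2 with rfl | hr2
      · exact hr
      · exact h r (by simp [hr2])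
    · rw [insTab_some rest h']; rw [h'] at hr
      intro r hr2
      rcases List.mem_cons.mp hr2 with rfl | hr2
      · exact hr
      · exact ih y (fun r hr => h r (by simp [hr])) r hr2

theorem ptab_ne_nil (w : List ℕ) : ∀ r ∈ ptab w, r ≠ [] := by
  induction w using List.reverseRecOn with
  | nil => simp [ptab]
  | append_singleton w x ih => rw [ptab_append]; exact insTab_ne_nil _ _ ih

theorem ptab_spec (w : List ℕ) (hn : w.Nodup) : IsTab (ptab w) ∧ KEq w (rd (ptab w)) := by
  induction w using List.reverseRecOn with
  | nil => exact ⟨by simp [ptab, IsTab], KEq.rfl'⟩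
  | append_singleton w x ih =>
    have h1 := ih (List.nodup_append.mp hn).1
    rw [ptab_append]
    have h2 := h1.2.ctx [] [x]
    simp only [List.nil_append] at h2
    have hn2 := h2.perm.nodup_iff.mp hn
    exact ⟨IsTab_insTab _ _ h1.1 hn2, KEq.trans' h2 (KEq_insTab _ _ h1.1.1 hn2)⟩

end TabSec


section TabRank

theorem mem_rd {T : List (List ℕ)} {a : ℕ} : a ∈ rd T ↔ ∃ r ∈ T, a ∈ r := by
  induction T with
  | nil => simp [rd]
  | cons r T ih => simp [rd, ih, or_comm]

theorem rd_perm (T : List (List ℕ)) : (rd T).Perm T.flatten := by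
  induction T with
  | nil => simp [rd]
  | cons r T ih => 
    simp only [rd, List.flatten_cons]
    exact List.perm_append_comm.trans (ih.append_left r)

theorem Inc_step {T : List (List ℕ)} (hT : IsTab T) (hn : (rd T).Nodup) (c a b : ℕ) (hab : a < b) 
    (h : Bef (rd T) a b) (ha : ∃ r ∈ T, a ∈ r.drop c) : ∃ r ∈ T, b ∈ r.drop (c+1) := by
  induction T with
  | nil => exact h.elim
  | cons r T ih =>
    simp only [rd, Bef_append] at h
    simp only [rd] at hn
    have hn' := List.nodup_append.mp hn
    have hr := hT.1 r (by simp)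
    have key : ∀ a', (∃ i, r[i]? = some a' ∧ c ≤ i) → a' < b → b ∈ r → b ∈ r.drop (c+1) := by
      rintro a' ⟨i, hi, hci⟩ hab' hbr
      obtain ⟨j, hj⟩ := List.mem_iff_getElem?.mp hbr
      have hij : i < j := by
        by_contra hcon
        have hle : j ≤ i := by omega
        rcases hle.lt_or_eq with h5 | h5
        · obtain ⟨hj1, hj2⟩ := List.getElem?_eq_some_iff.mp hj
          obtain ⟨hi1, hi2⟩ := List.getElem?_eq_some_iff.mp hi
          have := List.pairwise_iff_getElem.mp hr j i hj1 hi1 h5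
          omega
        · subst h5; rw [hi] at hj; injection hj; omega
      rw [List.mem_iff_getElem?]
      exact ⟨j - (c+1), by rw [List.getElem?_drop, ← hj]; congr 1; omega⟩
    rcases h with h | h | ⟨h1, h2⟩
    · obtain ⟨s, hs, ha2⟩ := ha
      have har := h.mem_left
      have hs' : s ∈ T := by
        rcases List.mem_cons.mp hs with rfl | hs
        · exact absurd rfl (hn'.2.2 a har a (List.mem_of_mem_drop ha2))
        · exact hs
      obtain ⟨t, ht, hb⟩ := ih hT.tail hn'.1 h ⟨s, hs', ha2⟩
      exact ⟨t, by simp [ht], hb⟩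
    · refine ⟨r, by simp, ?_⟩
      obtain ⟨s, hs, ha2⟩ := ha
      have har := h.mem_left
      have hs' : s = r := by
        rcases List.mem_cons.mp hs with rfl | hs
        · rfl
        · exact absurd rfl (hn'.2.2 a (mem_rd.mpr ⟨s, hs, List.mem_of_mem_drop ha2⟩) a har)
      subst hs'
      obtain ⟨i, hi⟩ := List.mem_iff_getElem?.mp ha2
      rw [List.getElem?_drop] at hi
      exact key a ⟨c + i, hi, by omega⟩ hab h.mem_right
    · refine ⟨r, by simp, ?_⟩
      obtain ⟨s, hs, ha2⟩ := ha
      have hs' : s ∈ T := by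
        rcases List.mem_cons.mp hs with rfl | hs
        · exact absurd rfl (hn'.2.2 a h1 a (List.mem_of_mem_drop ha2))
        · exact hs
      obtain ⟨i, hi⟩ := List.mem_iff_getElem?.mp ha2
      rw [List.getElem?_drop] at hi
      obtain ⟨a', ha', hlt⟩ := ((List.pairwise_cons.mp hT.2).1 s hs').get _ _ hi
      exact key a' ⟨c + i, ha', by omega⟩ (by omega) h2

theorem rank_le_cols {n : ℕ} {K : Type*} [Field K] (A : Matrix (Fin n) (Fin n) K) (s : Finset (Fin n))
    (h : ∀ a b, A a b ≠ 0 → b ∈ s) : A.rank ≤ s.card := by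
  have e : A = A * diagonal (fun i => if i ∈ s then (1:K) else 0) := by
    ext a b
    rw [mul_diagonal]
    by_cases hb : b ∈ s
    · simp [hb]
    · simp only [hb, if_false, mul_zero]
      by_contra hc
      exact hb (h a b hc)
  rw [e]
  refine (rank_mul_le_right _ _).trans ?_
  rw [rank_diagonal, Fintype.card_subtype]
  apply le_of_eq
  congr 1; ext i; simp

theorem le_rank_cols {n : ℕ} {K : Type*} [Field K] (A : Matrix (Fin n) (Fin n) K) (s : Finset (Fin n))
    (h : ∀ a ∈ s, ∃ v : Fin n → K, A *ᵥ v = Pi.single a 1) : s.card ≤ A.rank := by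
  choose! v hv using h
  have e : diagonal (fun i => if i ∈ s then (1:K) else 0) = 
      A * (Matrix.of fun i a => if a ∈ s then v a i else 0) := by
    ext a b
    rw [diagonal_apply, mul_apply]
    by_cases hb : b ∈ s
    · have := congrFun (hv b hb) a
      rw [mulVec, dotProduct] at this
      simp only [of_apply, hb, if_true, this, Pi.single_apply]
      by_cases hab : a = b
      · subst hab; simp [hb]
      · simp [hab]
    · simp only [of_apply, hb, if_false, mul_zero, Finset.sum_const_zero]
      by_cases hab : a = b
      · subst hab; simp [hb]
      · simp [hab]
  have h1 : (diagonal (fun i => if i ∈ s then (1:K) else 0)).rank = s.card := by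
    rw [rank_diagonal, Fintype.card_subtype]
    congr 1; ext i; simp
  rw [← h1, e]
  exact rank_mul_le_left _ _

theorem card_fin_list {n : ℕ} (V : List ℕ) (hV : V.Nodup) (hlt : ∀ a ∈ V, a < n) :
    (Finset.univ.filter (fun a : Fin n => a.val ∈ V)).card = V.length := by
  rw [← List.toFinset_card_of_nodup hV, ← Finset.card_map Fin.valEmbedding]
  congr 1
  ext a
  simp only [Finset.mem_map, Finset.mem_filter, Finset.mem_univ, true_and, Fin.valEmbedding_apply,
    List.mem_toFinset]
  constructor
  · rintro ⟨b, hb, rfl⟩; exact hb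
  · intro h; exact ⟨⟨a, hlt a h⟩, h, rfl⟩

theorem grk_tab_le {n m : ℕ} {T : List (List ℕ)} (hT : IsTab T) (hn : (rd T).Nodup) (hlt : ∀ a ∈ rd T, a < n)
    (hm : 1 ≤ m) : grk n m (rd T) ≤ (T.map (fun r => r.length - m)).sum := by
  have key : ∀ m, 1 ≤ m → ∀ a b : Fin n, (GK (Inc n (rd T)) ^ m) a b ≠ 0 → ∃ r ∈ T, b.val ∈ r.drop m := by
    intro m hm
    induction m, hm using Nat.le_induction with
    | base =>
      intro a b h
      rw [pow_one] at h
      have := GK_supp _ _ _ h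
      refine Inc_step hT hn 0 a b this.1 this.2 ?_
      simpa using mem_rd.mp this.2.mem_left
    | succ m hm ih =>
      intro a b h
      rw [pow_succ, mul_apply] at h
      obtain ⟨c, _, hc⟩ := Finset.exists_ne_zero_of_sum_ne_zero h
      have h1 := ih a c (left_ne_zero_of_mul hc)
      have := GK_supp _ _ _ (right_ne_zero_of_mul hc)
      exact Inc_step hT hn m c b this.1 this.2 h1
  refine (rank_le_cols _ (Finset.univ.filter (fun a : Fin n => a.val ∈ (T.map (List.drop m)).flatten)) ?_).trans ?_
  · intro a b h
    obtain ⟨r, hr, hb⟩ := key m hm a b h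
    simp only [Finset.mem_filter, Finset.mem_univ, true_and, List.mem_flatten, List.mem_map]
    exact ⟨_, ⟨r, hr, rfl⟩, hb⟩
  · have hsub : ((T.map (List.drop m)).flatten).Sublist T.flatten := by
      clear key hT hn hlt
      induction T with
      | nil => simp
      | cons r T ih => simp only [List.map_cons, List.flatten_cons]; exact (List.drop_sublist _ _).append ih
    have hnf := (rd_perm T).nodup_iff.mp hn
    rw [card_fin_list]
    · rw [List.length_flatten, List.map_map]
      apply le_of_eq
      congr 1
      apply List.map_congr_left
      intro r _; simp
    · exact hsub.nodup hnf
    · intro a ha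
      exact hlt a ((rd_perm T).mem_iff.mpr (hsub.mem ha))

def SuccT (T : List (List ℕ)) (a b : ℕ) : Prop := ∃ r ∈ T, ∃ i : ℕ, r[i]? = some a ∧ r[i+1]? = some b

theorem Bef_rd {T : List (List ℕ)} {r : List ℕ} (hr : r ∈ T) {a b : ℕ} (h : Bef r a b) : Bef (rd T) a b := by
  induction T with
  | nil => simp at hr
  | cons s T ih =>
    simp only [rd, Bef_append]
    rcases List.mem_cons.mp hr with rfl | hr
    · exact Or.inr (Or.inl h)
    · exact Or.inl (ih hr)

theorem SuccT_inc {T : List (List ℕ)} (hT : IsTab T) {a b : ℕ} (h : SuccT T a b) : a < b ∧ Bef (rd T) a b := by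
  obtain ⟨r, hr, i, h1, h2⟩ := h
  constructor
  · obtain ⟨hj1, hj2⟩ := List.getElem?_eq_some_iff.mp h1
    obtain ⟨hi1, hi2⟩ := List.getElem?_eq_some_iff.mp h2
    have := List.pairwise_iff_getElem.mp (hT.1 r hr) i (i+1) hj1 hi1 (by omega)
    omega
  · exact Bef_rd hr ((Bef_iff _ _ _).mpr ⟨i, i+1, by omega, h1, h2⟩)

theorem SuccT_uniq {T : List (List ℕ)} (hn : (rd T).Nodup) {a a' b : ℕ} (h : SuccT T a b) (h' : SuccT T a' b) : 
    a = a' := by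
  obtain ⟨r, hr, i, h1, h2⟩ := h
  obtain ⟨r', hr', i', h1', h2'⟩ := h'
  have hnf := (rd_perm T).nodup_iff.mp hn
  rw [List.nodup_flatten] at hnf
  have hrr : r = r' := by
    by_contra hne
    haveI : Std.Symm (List.Disjoint (α := ℕ)) := ⟨fun _ _ h => h.symm⟩
    have := hnf.2.forall hr hr' hne
    exact this (List.mem_of_getElem? h2) (List.mem_of_getElem? h2')
  subst hrr
  have hrn := hnf.1 r hr
  obtain ⟨hi1, hi2⟩ := List.getElem?_eq_some_iff.mp h2
  obtain ⟨hi1', hi2'⟩ := List.getElem?_eq_some_iff.mp h2'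
  have : i + 1 = i' + 1 := (List.Nodup.getElem_inj_iff hrn).mp (hi2.trans hi2'.symm)
  obtain rfl : i = i' := by omega
  rw [h1] at h1'
  injection h1'

theorem le_grk_tab {n m : ℕ} {T : List (List ℕ)} (hT : IsTab T) (hn : (rd T).Nodup) (hlt : ∀ a ∈ rd T, a < n) :
    (T.map (fun r => r.length - m)).sum ≤ grk n m (rd T) := by
  let N0 : Matrix (Fin n) (Fin n) (Kg n) := fun a b => if SuccT T a b then 1 else 0
  have h1 : (N0 ^ m).rank ≤ grk n m (rd T) := by
    apply rank_le_gr
    intro a b h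
    have : SuccT T a b := by
      by_contra hc; exact h (by simp [N0, hc])
    exact SuccT_inc hT this
  refine le_trans ?_ h1
  have hstep : ∀ a b : Fin n, SuccT T a b → N0 *ᵥ Pi.single b 1 = Pi.single a 1 := by
    intro a b h
    ext c
    rw [mulVec_single_one, col_apply, Pi.single_apply]
    by_cases hc : SuccT T c b
    · have : c = a := Fin.ext (SuccT_uniq hn hc h)
      simp [N0, hc, this]; rw [← this]; simpa using hc
    · have : c ≠ a := by rintro rfl; exact hc h
      simp [N0, hc, this]
  have hpow : ∀ m, ∀ r ∈ T, ∀ i : ℕ, ∀ a b : Fin n, r[i]? = some a.val → r[i+m]? = some b.val → 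
      (N0 ^ m) *ᵥ Pi.single b 1 = Pi.single a 1 := by
    intro m
    induction m with
    | zero =>
      intro r hr i a b ha hb
      rw [add_zero, ha] at hb
      injection hb with hb
      rw [Fin.ext hb, pow_zero, one_mulVec]
    | succ m ih =>
      intro r hr i a b ha hb
      have hlen : i + m < r.length := by
        obtain ⟨h, _⟩ := List.getElem?_eq_some_iff.mp hb
        omega
      have hc : r[i+m]? = some r[i+m] := List.getElem?_eq_getElem hlen
      have hcn : r[i+m] < n := hlt _ (mem_rd.mpr ⟨r, hr, List.getElem_mem _⟩)
      rw [pow_succ, ← mulVec_mulVec, hstep ⟨r[i+m], hcn⟩ b ⟨r, hr, i+m, hc, hb⟩]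
      exact ih r hr i a _ ha hc
  have hsub : ((T.map (fun r => r.take (r.length - m))).flatten).Sublist T.flatten := by
    clear hpow hstep h1 N0 hT hn hlt
    induction T with
    | nil => simp
    | cons r T ih => simp only [List.map_cons, List.flatten_cons]; exact (List.take_sublist _ _).append ih
  have hnf := (rd_perm T).nodup_iff.mp hn
  have hcard := card_fin_list (n := n) ((T.map (fun r => r.take (r.length - m))).flatten) (hsub.nodup hnf) 
    (fun a ha => hlt a ((rd_perm T).mem_iff.mpr (hsub.mem ha)))
  have hlen : ((T.map (fun r => r.take (r.length - m))).flatten).length = (T.map (fun r => r.length - m)).sum := by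
    rw [List.length_flatten, List.map_map]
    congr 1
    apply List.map_congr_left
    intro r _; simp
  rw [← hlen, ← hcard]
  apply le_rank_cols
  intro a ha
  simp only [Finset.mem_filter, Finset.mem_univ, true_and, List.mem_flatten, List.mem_map] at ha
  obtain ⟨_, ⟨r, hr, rfl⟩, ha⟩ := ha
  obtain ⟨i, hi⟩ := List.mem_iff_getElem?.mp ha
  obtain ⟨hi1, hi2⟩ := List.getElem?_eq_some_iff.mp hi
  simp at hi1 hi2
  have hb : r[i+m]? = some r[i+m] := List.getElem?_eq_getElem (by omega)
  have hcn : r[i+m] < n := hlt _ (mem_rd.mpr ⟨r, hr, List.getElem_mem _⟩)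
  exact ⟨_, hpow m r hr i a ⟨r[i+m], hcn⟩ (by rw [← hi2]; exact List.getElem?_eq_getElem (by omega)) hb⟩

theorem grk_tab {n m : ℕ} {T : List (List ℕ)} (hT : IsTab T) (hn : (rd T).Nodup) (hlt : ∀ a ∈ rd T, a < n)
    (hm : 1 ≤ m) : grk n m (rd T) = (T.map (fun r => r.length - m)).sum :=
  le_antisymm (grk_tab_le hT hn hlt hm) (le_grk_tab hT hn hlt)

theorem rd_filter (p : ℕ → Bool) (T : List (List ℕ)) : (rd T).filter p = rd (T.map (List.filter p)) := by
  induction T with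
  | nil => simp [rd]
  | cons r T ih => simp [rd, ih]

theorem DomR_filter {r s : List ℕ} (j : ℕ) (h : DomR r s) (hs : s.Pairwise (· < ·)) : 
    DomR (r.filter (fun a => decide (a < j))) (s.filter (fun a => decide (a < j))) := by
  induction s generalizing r with
  | nil => exact DomR_nil _
  | cons b s ih =>
    cases r with
    | nil => exact h.elim
    | cons a r => 
      have h1 := List.pairwise_cons.mp hs
      by_cases hb : b < j
      · have ha : a < j := h.1.trans hb
        simp only [List.filter_cons, ha, hb, decide_true, if_true]
        exact ⟨h.1, ih h.2 h1.2⟩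
      · have : (b :: s).filter (fun a => decide (a < j)) = [] := by
          rw [List.filter_eq_nil_iff]
          intro c hc
          rcases List.mem_cons.mp hc with rfl | hc
          · simpa using hb
          · have := h1.1 c hc
            simp; omega
        rw [this]; exact DomR_nil _

theorem IsTab_filter {T : List (List ℕ)} (j : ℕ) (hT : IsTab T) : 
    IsTab (T.map (List.filter (fun a => decide (a < j)))) := by
  constructor
  · intro r hr
    obtain ⟨s, hs, rfl⟩ := List.mem_map.mp hr
    exact (hT.1 s hs).filter _
  · rw [List.pairwise_map]
    exact hT.2.imp_of_mem (fun {r s} hr hs h => DomR_filter j h (hT.1 s hs))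

theorem GK_filter {n : ℕ} (w : List ℕ) (j : ℕ) : 
    GK (Inc n (w.filter (fun a => decide (a < j)))) = GK (Inc n w) * Dm n (Kg n) j := by
  ext a b
  rw [Dm, mul_diagonal]
  simp only [GK, Gm, map_apply, Inc, Bef_filter, decide_eq_true_eq]
  by_cases hb : b.val < j
  · by_cases hab : a < b
    · have : a.val < j := lt_trans hab hb
      simp only [hb, this, and_true, true_and, if_true, mul_one]
      congr
    · simp [hab]
  · simp [hb]

theorem gr_filter {n m : ℕ} (w : List ℕ) (j : ℕ) (hm : 1 ≤ m) : 
    (GK (Inc n w) ^ m * Dm n (Kg n) j).rank = grk n m (w.filter (fun a => decide (a < j))) := by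
  rw [grk, GK_filter]
  congr 1
  induction m, hm using Nat.le_induction with
  | base => simp
  | succ m hm ih =>
    rw [pow_succ (GK (Inc n w) * Dm n (Kg n) j), ← ih, pow_succ, mul_assoc, mul_assoc]
    congr 1
    symm
    apply upper_mul_Dm
    intro a b hab
    by_contra hc
    exact absurd (GK_supp _ _ _ hc).1 (not_lt.mpr hab.le)

theorem gr_tab {n m : ℕ} (w : List ℕ) (hn : w.Nodup) (hlt : ∀ a ∈ w, a < n) (j : ℕ) (hm : 1 ≤ m) : 
    (GK (Inc n w) ^ m * Dm n (Kg n) j).rank = 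
      ((ptab w).map (fun r => (r.filter (fun a => decide (a < j))).length - m)).sum := by
  obtain ⟨h1, h2⟩ := ptab_spec w hn
  have h3 := h2.filter j
  have hn3 : (w.filter (fun a => decide (a < j))).Nodup := hn.filter _
  have hlt3 : ∀ a ∈ w.filter (fun a => decide (a < j)), a < n := fun a ha => hlt a (List.mem_of_mem_filter ha)
  rw [gr_filter w j hm, grk_KEq h3 hn3 hlt3, rd_filter, grk_tab (IsTab_filter j h1) _ _ hm]
  · rw [List.map_map]; rfl
  · rw [← rd_filter]; exact h3.perm.nodup_iff.mp hn3
  · rw [← rd_filter]; exact fun a ha => hlt3 a (h3.perm.mem_iff.mpr ha)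
end TabRank


section LemA

def wd {n : ℕ} (σ : Equiv.Perm (Fin n)) : List ℕ := List.ofFn fun i => (σ i : ℕ)

theorem Ptab_eq {n : ℕ} (σ : Equiv.Perm (Fin n)) : Ptab σ = ptab (wd σ) := rfl

theorem wd_nodup {n : ℕ} (σ : Equiv.Perm (Fin n)) : (wd σ).Nodup := by
  rw [wd, List.nodup_ofFn]
  intro a b h
  exact σ.injective (Fin.ext h)

theorem wd_lt {n : ℕ} (σ : Equiv.Perm (Fin n)) : ∀ a ∈ wd σ, a < n := by
  intro a ha
  simp only [wd, List.mem_ofFn] at ha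
  obtain ⟨i, rfl⟩ := ha
  exact (σ i).2

theorem wd_mem {n : ℕ} (σ : Equiv.Perm (Fin n)) (a : ℕ) : a ∈ wd σ ↔ a < n := by
  refine ⟨wd_lt σ a, fun h => ?_⟩
  simp only [wd, List.mem_ofFn]
  exact ⟨σ.symm ⟨a, h⟩, by simp⟩

theorem wd_get {n : ℕ} (σ : Equiv.Perm (Fin n)) (i : ℕ) (a : Fin n) : 
    (wd σ)[i]? = some a.val ↔ i = (σ.symm a).val := by
  simp only [wd, List.getElem?_eq_some_iff, List.length_ofFn, List.getElem_ofFn]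
  constructor
  · rintro ⟨h, h2⟩
    rw [← Fin.ext h2]; simp
  · rintro rfl
    exact ⟨(σ.symm a).2, by simp⟩

theorem Inc_wd {n : ℕ} (σ : Equiv.Perm (Fin n)) (a b : Fin n) : 
    Inc n (wd σ) a b ↔ a < b ∧ σ.symm a < σ.symm b := by
  rw [Inc, Bef_iff]
  simp only [wd_get]
  constructor
  · rintro ⟨h, i, j, hij, rfl, rfl⟩; exact ⟨h, hij⟩
  · rintro ⟨h, h2⟩; exact ⟨h, _, _, h2, rfl, rfl⟩

theorem sum_le_sub (l : List ℕ) (m : ℕ) : l.sum ≤ (l.map (· - m)).sum + l.length * m := by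
  induction l with
  | nil => simp
  | cons a l ih => simp only [List.sum_cons, List.map_cons, List.length_cons, add_mul]; omega

theorem sum_eq_sub (l : List ℕ) (m : ℕ) (h : ∀ a ∈ l, m ≤ a) : (l.map (· - m)).sum + l.length * m = l.sum := by
  induction l with
  | nil => simp
  | cons a l ih => 
    have := ih (fun a ha => h a (by simp [ha]))
    have := h a (by simp)
    simp only [List.sum_cons, List.map_cons, List.length_cons, add_mul]; omega

theorem sum_eq_zero_sub (l : List ℕ) (m : ℕ) (h : ∀ a ∈ l, a ≤ m) : (l.map (· - m)).sum = 0 := by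
  induction l with
  | nil => simp
  | cons a l ih => 
    have := ih (fun a ha => h a (by simp [ha]))
    have := h a (by simp)
    simp only [List.sum_cons, List.map_cons]; omega

theorem dom_of_sub {a b : List ℕ} (hb : b.Pairwise (· ≥ ·)) 
    (hab : ∀ m, (a.map (· - m)).sum ≤ (b.map (· - m)).sum) : domList a b := by
  intro i
  by_cases hi : b.length ≤ i
  · rw [List.take_of_length_le hi]
    have h0 := hab 0
    simp only [tsub_zero, List.map_id'] at h0
    have := List.sum_take_add_sum_drop a i
    omega
  · push Not at hi
    set m := b[i] with hm
    have hs : b = b.take i ++ b.drop i := (List.take_append_drop i b).symm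
    have h1 := sum_le_sub (a.take i) m
    have h2 : ((a.take i).map (· - m)).sum ≤ (a.map (· - m)).sum := by
      conv_rhs => rw [← List.take_append_drop i a, List.map_append, List.sum_append]
      omega
    have h3 := hab m
    have h4 : (b.map (· - m)).sum = ((b.take i).map (· - m)).sum := by
      conv_lhs => rw [hs, List.map_append, List.sum_append]
      rw [sum_eq_zero_sub (b.drop i) m, add_zero]
      intro c hc
      obtain ⟨k, hk, rfl⟩ := List.getElem_of_mem hc
      rw [List.getElem_drop]
      rcases Nat.eq_zero_or_pos k with rfl | hk0
      · simp [hm]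
      · exact List.pairwise_iff_getElem.mp hb i (i+k) _ _ (by omega)
    have h5 := sum_eq_sub (b.take i) m (by
      intro c hc
      obtain ⟨k, hk, rfl⟩ := List.getElem_of_mem hc
      rw [List.getElem_take]
      have : k < i := by simp at hk; omega
      exact List.pairwise_iff_getElem.mp hb k i _ _ this)
    have h6 : (a.take i).length * m ≤ (b.take i).length * m := by
      apply Nat.mul_le_mul_right
      simp; omega
    omega

theorem eq_of_sub {a b : List ℕ} (ha : a.Pairwise (· ≥ ·)) (hb : b.Pairwise (· ≥ ·)) (hlen : a.length = b.length)
    (hab : ∀ m, (a.map (· - m)).sum = (b.map (· - m)).sum) : a = b := by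
  have h1 := dom_of_sub hb (fun m => (hab m).le)
  have h2 := dom_of_sub ha (fun m => (hab m).ge)
  apply List.ext_getElem hlen
  intro i hi hi'
  have e1 := List.sum_take_succ a i hi
  have e2 := List.sum_take_succ b i hi'
  have := h1 i; have := h2 i; have := h1 (i+1); have := h2 (i+1)
  omega

theorem row_eq {r s : List ℕ} (hr : r.Pairwise (· < ·)) (hs : s.Pairwise (· < ·)) 
    (h : ∀ j, (r.filter (fun a => decide (a < j))).length = (s.filter (fun a => decide (a < j))).length) : r = s := by
  have key : ∀ (l : List ℕ) (j : ℕ), (l.filter (fun a => decide (a < j+1))).length = 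
      (l.filter (fun a => decide (a < j))).length + l.count j := by
    intro l j
    simp only [Nat.lt_succ_iff]
    induction l with
    | nil => simp
    | cons a l ih =>
      rw [List.filter_cons, List.filter_cons, List.count_cons]
      rcases lt_trichotomy a j with h | h | h
      · simp [h, h.le, h.ne]; omega
      · simp [h]; omega
      · have h1 : ¬ a < j := by omega
        have h2 : ¬ a ≤ j := by omega
        simp [h1, h2, h.ne']; omega
  have hp : r.Perm s := by
    rw [List.perm_iff_count]
    intro a
    have := key r a; have := key s a; have := h a; have := h (a+1)
    omega
  exact hp.eq_of_pairwise (le := (· < ·)) (fun a b _ _ h1 h2 => absurd h1 (not_lt.mpr h2.le)) hr hs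

theorem cnt_pairwise {T : List (List ℕ)} (hT : IsTab T) (j : ℕ) : 
    (T.map (fun r => (r.filter (fun a => decide (a < j))).length)).Pairwise (· ≥ ·) := by
  have := (IsTab_filter j hT).2
  rw [List.pairwise_map] at this ⊢
  exact this.imp (fun h => h.length)

theorem shape_pairwise {T : List (List ℕ)} (hT : IsTab T) : (shapeOf T).Pairwise (· ≥ ·) := by
  rw [shapeOf, List.pairwise_map]
  exact hT.2.imp (fun h => h.length)

theorem rd_length (T : List (List ℕ)) : (rd T).length = (shapeOf T).sum := by
  rw [(rd_perm T).length_eq, List.length_flatten]; rfl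

theorem tab_eq {T T' : List (List ℕ)} (hT : IsTab T) (hT' : IsTab T') (hlen : T.length = T'.length)
    (h : ∀ m j, (T.map (fun r => (r.filter (fun a => decide (a < j))).length - m)).sum = 
      (T'.map (fun r => (r.filter (fun a => decide (a < j))).length - m)).sum) : T = T' := by
  have h1 : ∀ j, T.map (fun r => (r.filter (fun a => decide (a < j))).length) = 
      T'.map (fun r => (r.filter (fun a => decide (a < j))).length) := by
    intro j
    apply eq_of_sub (cnt_pairwise hT j) (cnt_pairwise hT' j) (by simpa using hlen)
    intro m
    have := h m j
    rw [List.map_map, List.map_map]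
    exact this
  apply List.ext_getElem hlen
  intro i hi hi'
  apply row_eq (hT.1 _ (List.getElem_mem _)) (hT'.1 _ (List.getElem_mem _))
  intro j
  have := congrArg (fun l => l[i]?) (h1 j)
  simpa [hi, hi'] using this

theorem cnt_zero {n : ℕ} (σ σ' : Equiv.Perm (Fin n)) (j : ℕ) : 
    ((ptab (wd σ)).map (fun r => (r.filter (fun a => decide (a < j))).length - 0)).sum = 
      ((ptab (wd σ')).map (fun r => (r.filter (fun a => decide (a < j))).length - 0)).sum := by
  have key : ∀ σ : Equiv.Perm (Fin n), ((ptab (wd σ)).map (fun r => (r.filter (fun a => decide (a < j))).length - 0)).sum = 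
      ((wd σ).filter (fun a => decide (a < j))).length := by
    intro σ
    rw [((ptab_spec _ (wd_nodup σ)).2.perm.filter _).length_eq, rd_filter, rd_length, shapeOf, List.map_map]
    rfl
  rw [key, key]
  apply List.Perm.length_eq
  apply List.Perm.filter
  rw [List.perm_ext_iff_of_nodup (wd_nodup _) (wd_nodup _)]
  intro a; rw [wd_mem, wd_mem]

theorem lemA {n : ℕ} (σ σ' : Equiv.Perm (Fin n)) (hsub : ∀ a b, Inc n (wd σ') a b → Inc n (wd σ) a b) :
    domList (shapeOf (Ptab σ')) (shapeOf (Ptab σ)) ∧ (shapeOf (Ptab σ') = shapeOf (Ptab σ) → Ptab σ' = Ptab σ) := by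
  have hT := ptab_spec _ (wd_nodup σ)
  have hT' := ptab_spec _ (wd_nodup σ')
  have hg : ∀ (σ : Equiv.Perm (Fin n)) m, 1 ≤ m → grk n m (wd σ) = ((shapeOf (Ptab σ)).map (· - m)).sum := by
    intro σ m hm
    have h := ptab_spec _ (wd_nodup σ)
    rw [grk_KEq h.2 (wd_nodup σ) (wd_lt σ), grk_tab h.1 (h.2.perm.nodup_iff.mp (wd_nodup σ)) 
      (fun a ha => wd_lt σ a (h.2.perm.mem_iff.mpr ha)) hm, shapeOf, List.map_map]
    rfl
  have hlen : (shapeOf (Ptab σ)).sum = (shapeOf (Ptab σ')).sum := by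
    rw [Ptab_eq, Ptab_eq, ← rd_length, ← rd_length, ← hT.2.perm.length_eq, ← hT'.2.perm.length_eq]
    simp [wd]
  constructor
  · apply dom_of_sub (shape_pairwise hT.1)
    intro m
    rw [← Ptab_eq]
    rcases Nat.eq_zero_or_pos m with rfl | hm
    · simp [hlen]
    · rw [← hg σ m hm, ← hg σ' m hm]
      exact grk_mono hsub
  · intro hsh
    have hr : ∀ m, (GK (Inc n (wd σ)) ^ m).rank = (GK (Inc n (wd σ')) ^ m).rank := by
      intro m
      rcases Nat.eq_zero_or_pos m with rfl | hm
      · simp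
      · have h1 := hg σ m hm
        have h2 := hg σ' m hm
        rw [hsh, ← h1] at h2
        exact h2.symm
    have hc := core (K := Kg n) (Inc n (wd σ)) (Inc n (wd σ')) σ' (fun a b h => h.1) (Inc_wd σ') hsub hr
    apply tab_eq hT'.1 hT.1
    · have := congrArg List.length hsh
      simpa [shapeOf, Ptab_eq] using this
    · intro m j
      rcases Nat.eq_zero_or_pos m with rfl | hm
      · exact cnt_zero σ' σ j
      · rw [← gr_tab _ (wd_nodup σ) (wd_lt σ) j hm, ← gr_tab _ (wd_nodup σ') (wd_lt σ') j hm]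
        exact (hc m j).symm

theorem swap_inc {n : ℕ} (σ : Equiv.Perm (Fin n)) (p : ℕ) (h : p + 1 < n) 
    (hlt : σ ⟨p, Nat.lt_of_succ_lt h⟩ < σ ⟨p+1, h⟩) (a b : Fin n) 
    (hab : Inc n (wd (σ * Equiv.swap ⟨p, Nat.lt_of_succ_lt h⟩ ⟨p+1, h⟩)) a b) : Inc n (wd σ) a b := by
  rw [Inc_wd] at *
  refine ⟨hab.1, ?_⟩
  obtain ⟨h1, h2⟩ := hab
  have e : ∀ c, (σ * Equiv.swap (⟨p, Nat.lt_of_succ_lt h⟩ : Fin n) ⟨p+1, h⟩).symm c = 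
    Equiv.swap (⟨p, Nat.lt_of_succ_lt h⟩ : Fin n) ⟨p+1, h⟩ (σ.symm c) := by
    intro c
    rw [Equiv.symm_apply_eq]; simp
  rw [e, e] at h2
  obtain ⟨i, rfl⟩ := σ.surjective a
  obtain ⟨j, rfl⟩ := σ.surjective b
  simp only [Equiv.symm_apply_apply] at *
  by_contra hc
  rw [Equiv.swap_apply_def, Equiv.swap_apply_def] at h2
  have hij : i ≠ j := by rintro rfl; exact lt_irrefl _ h1
  have hij' : (i:ℕ) ≠ j := fun h => hij (Fin.ext h)
  rw [not_lt, Fin.le_def] at hc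
  have : i = ⟨p+1, h⟩ ∧ j = ⟨p, Nat.lt_of_succ_lt h⟩ := by
    simp only [Fin.ext_iff, Fin.lt_def] at h2 ⊢
    clear hlt h1
    split_ifs at h2 <;> (try dsimp only at h2) <;> omega
  rw [this.1, this.2] at h1
  exact absurd h1 (not_lt.mpr hlt.le)

theorem part1 {n : ℕ} (γ : Equiv.Perm (Fin n)) (a : ℕ) (h : a + 1 < n) (hd : a ∉ DesL0 γ) :
    domList (shapeOf (Qtab (Equiv.swap (⟨a, Nat.lt_of_succ_lt h⟩ : Fin n) ⟨a + 1, h⟩ * γ))) (shapeOf (Qtab γ)) ∧ 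
    (shapeOf (Qtab (Equiv.swap (⟨a, Nat.lt_of_succ_lt h⟩ : Fin n) ⟨a + 1, h⟩ * γ)) = shapeOf (Qtab γ) → 
      Qtab (Equiv.swap (⟨a, Nat.lt_of_succ_lt h⟩ : Fin n) ⟨a + 1, h⟩ * γ) = Qtab γ) := by
  have hlt : γ⁻¹ ⟨a, Nat.lt_of_succ_lt h⟩ < γ⁻¹ ⟨a+1, h⟩ := by
    by_contra hc
    refine hd ⟨h, lt_of_le_of_ne (not_lt.mp hc) ?_⟩
    intro he
    have := γ⁻¹.injective he
    simp at this
  unfold Qtab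
  rw [_root_.mul_inv_rev, Equiv.swap_inv]
  exact lemA _ _ (swap_inc γ⁻¹ a h hlt)
end LemA


section Closure
variable {n : ℕ} {r : Fin n → Fin n → Prop} {s : SkewShape} {τ : ℕ × ℕ → Fin n}

theorem cells_convex {i j i1 j1 i2 j2 : ℕ} (h1 : (i1, j1) ∈ s.cells) (h2 : (i2, j2) ∈ s.cells) 
    (a : i1 ≤ i) (b : j1 ≤ j) (c : i ≤ i2) (d : j ≤ j2) : (i, j) ∈ s.cells := by
  unfold SkewShape.cells at *
  rw [Finset.mem_sdiff] at *
  refine ⟨?_, fun h => h1.2 ?_⟩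
  · exact s.outer.up_left_mem c d h2.1
  · exact s.inner.up_left_mem a b h

theorem col_mono (hs : IsSchurLabeling s n τ) {i i' j : ℕ} (h1 : (i, j) ∈ s.cells) (h2 : (i', j) ∈ s.cells) 
    (h : i ≤ i') : τ (i, j) ≤ τ (i', j) := by
  induction i', h using Nat.le_induction with
  | base => exact le_rfl
  | succ k hk ih =>
    have hm : (k, j) ∈ s.cells := cells_convex h1 h2 hk le_rfl (by omega) le_rfl
    exact (ih hm).trans (hs.2.2 k j hm h2).le

theorem row_anti (hs : IsSchurLabeling s n τ) {i j j' : ℕ} (h1 : (i, j) ∈ s.cells) (h2 : (i, j') ∈ s.cells) 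
    (h : j ≤ j') : τ (i, j') ≤ τ (i, j) := by
  induction j', h using Nat.le_induction with
  | base => exact le_rfl
  | succ k hk ih =>
    have hm : (i, k) ∈ s.cells := cells_convex h1 h2 le_rfl hk le_rfl (by omega)
    exact (hs.2.1 i k hm h2).le.trans (ih hm)

/-- position function compatible with the poset -/
def PosOK (r : Fin n → Fin n → Prop) (f : Fin n → ℕ) : Prop := Function.Injective f ∧ ∀ a b, r a b → f a ≤ f b

theorem pos_le (hrel : ∀ x y, r x y ↔ posetRel s τ x y) {f : Fin n → ℕ} (hf : PosOK r f) {i j i' j' : ℕ} 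
    (h1 : (i, j) ∈ s.cells) (h2 : (i', j') ∈ s.cells) (a : i ≤ i') (b : j ≤ j') : f (τ (i, j)) ≤ f (τ (i', j')) :=
  hf.2 _ _ ((hrel _ _).mpr ⟨_, h1, _, h2, rfl, rfl, a, b⟩)

theorem tau_inj (hs : IsSchurLabeling s n τ) {f : Fin n → ℕ} (hf : PosOK r f) {i j i' j' : ℕ} 
    (h1 : (i, j) ∈ s.cells) (h2 : (i', j') ∈ s.cells) (h : f (τ (i, j)) = f (τ (i', j'))) : i = i' ∧ j = j' := by
  have := hs.1.injOn h1 h2 (hf.1 h)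
  simpa using this

theorem cover (hs : IsSchurLabeling s n τ) (hrel : ∀ x y, r x y ↔ posetRel s τ x y) {f : Fin n → ℕ} 
    (hf : PosOK r f) {c d : Fin n} (hcd : r c d) (hp : f d = f c + 1) : 
    (c < d ∧ ∃ i j, (i, j) ∈ s.cells ∧ (i+1, j) ∈ s.cells ∧ τ (i, j) = c ∧ τ (i+1, j) = d) ∨ 
    (d < c ∧ ∃ i j, (i, j) ∈ s.cells ∧ (i, j+1) ∈ s.cells ∧ τ (i, j) = c ∧ τ (i, j+1) = d) := by
  obtain ⟨⟨i, j⟩, h1, ⟨i', j'⟩, h2, rfl, rfl, a, b⟩ := (hrel _ _).mp hcd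
  simp only at a b
  by_cases hi : i < i'
  · left
    have hm : (i+1, j) ∈ s.cells := cells_convex h1 h2 (by omega) le_rfl (by omega) b
    have e1 := pos_le hrel hf h1 hm (by omega) le_rfl
    have e2 := pos_le hrel hf hm h2 (by omega) b
    have e3 : f (τ (i, j)) ≠ f (τ (i+1, j)) := fun h => by have := tau_inj hs hf h1 hm h; omega
    have e4 : f (τ (i+1, j)) = f (τ (i', j')) := by omega
    obtain ⟨rfl, rfl⟩ := tau_inj hs hf hm h2 e4
    exact ⟨hs.2.2 _ _ h1 h2, i, j, h1, h2, rfl, rfl⟩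
  · right
    obtain rfl : i = i' := by omega
    have hj : j ≠ j' := by rintro rfl; omega
    have hm : (i, j+1) ∈ s.cells := cells_convex h1 h2 le_rfl (by omega) le_rfl (by omega)
    have e1 := pos_le hrel hf h1 hm le_rfl (by omega)
    have e2 := pos_le hrel hf hm h2 le_rfl (by omega)
    have e3 : f (τ (i, j)) ≠ f (τ (i, j+1)) := fun h => by have := tau_inj hs hf h1 hm h; omega
    have e4 : f (τ (i, j+1)) = f (τ (i, j')) := by omega
    obtain ⟨_, rfl⟩ := tau_inj hs hf hm h2 e4
    exact ⟨hs.2.1 _ _ h1 h2, i, j, h1, h2, rfl, rfl⟩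


theorem cl1 (hreg : RegularRel r) (hs : IsSchurLabeling s n τ) (hrel : ∀ x y, r x y ↔ posetRel s τ x y)
    {f : Fin n → ℕ} (hf : PosOK r f) {x y z : Fin n} (hxy : x < y) (hyz : y < z) 
    (h1 : f x = f y + 1) (h2 : f z = f x + 1) : ¬ r x z := by
  intro h
  have hyz' : r y z := (hreg x y z h (Or.inl ⟨hxy, hyz⟩)).resolve_left (fun h => by have := hf.2 _ _ h; omega)
  rcases cover hs hrel hf h h2 with ⟨_, i, j, c1, c2, rfl, rfl⟩ | ⟨h3, _⟩
  · obtain ⟨⟨k, l⟩, c3, ⟨i', j'⟩, c4, rfl, e, a, b⟩ := (hrel _ _).mp hyz'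
    have := hs.1.injOn c4 c2 e
    simp only [Prod.mk.injEq] at this a b
    obtain ⟨rfl, rfl⟩ := this
    by_cases hl : l < j'
    · have hm : (i+1, j'-1) ∈ s.cells := cells_convex c3 c2 a (by omega) le_rfl (by omega)
      have e1 := pos_le hrel hf c3 hm a (by omega)
      have e2 := pos_le hrel hf hm c2 le_rfl (by omega)
      have e3 : f (τ (i+1, j'-1)) ≠ f (τ (i+1,j')) := fun h => by have := tau_inj hs hf hm c2 h; omega
      have e4 : f (τ (i+1, j'-1)) ≠ f (τ (i,j')) := fun h => by have := tau_inj hs hf hm c1 h; omega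
      have e5 : f (τ (k, l)) = f (τ (i+1, j'-1)) := by omega
      obtain ⟨rfl, rfl⟩ := tau_inj hs hf c3 hm e5
      have h4 := row_anti hs hm c2 (by omega)
      exact absurd hyz (not_lt.mpr h4)
    · obtain rfl : l = j' := by omega
      have : k ≠ i + 1 := by rintro rfl; exact lt_irrefl _ hyz
      exact absurd hxy (not_lt.mpr (col_mono hs c3 c1 (by omega)))
  · exact absurd (hxy.trans hyz) (not_lt.mpr h3.le)

theorem cl2 (hreg : RegularRel r) (hs : IsSchurLabeling s n τ) (hrel : ∀ x y, r x y ↔ posetRel s τ x y)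
    {f : Fin n → ℕ} (hf : PosOK r f) {x y z : Fin n} (hxy : x < y) (hyz : y < z) 
    (h1 : f z = f y + 1) (h2 : f x = f z + 1) : ¬ r z x := by
  intro h
  have hyz' : r y x := (hreg z y x h (Or.inr ⟨hxy, hyz⟩)).resolve_left (fun h => by have := hf.2 _ _ h; omega)
  rcases cover hs hrel hf h h2 with ⟨h3, _⟩ | ⟨_, i, j, c1, c2, rfl, rfl⟩
  · exact absurd (hxy.trans hyz) (not_lt.mpr h3.le)
  · obtain ⟨⟨k, l⟩, c3, ⟨i', j'⟩, c4, rfl, e, a, b⟩ := (hrel _ _).mp hyz'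
    have := hs.1.injOn c4 c2 e
    simp only [Prod.mk.injEq] at this a b
    obtain ⟨rfl, rfl⟩ := this
    by_cases hl : k < i'
    · have hm : (i'-1, j+1) ∈ s.cells := cells_convex c3 c2 (by omega) b (by omega) le_rfl
      have e1 := pos_le hrel hf c3 hm (by omega) b
      have e2 := pos_le hrel hf hm c2 (by omega) le_rfl
      have e3 : f (τ (i'-1, j+1)) ≠ f (τ (i',j+1)) := fun h => by have := tau_inj hs hf hm c2 h; omega
      have e4 : f (τ (i'-1, j+1)) ≠ f (τ (i',j)) := fun h => by have := tau_inj hs hf hm c1 h; omega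
      have e5 : f (τ (k, l)) = f (τ (i'-1, j+1)) := by omega
      obtain ⟨rfl, rfl⟩ := tau_inj hs hf c3 hm e5
      have h4 := col_mono hs hm c2 (by omega)
      exact absurd hxy (not_lt.mpr h4)
    · obtain rfl : k = i' := by omega
      have : l ≠ j + 1 := by rintro rfl; exact lt_irrefl _ hxy
      exact absurd hyz (not_lt.mpr (row_anti hs c3 c1 (by omega)))

theorem cl3 (hreg : RegularRel r) (hs : IsSchurLabeling s n τ) (hrel : ∀ x y, r x y ↔ posetRel s τ x y)
    {f : Fin n → ℕ} (hf : PosOK r f) {x y z : Fin n} (hxy : x < y) (hyz : y < z) 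
    (h1 : f z = f x + 1) (h2 : f y = f z + 1) : ¬ r x z := by
  intro h
  have hyz' : r x y := (hreg x y z h (Or.inl ⟨hxy, hyz⟩)).resolve_right (fun h => by have := hf.2 _ _ h; omega)
  rcases cover hs hrel hf h h1 with ⟨_, i, j, c1, c2, rfl, rfl⟩ | ⟨h3, _⟩
  · obtain ⟨⟨i', j'⟩, c4, ⟨k, l⟩, c3, e, rfl, a, b⟩ := (hrel _ _).mp hyz'
    have := hs.1.injOn c4 c1 e
    simp only [Prod.mk.injEq] at this a b
    obtain ⟨rfl, rfl⟩ := this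
    by_cases hl : j' < l
    · have hm : (i', j'+1) ∈ s.cells := cells_convex c1 c3 le_rfl (by omega) a (by omega)
      have e1 := pos_le hrel hf hm c3 a (by omega)
      have e2 := pos_le hrel hf c1 hm le_rfl (by omega)
      have e3 : f (τ (i', j'+1)) ≠ f (τ (i'+1,j')) := fun h => by have := tau_inj hs hf hm c2 h; omega
      have e4 : f (τ (i', j'+1)) ≠ f (τ (i',j')) := fun h => by have := tau_inj hs hf hm c1 h; omega
      have e5 : f (τ (k, l)) = f (τ (i', j'+1)) := by omega
      obtain ⟨rfl, rfl⟩ := tau_inj hs hf c3 hm e5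
      have h4 := row_anti hs c1 hm (by omega)
      exact absurd hxy (not_lt.mpr h4)
    · obtain rfl : l = j' := by omega
      have : k ≠ i' := by rintro rfl; exact lt_irrefl _ hxy
      exact absurd hyz (not_lt.mpr (col_mono hs c2 c3 (by omega)))
  · exact absurd (hxy.trans hyz) (not_lt.mpr h3.le)

theorem cl4 (hreg : RegularRel r) (hs : IsSchurLabeling s n τ) (hrel : ∀ x y, r x y ↔ posetRel s τ x y)
    {f : Fin n → ℕ} (hf : PosOK r f) {x y z : Fin n} (hxy : x < y) (hyz : y < z) 
    (h1 : f x = f z + 1) (h2 : f y = f x + 1) : ¬ r z x := by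
  intro h
  have hyz' : r z y := (hreg z y x h (Or.inr ⟨hxy, hyz⟩)).resolve_right (fun h => by have := hf.2 _ _ h; omega)
  rcases cover hs hrel hf h h1 with ⟨h3, _⟩ | ⟨_, i, j, c1, c2, rfl, rfl⟩
  · exact absurd (hxy.trans hyz) (not_lt.mpr h3.le)
  · obtain ⟨⟨i', j'⟩, c4, ⟨k, l⟩, c3, e, rfl, a, b⟩ := (hrel _ _).mp hyz'
    have := hs.1.injOn c4 c1 e
    simp only [Prod.mk.injEq] at this a b
    obtain ⟨rfl, rfl⟩ := this
    by_cases hl : i' < k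
    · have hm : (i'+1, j') ∈ s.cells := cells_convex c1 c3 (by omega) le_rfl (by omega) b
      have e1 := pos_le hrel hf hm c3 (by omega) b
      have e2 := pos_le hrel hf c1 hm (by omega) le_rfl
      have e3 : f (τ (i'+1, j')) ≠ f (τ (i',j'+1)) := fun h => by have := tau_inj hs hf hm c2 h; omega
      have e4 : f (τ (i'+1, j')) ≠ f (τ (i',j')) := fun h => by have := tau_inj hs hf hm c1 h; omega
      have e5 : f (τ (k, l)) = f (τ (i'+1, j')) := by omega
      obtain ⟨rfl, rfl⟩ := tau_inj hs hf c3 hm e5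
      have h4 := col_mono hs c1 hm (by omega)
      exact absurd hyz (not_lt.mpr h4)
    · obtain rfl : k = i' := by omega
      have : l ≠ j' := by rintro rfl; exact lt_irrefl _ hyz
      exact absurd hxy (not_lt.mpr (row_anti hs c2 c3 (by omega)))

theorem idx_cons' (a e : ℕ) (l : List ℕ) : (a :: l).idxOf e = if e = a then 0 else l.idxOf e + 1 := by
  by_cases h : e = a
  · simp [h]
  · rw [List.idxOf_cons_ne _ (Ne.symm h), if_neg h]

theorem idx_swap (u v : List ℕ) {c d : ℕ} (hcd : c ≠ d) (hc : c ∉ u) (hd : d ∉ u) (e : ℕ) : 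
    ((u ++ d :: c :: v).idxOf e = if e = c then u.length + 1 else if e = d then u.length else 
      (u ++ c :: d :: v).idxOf e) ∧ (u ++ c :: d :: v).idxOf c = u.length ∧ (u ++ c :: d :: v).idxOf d = u.length + 1 := by
  simp only [List.idxOf_append, idx_cons', hc, hd]
  refine ⟨?_, by simp, by simp [hcd.symm]; omega⟩
  by_cases h1 : e = c
  · subst h1; simp [hc, hcd]; omega
  · by_cases h2 : e = d
    · subst h2; simp [hd, h1]
    · simp [h1, h2]

theorem LE_swap (u v : List ℕ) {c d : Fin n} (hn : (u ++ c.val :: d.val :: v).Nodup) 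
    (hr : ¬ r c d) (h : ∀ a b : Fin n, r a b → (u ++ c.val :: d.val :: v).idxOf a.val ≤ (u ++ c.val :: d.val :: v).idxOf b.val) :
    ∀ a b : Fin n, r a b → (u ++ d.val :: c.val :: v).idxOf a.val ≤ (u ++ d.val :: c.val :: v).idxOf b.val := by
  intro a b hab
  have hcd : c.val ≠ d.val := by
    intro h; simp [h, List.nodup_append] at hn
  have hc : c.val ∉ u := by
    intro h; exact (List.nodup_append.mp hn).2.2 _ h c.val (by simp) rfl
  have hd : d.val ∉ u := by
    intro h; exact (List.nodup_append.mp hn).2.2 _ h d.val (by simp) rfl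
  have := h a b hab
  obtain ⟨ea, e1, e2⟩ := idx_swap u v hcd hc hd a.val
  obtain ⟨eb, -, -⟩ := idx_swap u v hcd hc hd b.val
  rw [ea, eb]
  have na : ∀ x : ℕ, (u ++ c.val :: d.val :: v).idxOf x = u.length → x = c.val := by
    intro x hx
    rw [← e1] at hx
    exact ((List.idxOf_inj (by simp)).mp hx.symm).symm
  have nb : ∀ x : ℕ, (u ++ c.val :: d.val :: v).idxOf x = u.length + 1 → x = d.val := by
    intro x hx
    rw [← e2] at hx
    exact ((List.idxOf_inj (by simp)).mp hx.symm).symm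
  have ha1 := na a.val; have ha2 := nb a.val; have hb1 := na b.val; have hb2 := nb b.val
  by_cases h1 : a.val = c.val
  · obtain rfl := Fin.ext h1
    by_cases h2 : b.val = d.val
    · obtain rfl := Fin.ext h2; exact absurd hab hr
    · simp only [if_true, h2, if_false]
      split_ifs with h3
      · exact le_rfl
      · omega
  · simp only [h1, if_false]
    by_cases h2 : b.val = c.val
    · rw [h2] at this hb2
      simp only [h2, if_true]
      split_ifs with h3
      · omega
      · omega
    · simp only [h2, if_false]
      split_ifs with h3 h4 h4
      · exact le_rfl
      · rw [h3, e2] at this; omega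
      · rw [h4, e2] at this
        omega
      · exact this

def LEw (r : Fin n → Fin n → Prop) (w : List ℕ) : Prop := ∀ a b : Fin n, r a b → w.idxOf a.val ≤ w.idxOf b.val

theorem LEw.pos {w : List ℕ} (h : LEw r w) (hw : ∀ a : Fin n, a.val ∈ w) : PosOK r (fun a => w.idxOf a.val) :=
  ⟨fun a _ h => Fin.ext ((List.idxOf_inj (hw a)).mp h), h⟩

theorem idx3 (u v : List ℕ) (a b c : ℕ) (hn : (u ++ a :: b :: c :: v).Nodup) : 
    (u ++ a :: b :: c :: v).idxOf a = u.length ∧ (u ++ a :: b :: c :: v).idxOf b = u.length + 1 ∧ 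
    (u ++ a :: b :: c :: v).idxOf c = u.length + 2 := by
  have hd := (List.nodup_append.mp hn).2.2
  have ha : a ∉ u := fun h => hd _ h a (by simp) rfl
  have hb : b ∉ u := fun h => hd _ h b (by simp) rfl
  have hc : c ∉ u := fun h => hd _ h c (by simp) rfl
  have h2 := (List.nodup_append.mp hn).2.1
  simp only [List.nodup_cons, List.mem_cons, not_or] at h2
  simp [List.idxOf_append, List.idxOf_cons, ha, hb, hc, h2.1.1, h2.1.2.1, h2.2.1.1]
  omega

theorem LEw_KStep (hreg : RegularRel r) (hs : IsSchurLabeling s n τ) (hrel : ∀ x y, r x y ↔ posetRel s τ x y)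
    {w w' : List ℕ} (h : KStep w w') (hn : w.Nodup) (hw : ∀ a : ℕ, a ∈ w ↔ a < n) : 
    LEw r w ↔ LEw r w' := by
  have hn' := h.perm.nodup_iff.mp hn
  have hw' : ∀ a : ℕ, a ∈ w' ↔ a < n := fun a => by rw [← h.perm.mem_iff, hw]
  cases h with
  | k1 u v x y z hxy hyz =>
    lift x to Fin n using (hw x).mp (by simp)
    lift y to Fin n using (hw y).mp (by simp)
    lift z to Fin n using (hw z).mp (by simp)
    have e : ∀ p q : ℕ, u ++ y.val :: p :: q :: v = (u ++ [y.val]) ++ p :: q :: v := by simp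
    have i1 := idx3 u v _ _ _ hn
    have i2 := idx3 u v _ _ _ hn'
    constructor
    · intro hL
      have hp := hL.pos (fun a => (hw a).mpr a.2)
      have hr := cl1 hreg hs hrel hp hxy hyz (by omega) (by omega)
      unfold LEw at hL ⊢
      rw [e] at hL ⊢ hn
      exact LE_swap _ _ hn hr hL
    · intro hL
      have hp := hL.pos (fun a => (hw' a).mpr a.2)
      have hr := cl2 hreg hs hrel hp hxy hyz (by omega) (by omega)
      unfold LEw at hL ⊢
      rw [e] at hL ⊢ hn'
      exact LE_swap _ _ hn' hr hL
  | k2 u v x y z hxy hyz =>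
    lift x to Fin n using (hw x).mp (by simp)
    lift y to Fin n using (hw y).mp (by simp)
    lift z to Fin n using (hw z).mp (by simp)
    have i1 := idx3 u v _ _ _ hn
    have i2 := idx3 u v _ _ _ hn'
    constructor
    · intro hL
      have hp := hL.pos (fun a => (hw a).mpr a.2)
      have hr := cl3 hreg hs hrel hp hxy hyz (by omega) (by omega)
      exact LE_swap _ _ hn hr hL
    · intro hL
      have hp := hL.pos (fun a => (hw' a).mpr a.2)
      have hr := cl4 hreg hs hrel hp hxy hyz (by omega) (by omega)
      exact LE_swap _ _ hn' hr hL

theorem LEw_KEq (hreg : RegularRel r) (hs : IsSchurLabeling s n τ) (hrel : ∀ x y, r x y ↔ posetRel s τ x y)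
    {w w' : List ℕ} (h : KEq w w') (hn : w.Nodup) (hw : ∀ a : ℕ, a ∈ w ↔ a < n) : 
    LEw r w ↔ LEw r w' := by
  induction h with
  | rel x y h => exact LEw_KStep hreg hs hrel h hn hw
  | refl x => exact Iff.rfl
  | symm x y h ih => 
    have hp : x.Perm y := KEq.perm h
    exact (ih (hp.nodup_iff.mpr hn) (fun a => by rw [hp.mem_iff, hw])).symm
  | trans x y z h1 h2 ih1 ih2 => 
    have hp : x.Perm y := KEq.perm h1
    exact (ih1 hn hw).trans (ih2 (hp.nodup_iff.mp hn) (fun a => by rw [← hp.mem_iff, hw]))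

theorem LEw_wd (γ : Equiv.Perm (Fin n)) : LEw r (wd γ⁻¹) ↔ ∀ i j, r i j → γ i ≤ γ j := by
  have : ∀ a : Fin n, (wd γ⁻¹).idxOf a.val = (γ a).val := by
    intro a
    have h1 : (wd γ⁻¹)[(γ a).val]? = some a.val := by rw [wd_get]; rfl
    obtain ⟨h, h2⟩ := List.getElem?_eq_some_iff.mp h1
    rw [← h2]
    exact (wd_nodup _).idxOf_getElem _ _
  simp only [LEw, this]
  rfl

theorem closure_Q (hreg : RegularRel r) (hs : IsSchurLabeling s n τ) (hrel : ∀ x y, r x y ↔ posetRel s τ x y)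
    (γ γ' : Equiv.Perm (Fin n)) (h : Qtab γ = Qtab γ') (hγ : ∀ i j, r i j → γ i ≤ γ j) : 
    ∀ i j, r i j → γ' i ≤ γ' j := by
  rw [← LEw_wd] at *
  have h1 := (ptab_spec _ (wd_nodup γ⁻¹)).2
  have h2 := (ptab_spec _ (wd_nodup γ'⁻¹)).2
  have e : ptab (wd γ⁻¹) = ptab (wd γ'⁻¹) := h
  rw [e] at h1
  exact (LEw_KEq hreg hs hrel (h1.trans' h2.symm') (wd_nodup _) (wd_mem _)).mp hγ
end Closure


section RevIns

/-- row index of the cell created by insertion -/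
def krow : List (List ℕ) → ℕ → ℕ
  | [], _ => 0
  | row :: rest, x =>
    match insRow x row with
    | (_, none) => 0
    | (_, some y) => krow rest y + 1

theorem krow_none {x : ℕ} {row row' : List ℕ} (rest : List (List ℕ)) (h : insRow x row = (row', none)) :
    krow (row :: rest) x = 0 := by
  simp [krow, h]

theorem krow_some {x y : ℕ} {row row' : List ℕ} (rest : List (List ℕ)) (h : insRow x row = (row', some y)) :
    krow (row :: rest) x = krow rest y + 1 := by
  simp [krow, h]

theorem insRow_app {x : ℕ} {row : List ℕ} (h : ∀ a ∈ row, a < x) : insRow x row = (row ++ [x], none) := by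
  induction row with
  | nil => simp [insRow]
  | cons c row ih =>
    have hc : c ≤ x := (h c (by simp)).le
    simp [insRow, hc, ih (fun a ha => h a (by simp [ha]))]

theorem insRow_bmp {x y : ℕ} {A B : List ℕ} (h : ∀ a ∈ A, a < x) (hxy : x < y) : 
    insRow x (A ++ y :: B) = (A ++ x :: B, some y) := by
  induction A with
  | nil => simp [insRow, hxy]
  | cons c row ih =>
    have hc : c ≤ x := (h c (by simp)).le
    have := ih (fun a ha => h a (by simp [ha]))
    simp [insRow, hc, this]

def shf (T : List (List ℕ)) (k : ℕ) : ℕ := (shapeOf T).getD k 0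

theorem shf_nil (k : ℕ) : shf [] k = 0 := by simp [shf, shapeOf]
theorem shf_zero (r : List ℕ) (T : List (List ℕ)) : shf (r :: T) 0 = r.length := by simp [shf, shapeOf]
theorem shf_succ (r : List ℕ) (T : List (List ℕ)) (k : ℕ) : shf (r :: T) (k+1) = shf T k := by simp [shf, shapeOf]

theorem shf_insTab (T : List (List ℕ)) (x : ℕ) (hn : (rd T ++ [x]).Nodup) (k : ℕ) : 
    shf (insTab T x) k = shf T k + if krow T x = k then 1 else 0 := by
  induction T generalizing x k with
  | nil => 
    cases k with
    | zero => simp [insTab, krow, shf, shapeOf]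
    | succ k => simp [insTab, krow, shf, shapeOf]
  | cons row rest ih =>
    have hx : x ∉ row := by
      intro h
      refine (List.nodup_append.mp hn).2.2 x ?_ x (by simp) rfl
      simp [rd, h]
    rcases insRow_spec x row hx with ⟨h, -⟩ | ⟨A, y, B, rfl, h, -, -⟩
    · rw [insTab_none _ h, krow_none _ h]
      cases k with
      | zero => simp [shf_zero]
      | succ k => simp [shf_succ]
    · rw [insTab_some _ h, krow_some _ h]
      have hn' : (rd rest ++ [y]).Nodup := by
        have h1 := (List.nodup_append.mp hn).1
        simp only [rd] at h1
        have h2 := h1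
        rw [List.nodup_append] at h2 ⊢
        refine ⟨h2.1, by simp, ?_⟩
        intro a ha b hb
        rw [List.mem_singleton] at hb; subst hb
        exact h2.2.2 a ha _ (by simp)
      cases k with
      | zero => simp [shf_zero]
      | succ k => simp [shf_succ, ih y hn']

theorem bump_rows (T : List (List ℕ)) (x x' : ℕ) (hs : ∀ r ∈ T, r.Pairwise (· < ·)) (hn : (rd T ++ [x, x']).Nodup) : 
    (x' < x → krow T x < krow (insTab T x) x') ∧ (x < x' → krow (insTab T x) x' ≤ krow T x) := by
  induction T generalizing x x' with
  | nil => 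
    constructor
    · intro h
      have h1 : insRow x' [x] = ([x'], some x) := by simpa using insRow_bmp (A := []) (B := []) (by simp) h
      simp only [insTab]
      rw [krow_some _ h1]; simp [krow]
    · intro h
      have h1 : insRow x' [x] = ([x, x'], none) := by simpa using insRow_app (row := [x]) (x := x') (by simpa using h)
      simp only [insTab]
      rw [krow_none _ h1]; simp
  | cons row rest ih =>
    have hnn := List.nodup_append.mp hn
    have hxx : x ≠ x' := by
      intro h; simp [h] at hnn
    have hmem : ∀ a ∈ row, a ∈ rd (row :: rest) := fun a ha => by simp [rd, ha]
    have hx : x ∉ row := fun h => hnn.2.2 x (hmem x h) x (by simp) rfl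
    have hx' : x' ∉ row := fun h => hnn.2.2 x' (hmem x' h) x' (by simp) rfl
    have hr := hs row (by simp)
    have hsr : ∀ r ∈ rest, r.Pairwise (· < ·) := fun r h => hs r (by simp [h])
    rcases insRow_spec x row hx with ⟨h, hall⟩ | ⟨A, y, B, rfl, h, hA, hxy⟩
    · rw [insTab_none _ h, krow_none _ h]
      rcases insRow_spec x' (row ++ [x]) (by simp [hx', hxx.symm]) with ⟨h', hall'⟩ | ⟨A', y', B', e, h', hA', hxy'⟩
      · rw [krow_none _ h']
        exact ⟨fun hl => absurd (hall' x (by simp)) (by omega), fun _ => le_rfl⟩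
      · rw [krow_some _ h']
        refine ⟨fun _ => by omega, fun hl => ?_⟩
        have : y' ∈ row ++ [x] := by rw [e]; simp
        rcases List.mem_append.mp this with h1 | h1
        · have := hall _ h1; omega
        · simp at h1; omega
    · rw [insTab_some _ h, krow_some _ h]
      have hsr' := List.pairwise_append.mp hr
      have hB : ∀ b ∈ B, y < b := (List.pairwise_cons.mp hsr'.2.1).1
      have hnr := List.nodup_append.mp hnn.1
      have hx'' : x' ∉ A ++ x :: B := by
        simp only [List.mem_append, List.mem_cons, not_or] at hx' ⊢
        exact ⟨hx'.1, hxx.symm, hx'.2.2⟩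
      rcases insRow_spec x' (A ++ x :: B) hx'' with ⟨h', hall'⟩ | ⟨A', y', B', e, h', hA', hxy'⟩
      · rw [krow_none _ h']
        exact ⟨fun hl => absurd (hall' x (by simp)) (by omega), fun _ => by omega⟩
      · rw [krow_some _ h']
        have hy' : y' ∈ A ++ x :: B := by rw [e]; simp
        have hsor : (A ++ x :: B).Pairwise (· < ·) := by
          rw [List.pairwise_append, List.pairwise_cons]
          refine ⟨hsr'.1, ⟨fun b hb => hxy.trans (hB b hb), (List.pairwise_cons.mp hsr'.2.1).2⟩, ?_⟩
          intro a ha b hb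
          rcases List.mem_cons.mp hb with rfl | hb
          · exact hA a ha
          · exact hsr'.2.2 a ha b (by simp [hb])
        have hnd : ∀ y', y' ∈ A ∨ y' = x ∨ y' ∈ B → y' ≠ y → (rd rest ++ [y, y']).Nodup := by
          intro y' hy' hne
          rw [List.nodup_append]
          refine ⟨hnr.1, by simpa using hne.symm, ?_⟩
          intro a ha b hb
          simp only [List.mem_cons, List.not_mem_nil, or_false] at hb
          rcases hb with rfl | rfl
          · exact hnr.2.2 a ha _ (by simp)
          · rcases hy' with h1 | h1 | h1
            · exact hnr.2.2 a ha _ (by simp [h1])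
            · rw [h1]
              refine hnn.2.2 a ?_ x (by simp)
              simp [rd, ha]
            · exact hnr.2.2 a ha _ (by simp [h1])
        have hyc : y' ∈ A ∨ y' = x ∨ y' ∈ B := by simpa using hy'
        constructor
        · intro hl
          have hle : y' ≤ x := by
            by_contra hc
            have hxm : x ∈ A' ++ y' :: B' := by rw [← e]; simp
            rw [e] at hsor
            have h3 := List.pairwise_append.mp hsor
            rcases List.mem_append.mp hxm with h1 | h1
            · have := hA' x h1; omega
            · rcases List.mem_cons.mp h1 with h1 | h1
              · omega
              · have := (List.pairwise_cons.mp h3.2.1).1 x h1; omega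
          have := (ih y y' hsr (hnd y' hyc (by omega))).1 (by omega)
          omega
        · intro hl
          have hlt : y < y' := by
            rcases hyc with h1 | h1 | h1
            · have := hA _ h1; omega
            · omega
            · exact hB _ h1
          have := (ih y y' hsr (hnd y' hyc (by omega))).2 hlt
          omega

theorem split_max_uniq {A A' B B' : List ℕ} {x x' y : ℕ} (e : A ++ x :: B = A' ++ x' :: B') 
    (hA : ∀ a ∈ A, a < y) (hx : x < y) (hB : ∀ b ∈ B, y < b) (hA' : ∀ a ∈ A', a < y) (hx' : x' < y) (hB' : ∀ b ∈ B', y < b) :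
    A = A' ∧ x = x' ∧ B = B' := by
  have h1 : (A ++ x :: B).filter (fun a => decide (a < y)) = A ++ [x] := by
    rw [List.filter_append, List.filter_cons, List.filter_eq_self.mpr (by simpa using hA), 
      List.filter_eq_nil_iff.mpr (by intro b hb; have := hB b hb; simp; omega)]
    simp [hx]
  have h2 : (A' ++ x' :: B').filter (fun a => decide (a < y)) = A' ++ [x'] := by
    rw [List.filter_append, List.filter_cons, List.filter_eq_self.mpr (by simpa using hA'), 
      List.filter_eq_nil_iff.mpr (by intro b hb; have := hB' b hb; simp; omega)]
    simp [hx']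
  rw [e, h2] at h1
  have h3 := List.append_inj' h1 rfl
  obtain ⟨rfl, h4⟩ := h3
  have h5 : x' = x := by simpa using h4
  subst h5
  refine ⟨rfl, rfl, ?_⟩
  simpa using e

theorem rev_uniq (T1 T2 : List (List ℕ)) (x1 x2 : ℕ) (hs1 : ∀ r ∈ T1, r.Pairwise (· < ·)) (hs2 : ∀ r ∈ T2, r.Pairwise (· < ·))
    (hn1 : (rd T1 ++ [x1]).Nodup) (hn2 : (rd T2 ++ [x2]).Nodup) (he1 : ∀ r ∈ T1, r ≠ []) (he2 : ∀ r ∈ T2, r ≠ [])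
    (hT : insTab T1 x1 = insTab T2 x2) (hk : krow T1 x1 = krow T2 x2) : T1 = T2 ∧ x1 = x2 := by
  have hxr : ∀ {row rest x}, (rd (row :: rest) ++ [x]).Nodup → x ∉ row := by
    intro row rest x hn h
    refine (List.nodup_append.mp hn).2.2 x ?_ x (by simp) rfl
    simp [rd, h]
  have hnr : ∀ {A B : List ℕ} {y x : ℕ} {rest}, (rd ((A ++ y :: B) :: rest) ++ [x]).Nodup → (rd rest ++ [y]).Nodup := by
    intro A B y x rest hn
    have h2 := (List.nodup_append.mp hn).1
    simp only [rd] at h2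
    rw [List.nodup_append] at h2 ⊢
    refine ⟨h2.1, by simp, ?_⟩
    intro a ha b hb
    rw [List.mem_singleton] at hb; subst hb
    exact h2.2.2 a ha _ (by simp)
  have aux : ∀ (row : List ℕ) (rest : List (List ℕ)) (x x' : ℕ), (rd (row :: rest) ++ [x]).Nodup → row ≠ [] → 
      [[x']] = insTab (row :: rest) x → 0 = krow (row :: rest) x → False := by
    intro row rest x x' hn hne hT hk
    rcases insRow_spec x row (hxr hn) with ⟨h, -⟩ | ⟨A, y, B, rfl, h, -, -⟩
    · rw [insTab_none _ h] at hT
      simp only [List.cons.injEq] at hT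
      have := congrArg List.length hT.1
      simp at this
      exact hne this
    · rw [krow_some _ h] at hk; omega
  induction T1 generalizing T2 x1 x2 with
  | nil => 
    cases T2 with
    | nil => simpa [insTab] using hT
    | cons row rest => exact (aux row rest x2 x1 hn2 (he2 row (by simp)) hT hk).elim
  | cons row1 rest1 ih =>
    cases T2 with
    | nil => exact (aux row1 rest1 x1 x2 hn1 (he1 row1 (by simp)) hT.symm hk.symm).elim
    | cons row2 rest2 =>
      have s1 := hs1 row1 (by simp)
      have s2 := hs2 row2 (by simp)
      rcases insRow_spec x1 row1 (hxr hn1) with ⟨h, -⟩ | ⟨A, y, B, rfl, h, hA, hxy⟩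
      · rcases insRow_spec x2 row2 (hxr hn2) with ⟨h', -⟩ | ⟨A', y', B', rfl, h', hA', hxy'⟩
        · rw [insTab_none _ h, insTab_none _ h'] at hT
          simp only [List.cons.injEq] at hT
          obtain ⟨e, rfl⟩ := hT
          obtain ⟨rfl, h4⟩ := List.append_inj' e rfl
          exact ⟨rfl, by simpa using h4⟩
        · rw [krow_none _ h, krow_some _ h'] at hk; omega
      · rcases insRow_spec x2 row2 (hxr hn2) with ⟨h', -⟩ | ⟨A', y', B', rfl, h', hA', hxy'⟩
        · rw [krow_some _ h, krow_none _ h'] at hk; omega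
        · rw [krow_some _ h, krow_some _ h'] at hk
          rw [insTab_some _ h, insTab_some _ h'] at hT
          simp only [List.cons.injEq] at hT
          obtain ⟨e, hT⟩ := hT
          obtain ⟨rfl, rfl⟩ := ih rest2 y y' (fun r hr => hs1 r (by simp [hr])) (fun r hr => hs2 r (by simp [hr])) 
            (hnr hn1) (hnr hn2) (fun r hr => he1 r (by simp [hr])) (fun r hr => he2 r (by simp [hr])) hT (by omega)
          have q1 := List.pairwise_append.mp s1
          have q2 := List.pairwise_append.mp s2
          obtain ⟨rfl, rfl, rfl⟩ := split_max_uniq (y := y) e (fun a ha => (hA a ha).trans hxy) hxy 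
            (List.pairwise_cons.mp q1.2.1).1 (fun a ha => (hA' a ha).trans hxy') hxy' (List.pairwise_cons.mp q2.2.1).1
          exact ⟨rfl, rfl⟩

theorem DomR_of_get {r s : List ℕ} (h : ∀ (i b : ℕ), s[i]? = some b → ∃ a, r[i]? = some a ∧ a < b) : DomR r s := by
  induction s generalizing r with
  | nil => exact DomR_nil r
  | cons b s ih =>
    obtain ⟨a, ha, hab⟩ := h 0 b (by simp)
    cases r with
    | nil => simp at ha
    | cons a' r =>
      simp at ha; subst ha
      exact ⟨hab, ih (fun i c hc => by simpa using h (i+1) c (by simpa using hc))⟩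

theorem split_lt {row : List ℕ} (hs : row.Pairwise (· < ·)) {y : ℕ} (hy : y ∉ row) (hex : ∃ a ∈ row, a < y) : 
    ∃ A x B, row = A ++ x :: B ∧ (∀ a ∈ A, a < x) ∧ x < y ∧ ∀ b ∈ B, y < b := by
  induction row with
  | nil => simp at hex
  | cons c row ih =>
    have hp := List.pairwise_cons.mp hs
    by_cases h : ∃ a ∈ row, a < y
    · obtain ⟨A, x, B, rfl, h1, h2, h3⟩ := ih hp.2 (fun h => hy (by simp [h])) h
      refine ⟨c :: A, x, B, rfl, ?_, h2, h3⟩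
      intro a ha
      rcases List.mem_cons.mp ha with rfl | ha
      · exact hp.1 x (by simp)
      · exact h1 a ha
    · push Not at h
      refine ⟨[], c, row, rfl, by simp, ?_, ?_⟩
      · obtain ⟨a, ha, hay⟩ := hex
        rcases List.mem_cons.mp ha with rfl | ha
        · exact hay
        · exact absurd hay (not_lt.mpr (h a ha))
      · intro b hb
        refine lt_of_le_of_ne (h b hb) ?_
        rintro rfl; exact hy (by simp [hb])
end RevIns


section RevEx

theorem get_mid (A B : List ℕ) (x : ℕ) : (A ++ x :: B)[A.length]? = some x := by simp

theorem get_ne (A B : List ℕ) (x y : ℕ) {i : ℕ} (h : i ≠ A.length) : (A ++ y :: B)[i]? = (A ++ x :: B)[i]? := by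
  rw [List.getElem?_append, List.getElem?_append]
  split_ifs with h1
  · rfl
  · obtain ⟨k, hk⟩ : ∃ k, i - A.length = k + 1 := ⟨i - A.length - 1, by omega⟩
    rw [hk]; simp

theorem get_gt (A B : List ℕ) (x : ℕ) {i a : ℕ} (h : A.length < i) (ha : (A ++ x :: B)[i]? = some a) : a ∈ B := by
  rw [List.getElem?_append, if_neg (by omega)] at ha
  obtain ⟨k, hk⟩ : ∃ k, i - A.length = k + 1 := ⟨i - A.length - 1, by omega⟩
  rw [hk] at ha
  simp only [List.getElem?_cons_succ] at ha
  exact List.mem_of_getElem? ha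

theorem DomR_unbump {A B h'' : List ℕ} {x y : ℕ} (hxy : x < y) (hB : ∀ b ∈ B, y < b) 
    (hy : y ∉ h'') (hs : h''.Pairwise (· < ·)) (hD : DomR (A ++ x :: B) (insRow y h'').1) : DomR (A ++ y :: B) h'' := by
  apply DomR_of_get
  intro i b hb
  rcases insRow_spec y h'' hy with ⟨h, hall⟩ | ⟨C, z, D, rfl, h, hC, hyz⟩
  · rw [h] at hD
    have hlen : i < h''.length := (List.getElem?_eq_some_iff.mp hb).1
    obtain ⟨a, ha, hab⟩ := hD.get i b (by rw [List.getElem?_append, if_pos hlen]; exact hb)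
    by_cases hi : i = A.length
    · obtain ⟨a', ha', hab'⟩ := hD.get h''.length y (by simp)
      have := hB a' (get_gt A B x (by omega) ha')
      omega
    · rw [get_ne A B x y hi]; exact ⟨a, ha, hab⟩
  · rw [h] at hD
    obtain ⟨a', ha', hab'⟩ := hD.get C.length y (by simp)
    have hq : C.length ≤ A.length := by
      by_contra hc
      have := hB a' (get_gt A B x (by omega) ha')
      omega
    by_cases hi : i = A.length
    · subst hi
      refine ⟨y, get_mid A B y, ?_⟩
      rcases Nat.eq_or_lt_of_le hq with e | e
      · rw [← e, get_mid] at hb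
        injection hb with hb; omega
      · have := get_gt C D z e hb
        have := (List.pairwise_cons.mp (List.pairwise_append.mp hs).2.1).1 b this
        omega
    · rw [get_ne A B x y hi]
      by_cases hiq : i = C.length
      · subst hiq
        rw [get_mid] at hb
        injection hb with hb
        exact ⟨a', ha', by omega⟩
      · exact hD.get i b (by rw [get_ne C D z y hiq]; exact hb)

theorem rev_ex (T : List (List ℕ)) (k : ℕ) (hT : IsTab T) (hn : (rd T).Nodup) (he : ∀ r ∈ T, r ≠ []) 
    (hk : shf T (k+1) < shf T k) : ∃ T' x, IsTab T' ∧ (rd T' ++ [x]).Nodup ∧ (∀ r ∈ T', r ≠ []) ∧ 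
      insTab T' x = T ∧ krow T' x = k ∧ (rd T' ++ [x]).Perm (rd T) := by
  induction T generalizing k with
  | nil => simp [shf_nil] at hk
  | cons row rest ih =>
    have hrow := hT.1 row (by simp)
    have hnn := List.nodup_append.mp hn
    cases k with
    | zero =>
      have hne := he row (by simp)
      obtain ⟨row0, x, rfl⟩ : ∃ row0 x, row = row0 ++ [x] := 
        ⟨row.dropLast, row.getLast hne, (List.dropLast_append_getLast hne).symm⟩
      have hall : ∀ a ∈ row0, a < x := by
        have := List.pairwise_append.mp hrow
        exact fun a ha => this.2.2 a ha x (by simp)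
      have hins := insRow_app hall
      rw [shf_succ, shf_zero] at hk
      rcases row0 with _ | ⟨c, row0⟩
      · have : rest = [] := by
          cases rest with
          | nil => rfl
          | cons r2 rest2 =>
            rw [shf_zero] at hk
            simp at hk
            exact absurd hk (he r2 (by simp))
        subst this
        refine ⟨[], x, by simp [IsTab], by simp [rd], by simp, by simp [insTab], rfl, by simp [rd]⟩
      · have hins' := insTab_none rest hins
        refine ⟨(c :: row0) :: rest, x, ?_, ?_, ?_, hins', krow_none _ hins, ?_⟩
        · apply IsTab.cons_head
          · exact (List.pairwise_append.mp hrow).1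
          · exact hT.tail
          · cases rest with
            | nil => exact DomR_nil _
            | cons r2 rest2 =>
              rw [shf_zero] at hk
              have hD : DomR (c :: row0 ++ [x]) r2 := (List.pairwise_cons.mp hT.2).1 r2 (by simp)
              apply DomR_of_get
              intro i b hb
              obtain ⟨a, ha, hab⟩ := hD.get i b hb
              have hi : i < r2.length := (List.getElem?_eq_some_iff.mp hb).1
              refine ⟨a, ?_, hab⟩
              rw [List.getElem?_append, if_pos (by simp at hk ⊢; omega)] at ha
              exact ha
        · simpa [rd] using hn
        · intro r hr
          rcases List.mem_cons.mp hr with rfl | hr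
          · simp
          · exact he r (by simp [hr])
        · simp [rd]
    | succ k =>
      rw [shf_succ, shf_succ] at hk
      obtain ⟨T'', y, h1, h2, h3, h4, h5, h6⟩ := ih k hT.tail hnn.1 (fun r hr => he r (by simp [hr])) hk
      have hD : DomR row (insRow y (T''.headD [])).1 := by
        have hh := insTab_head T'' y
        rw [h4] at hh
        cases rest with
        | nil => simp at hh
        | cons r2 rest2 =>
          simp only [List.head?_cons, Option.some.injEq] at hh
          rw [← hh]
          exact (List.pairwise_cons.mp hT.2).1 r2 (by simp)
      have hy : y ∉ T''.headD [] := by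
        intro hc
        refine (List.nodup_append.mp h2).2.2 y ?_ y (by simp) rfl
        cases T'' with
        | nil => simp at hc
        | cons r2 rest2 => simp at hc; simp [rd, hc]
      have hsh : (T''.headD []).Pairwise (· < ·) := by
        cases T'' with
        | nil => simp
        | cons r2 rest2 => simpa using h1.1 r2 (by simp)
      have hyrow : y ∉ row := by
        intro hc
        exact hnn.2.2 y (h6.mem_iff.mp (by simp)) y hc rfl
      have hex : ∃ a ∈ row, a < y := by
        have hym : y ∈ (insRow y (T''.headD [])).1 := by
          rcases insRow_spec y _ hy with ⟨h, -⟩ | ⟨C, z, D, -, h, -, -⟩ <;> rw [h] <;> simp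
        obtain ⟨i, hi⟩ := List.getElem?_of_mem hym
        obtain ⟨a, ha, hab⟩ := hD.get i y hi
        exact ⟨a, List.mem_of_getElem? ha, hab⟩
      obtain ⟨A, x, B, rfl, hA, hxy, hB⟩ := split_lt hrow hyrow hex
      have hins : insRow x (A ++ y :: B) = (A ++ x :: B, some y) := insRow_bmp hA hxy
      have hperm : (rd ((A ++ y :: B) :: T'') ++ [x]).Perm (rd ((A ++ x :: B) :: rest)) := by
        simp only [rd]
        rw [List.perm_iff_count] at h6 ⊢
        intro c
        have := h6 c
        simp only [List.count_append, List.count_cons, List.count_nil] at this ⊢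
        omega
      refine ⟨(A ++ y :: B) :: T'', x, ?_, hperm.nodup_iff.mpr hn, ?_, ?_, ?_, hperm⟩
      · apply IsTab.cons_head _ h1
        · exact DomR_unbump hxy hB hy hsh hD
        · have q := List.pairwise_append.mp hrow
          have q2 := List.pairwise_cons.mp q.2.1
          rw [List.pairwise_append, List.pairwise_cons]
          refine ⟨q.1, ⟨hB, q2.2⟩, ?_⟩
          intro a ha b hb
          rcases List.mem_cons.mp hb with rfl | hb
          · exact (hA a ha).trans hxy
          · exact q.2.2 a ha b (by simp [hb])
      · intro r hr
        rcases List.mem_cons.mp hr with rfl | hr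
        · simp
        · exact h3 r hr
      · rw [insTab_some _ hins, h4]
      · rw [krow_some _ hins, h5]

/-- recording row of step `i` of the word `w` -/
def kk (w : List ℕ) (i : ℕ) : ℕ := krow (ptab (w.take i)) (w.getD i 0)

theorem kk_lt (w : List ℕ) (x : ℕ) {i : ℕ} (h : i < w.length) : kk (w ++ [x]) i = kk w i := by
  unfold kk
  rw [List.take_append_of_le_length h.le]
  congr 1
  rw [List.getD_append _ _ _ _ h]

theorem kk_last (w : List ℕ) (x : ℕ) : kk (w ++ [x]) w.length = krow (ptab w) x := by
  simp [kk]

theorem word_uniq (w w' : List ℕ) (hlen : w.length = w'.length) (hn : w.Nodup) (hn' : w'.Nodup) 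
    (hp : ptab w = ptab w') (hk : ∀ i < w.length, kk w i = kk w' i) : w = w' := by
  induction w using List.reverseRecOn generalizing w' with
  | nil => 
    symm; apply List.length_eq_zero_iff.mp; rw [← hlen]; rfl
  | append_singleton w x ih =>
    rcases List.eq_nil_or_concat w' with rfl | ⟨u, x', rfl⟩
    · simp at hlen
    · simp only [List.concat_eq_append] at *
      have hl : w.length = u.length := by simpa using hlen
      have n1 := (List.nodup_append.mp hn).1
      have n2 := (List.nodup_append.mp hn').1
      have p1 := ptab_spec w n1
      have p2 := ptab_spec u n2
      rw [ptab_append, ptab_append] at hp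
      have hk0 := hk w.length (by simp)
      rw [kk_last, hl, kk_last] at hk0
      obtain ⟨e1, e2⟩ := rev_uniq (ptab w) (ptab u) x x' p1.1.1 p2.1.1 
        ((p1.2.perm.append_right [x]).nodup_iff.mp hn) ((p2.2.perm.append_right [x']).nodup_iff.mp hn')
        (ptab_ne_nil w) (ptab_ne_nil u) hp hk0
      have := ih u hl n1 n2 e1 (fun i hi => by
        have := hk i (by simp; omega)
        rwa [kk_lt w x hi, kk_lt u x' (by omega)] at this)
      rw [this, e2]

theorem shf_word (w : List ℕ) (hn : w.Nodup) (k : ℕ) : shf (ptab w) k = Nat.count (fun i => kk w i = k) w.length := by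
  induction w using List.reverseRecOn with
  | nil => simp [ptab, shf_nil]
  | append_singleton w x ih =>
    have n1 := (List.nodup_append.mp hn).1
    rw [ptab_append, shf_insTab _ _ (((ptab_spec w n1).2.perm.append_right [x]).nodup_iff.mp hn), ih n1]
    simp only [List.length_append, List.length_singleton, Nat.count_succ, kk_last]
    congr 1
    rw [Nat.count_eq_card_filter_range, Nat.count_eq_card_filter_range]
    congr 1
    apply Finset.filter_congr
    intro i hi
    rw [kk_lt w x (Finset.mem_range.mp hi)]

theorem kk_take (w : List ℕ) (j i : ℕ) (h : i < j) (hj : j ≤ w.length) : kk (w.take j) i = kk w i := by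
  unfold kk
  rw [List.take_take, min_eq_left h.le]
  congr 1
  simp [List.getD_eq_getElem?_getD, List.getElem?_take, h]

theorem shf_anti {T : List (List ℕ)} (hT : IsTab T) (k : ℕ) : shf T (k+1) ≤ shf T k := by
  have h := shape_pairwise hT
  unfold shf
  by_cases h1 : k + 1 < (shapeOf T).length
  · rw [List.getD_eq_getElem _ _ h1, List.getD_eq_getElem _ _ (by omega)]
    exact List.pairwise_iff_getElem.mp h k (k+1) _ _ (by omega)
  · rw [List.getD_eq_default _ _ (by omega)]; omega

theorem kk_yam (w : List ℕ) (hn : w.Nodup) (j : ℕ) (hj : j ≤ w.length) (k : ℕ) : 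
    Nat.count (fun i => kk w i = k+1) j ≤ Nat.count (fun i => kk w i = k) j := by
  have key : ∀ k, Nat.count (fun i => kk w i = k) j = shf (ptab (w.take j)) k := by
    intro k
    rw [shf_word _ (hn.sublist (List.take_sublist j w)), List.length_take, min_eq_left hj,
      Nat.count_eq_card_filter_range, Nat.count_eq_card_filter_range]
    congr 1
    apply Finset.filter_congr
    intro i hi
    rw [kk_take w j i (Finset.mem_range.mp hi) hj]
  rw [key, key]
  exact shf_anti (ptab_spec _ (hn.sublist (List.take_sublist j w))).1 k

theorem word_ex (N : ℕ) (ks : ℕ → ℕ) (T : List (List ℕ)) (hT : IsTab T) (hn : (rd T).Nodup) (he : ∀ r ∈ T, r ≠ [])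
    (hc : ∀ k, Nat.count (fun i => ks i = k) N = shf T k) 
    (hy : ∀ j ≤ N, ∀ k, Nat.count (fun i => ks i = k+1) j ≤ Nat.count (fun i => ks i = k) j) :
    ∃ w : List ℕ, w.length = N ∧ w.Nodup ∧ ptab w = T ∧ ∀ i < N, kk w i = ks i := by
  induction N generalizing T with
  | zero =>
    refine ⟨[], rfl, by simp, ?_, by simp⟩
    cases T with
    | nil => rfl
    | cons r T => 
      have := hc 0
      rw [shf_zero] at this
      simp at this
      exact absurd (List.length_eq_zero_iff.mp this.symm) (he r (by simp))
  | succ N ih =>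
    have hcor : shf T (ks N + 1) < shf T (ks N) := by
      rw [← hc, ← hc, Nat.count_succ, Nat.count_succ, if_neg (by omega), if_pos rfl]
      have := hy N (by omega) (ks N)
      omega
    obtain ⟨T', x, h1, h2, h3, h4, h5, h6⟩ := rev_ex T (ks N) hT hn he hcor
    obtain ⟨w, hl, hw, hp, hk⟩ := ih T' h1 (List.nodup_append.mp h2).1 h3 (by
      intro k
      have e1 := shf_insTab T' x h2 k
      rw [h4, h5, ← hc, Nat.count_succ] at e1
      omega) (fun j hj k => hy j (by omega) k)
    refine ⟨w ++ [x], by simp [hl], ?_, by rw [ptab_append, hp, h4], ?_⟩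
    · have := (ptab_spec w hw).2.perm
      rw [hp] at this
      exact (this.append_right [x]).nodup_iff.mpr h2
    · intro i hi
      rcases Nat.lt_succ_iff_lt_or_eq.mp hi with h | h
      · rw [kk_lt w x (by omega), hk i h]
      · subst h
        have := kk_last w x
        rw [hl, hp, h5] at this
        exact this

theorem kk_desc (w : List ℕ) (hn : w.Nodup) (i : ℕ) (h : i + 1 < w.length) : 
    kk w i < kk w (i+1) ↔ w[i+1] < w[i] := by
  have hsub := hn.sublist (List.take_sublist (i+2) w)
  have e2 : w.take (i+2) = w.take i ++ [w[i], w[i+1]] := by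
    rw [List.take_succ_eq_append_getElem h, List.take_succ_eq_append_getElem (by omega), List.append_assoc]
    rfl
  have e1 : ptab (w.take (i+1)) = insTab (ptab (w.take i)) w[i] := by
    rw [List.take_succ_eq_append_getElem (by omega), ptab_append]
  rw [e2] at hsub
  have n1 := (List.nodup_append.mp hsub).1
  have p := ptab_spec _ n1
  have hb := bump_rows (ptab (w.take i)) w[i] w[i+1] p.1.1 ((p.2.perm.append_right _).nodup_iff.mp hsub)
  unfold kk
  rw [e1, List.getD_eq_getElem _ _ h, List.getD_eq_getElem _ _ (by omega)]
  have hne : w[i] ≠ w[i+1] := by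
    intro hc
    have := (List.Nodup.getElem_inj_iff hn).mp hc
    omega
  constructor
  · intro hk
    by_contra hc
    have := hb.2 (by omega)
    omega
  · exact hb.1
end RevEx


section WordS

def GoodS {m : ℕ} (lam : ℕ → ℕ) (S : Finset (Fin m ×ₗ ℕ)) : Prop :=
  (∀ k, (S.filter (fun s => (ofLex s).2 = k)).card = lam k) ∧
  ∀ b ∈ S, ∀ k, (S.filter (fun s => (ofLex s).2 = k + 1 ∧ s ≤ b)).card ≤ (S.filter (fun s => (ofLex s).2 = k ∧ s ≤ b)).card

def gw {n m : ℕ} (σ : Equiv.Perm (Fin n)) (f : Fin n → Fin m) (i : Fin n) : Fin m ×ₗ ℕ := toLex (f i, kk (wd σ) i)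

theorem strictMono_steps {n : ℕ} {α : Type*} [Preorder α] (g : Fin n → α) : 
    StrictMono g ↔ ∀ (j : ℕ) (h : j + 1 < n), g ⟨j, Nat.lt_of_succ_lt h⟩ < g ⟨j+1, h⟩ := by
  constructor
  · intro hg j h
    exact hg (by simp [Fin.lt_def])
  · intro hg
    cases n with
    | zero => exact fun a => a.elim0
    | succ n =>
      rw [Fin.strictMono_iff_lt_succ]
      intro i
      exact hg i.val (by omega)

theorem gw_mono {n m : ℕ} (γ : Equiv.Perm (Fin n)) (f : Fin n → Fin m) : 
    (∀ (j : ℕ) (h : j + 1 < n),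
        f ⟨j, Nat.lt_of_succ_lt h⟩ ≤ f ⟨j + 1, h⟩ ∧
        (j ∈ {i | i ∉ DesL0 γ} → f ⟨j, Nat.lt_of_succ_lt h⟩ < f ⟨j + 1, h⟩)) ↔ StrictMono (gw γ⁻¹ f) := by
  rw [strictMono_steps]
  apply forall_congr'; intro j
  apply forall_congr'; intro h
  have hd : j ∈ DesL0 γ ↔ kk (wd γ⁻¹) j < kk (wd γ⁻¹) (j+1) := by
    rw [kk_desc _ (wd_nodup _) j (by simpa [wd] using h)]
    simp only [DesL0, Set.mem_setOf_eq, wd, List.getElem_ofFn]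
    exact ⟨fun ⟨_, h2⟩ => h2, fun h2 => ⟨h, h2⟩⟩
  simp only [gw, Prod.Lex.toLex_lt_toLex, Set.mem_setOf_eq, hd]
  constructor
  · rintro ⟨h1, h2⟩
    by_cases hk : kk (wd γ⁻¹) j < kk (wd γ⁻¹) (j+1)
    · rcases h1.lt_or_eq with h3 | h3
      · exact Or.inl h3
      · exact Or.inr ⟨h3, hk⟩
    · exact Or.inl (h2 hk)
  · rintro (h1 | ⟨h1, h2⟩)
    · exact ⟨h1.le, fun _ => h1⟩
    · exact ⟨h1.le, fun h3 => absurd h2 h3⟩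

theorem card_filter_count {n : ℕ} (q : ℕ → Prop) [DecidablePred q] (j : ℕ) (hj : j ≤ n) : 
    (Finset.univ.filter (fun i : Fin n => q i.val ∧ i.val < j)).card = Nat.count q j := by
  rw [Nat.count_eq_card_filter_range]
  apply Finset.card_bij (fun (i : Fin n) _ => i.val)
  · intro i hi
    simp only [Finset.mem_filter, Finset.mem_univ, true_and, Finset.mem_range] at hi ⊢
    exact ⟨hi.2, hi.1⟩
  · intro a _ b _ h; exact Fin.ext h
  · intro b hb
    simp only [Finset.mem_filter, Finset.mem_range] at hb
    exact ⟨⟨b, by omega⟩, by simp [hb], rfl⟩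

theorem card_filter_image {n : ℕ} {α : Type*} [Preorder α] [DecidableEq α] (g : Fin n → α) (hg : Function.Injective g) (P : α → Prop) [DecidablePred P] : 
    ((Finset.univ.image g).filter P).card = (Finset.univ.filter (fun i => P (g i))).card := by
  rw [Finset.filter_image, Finset.card_image_of_injective _ hg]

theorem good_iff {n m : ℕ} (lam : ℕ → ℕ) (g : Fin n → Fin m ×ₗ ℕ) (hg : StrictMono g) (ks : ℕ → ℕ) 
    (hks : ∀ i, (ofLex (g i)).2 = ks i.val) : GoodS lam (Finset.univ.image g) ↔ 
      (∀ k, Nat.count (fun i => ks i = k) n = lam k) ∧ 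
      ∀ j ≤ n, ∀ k, Nat.count (fun i => ks i = k+1) j ≤ Nat.count (fun i => ks i = k) j := by
  have e1 : ∀ k, ((Finset.univ.image g).filter (fun s => (ofLex s).2 = k)).card = Nat.count (fun i => ks i = k) n := by
    intro k
    rw [card_filter_image g hg.injective, ← card_filter_count _ n le_rfl]
    simp [hks]
  have e2 : ∀ (i : Fin n) k, ((Finset.univ.image g).filter (fun s => (ofLex s).2 = k ∧ s ≤ g i)).card = 
      Nat.count (fun i => ks i = k) (i.val+1) := by
    intro i k
    rw [card_filter_image g hg.injective, ← card_filter_count _ (i.val+1) i.2]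
    simp only [hks, hg.le_iff_le, Fin.le_def, Nat.lt_succ_iff]
  unfold GoodS
  simp only [e1]
  apply and_congr Iff.rfl
  constructor
  · intro h j hj k
    cases j with
    | zero => simp
    | succ j => 
      have := h (g ⟨j, hj⟩) (by simp) k
      rwa [e2, e2] at this
  · intro h b hb k
    obtain ⟨i, -, rfl⟩ := Finset.mem_image.mp hb
    rw [e2, e2]
    exact h _ i.2 k

theorem sum_getD (l : List ℕ) : ∑ i ∈ Finset.range l.length, l.getD i 0 = l.sum := by
  induction l with
  | nil => simp
  | cons a l ih => 
    rw [List.length_cons, Finset.sum_range_succ', List.sum_cons]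
    simp only [List.getD_cons_succ, List.getD_cons_zero, ih]
    omega

theorem good_card {m : ℕ} (T : List (List ℕ)) (S : Finset (Fin m ×ₗ ℕ)) (h : GoodS (shf T) S) : 
    S.card = (shapeOf T).sum := by
  rw [← sum_getD, Finset.card_eq_sum_card_fiberwise (f := fun s => (ofLex s).2) (t := Finset.range (shapeOf T).length)]
  · apply Finset.sum_congr rfl
    intro k _
    exact h.1 k
  · intro s hs
    simp only [Finset.coe_range, Set.mem_Iio]
    by_contra hc
    have h1 := h.1 (ofLex s).2
    rw [shf, List.getD_eq_default _ _ (by omega), Finset.card_eq_zero] at h1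
    have : s ∈ S.filter (fun s' => (ofLex s').2 = (ofLex s).2) := by
      rw [Finset.mem_filter]; exact ⟨hs, rfl⟩
    rw [h1] at this
    simp at this

theorem exists_perm_wd {n : ℕ} (w : List ℕ) (hl : w.length = n) (hn : w.Nodup) (hlt : ∀ a ∈ w, a < n) : 
    ∃ σ : Equiv.Perm (Fin n), wd σ = w := by
  subst hl
  let e : Fin w.length → Fin w.length := fun i => ⟨w[i], hlt _ (List.getElem_mem _)⟩
  have he : Function.Injective e := by
    intro a b h
    have h1 : w[a.val] = w[b.val] := by simpa [e] using h
    exact Fin.ext ((List.Nodup.getElem_inj_iff hn).mp h1)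
  refine ⟨Equiv.ofBijective e (Finite.injective_iff_bijective.mp he), ?_⟩
  apply List.ext_getElem
  · simp [wd]
  · intro i h1 h2
    simp [wd, e]

theorem word_good {n m : ℕ} (σ : Equiv.Perm (Fin n)) (f : Fin n → Fin m) (h : StrictMono (gw σ f)) : 
    GoodS (shf (Ptab σ)) (Finset.univ.image (gw σ f)) := by
  rw [good_iff _ _ h (kk (wd σ)) (fun i => rfl)]
  have hl : (wd σ).length = n := by simp [wd]
  constructor
  · intro k
    rw [Ptab_eq, shf_word _ (wd_nodup σ), hl]
  · intro j hj k
    exact kk_yam _ (wd_nodup σ) j (by omega) k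

theorem word_inj {n m : ℕ} (σ σ' : Equiv.Perm (Fin n)) (f f' : Fin n → Fin m) (h : StrictMono (gw σ f)) 
    (h' : StrictMono (gw σ' f')) (hp : Ptab σ = Ptab σ') 
    (he : Finset.univ.image (gw σ f) = Finset.univ.image (gw σ' f')) : σ = σ' ∧ f = f' := by
  have hg : gw σ f = gw σ' f' := by
    rw [← StrictMono.range_inj h h']
    ext x
    have := Finset.ext_iff.mp he x
    simpa using this
  have h1 : ∀ i, f i = f' i ∧ kk (wd σ) i = kk (wd σ') i := by
    intro i
    have := congrFun hg i
    simp only [gw, toLex_inj, Prod.mk.injEq] at this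
    exact this
  refine ⟨?_, funext fun i => (h1 i).1⟩
  have hl : ∀ σ : Equiv.Perm (Fin n), (wd σ).length = n := fun σ => by simp [wd]
  have hw := word_uniq (wd σ) (wd σ') (by rw [hl, hl]) (wd_nodup _) (wd_nodup _) hp (fun i hi => by
    rw [hl] at hi
    exact (h1 ⟨i, hi⟩).2)
  ext i
  have := List.ofFn_injective hw
  exact congrFun this i

theorem word_surj {n m : ℕ} (σ0 : Equiv.Perm (Fin n)) (S : Finset (Fin m ×ₗ ℕ)) (hS : GoodS (shf (Ptab σ0)) S) :
    ∃ (σ : Equiv.Perm (Fin n)) (f : Fin n → Fin m), Ptab σ = Ptab σ0 ∧ StrictMono (gw σ f) ∧ 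
      Finset.univ.image (gw σ f) = S := by
  have p0 := ptab_spec _ (wd_nodup σ0)
  have hcard : S.card = n := by
    rw [good_card _ _ hS, ← rd_length, Ptab_eq, ← p0.2.perm.length_eq]
    simp [wd]
  let g : Fin n ↪o (Fin m ×ₗ ℕ) := S.orderEmbOfFin hcard
  have hgS : Finset.univ.image g = S := Finset.image_orderEmbOfFin_univ S hcard
  let ks : ℕ → ℕ := fun i => if h : i < n then (ofLex (g ⟨i, h⟩)).2 else 0
  have hks : ∀ i : Fin n, (ofLex (g i)).2 = ks i.val := by
    intro i; simp [ks]
  rw [← hgS, good_iff _ g g.strictMono ks hks] at hS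
  obtain ⟨w, hl, hw, hp, hk⟩ := word_ex n ks (Ptab σ0) p0.1 (p0.2.perm.nodup_iff.mp (wd_nodup σ0)) (ptab_ne_nil _) hS.1 hS.2
  have hperm : w.Perm (wd σ0) := by
    have := (ptab_spec w hw).2.perm
    rw [hp] at this
    exact this.trans p0.2.perm.symm
  obtain ⟨σ, rfl⟩ := exists_perm_wd w hl hw (fun a ha => wd_lt σ0 a (hperm.mem_iff.mp ha))
  refine ⟨σ, fun i => (ofLex (g i)).1, hp, ?_, ?_⟩
  all_goals
    have hg : gw σ (fun i => (ofLex (g i)).1) = g := by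
      funext i
      rw [gw, hk i i.2, ← hks]
      rfl
    rw [hg]
  · exact g.strictMono
  · exact hgS

noncomputable def wS {m : ℕ} (S : Finset (Fin m ×ₗ ℕ)) : MvPolynomial (Fin m) ℤ := ∏ s ∈ S, MvPolynomial.X (ofLex s).1

theorem sum_eq_of_param {A B α : Type*} [Fintype A] [Fintype B] {R : Type*} [AddCommMonoid R] (P : A → Prop) (Q : B → Prop) 
    (G : α → Prop) (φ : A → α) (ψ : B → α) (F : α → R)
    (h1 : ∀ a, P a → G (φ a)) (h2 : ∀ a a', P a → P a' → φ a = φ a' → a = a') (h3 : ∀ s, G s → ∃ a, P a ∧ φ a = s)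
    (k1 : ∀ a, Q a → G (ψ a)) (k2 : ∀ a a', Q a → Q a' → ψ a = ψ a' → a = a') (k3 : ∀ s, G s → ∃ a, Q a ∧ ψ a = s) :
    ∑ a, (if P a then F (φ a) else 0) = ∑ b, (if Q b then F (ψ b) else 0) := by
  rw [← Finset.sum_filter, ← Finset.sum_filter]
  rw [← Finset.sum_image (f := F) (g := φ), ← Finset.sum_image (f := F) (g := ψ)]
  · apply Finset.sum_congr _ (fun _ _ => rfl)
    ext s
    simp only [Finset.mem_image, Finset.mem_filter, Finset.mem_univ, true_and]
    constructor
    · rintro ⟨a, ha, rfl⟩; exact k3 _ (h1 a ha)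
    · rintro ⟨a, ha, rfl⟩; exact h3 _ (k1 a ha)
  · intro a ha b hb h
    simp only [Finset.coe_filter, Finset.mem_univ, true_and, Set.mem_setOf_eq] at ha hb
    exact k2 a b ha hb h
  · intro a ha b hb h
    simp only [Finset.coe_filter, Finset.mem_univ, true_and, Set.mem_setOf_eq] at ha hb
    exact h2 a b ha hb h
end WordS


section SSYTSide

theorem conj_lt (ν : List ℕ) (hν : ν.Pairwise (· ≥ ·)) : ∀ i j, i < (ν.filter fun a => decide (j < a)).length ↔ j < ν.getD i 0 := by
  induction ν with
  | nil => simp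
  | cons a l ih =>
    intro i j
    rw [List.pairwise_cons] at hν
    by_cases h : j < a
    · rw [List.filter_cons_of_pos (by simpa using h)]
      cases i with
      | zero => simp [h]
      | succ i => simpa using ih hν.2 i j
    · have hl : l.filter (fun a => decide (j < a)) = [] := by
        rw [List.filter_eq_nil_iff]
        intro b hb
        have := hν.1 b hb
        simp only [decide_eq_true_eq]; omega
      rw [List.filter_cons_of_neg (by simpa using h), hl]
      cases i with
      | zero => simpa using h
      | succ i =>
        have := ih hν.2 i j
        rw [hl] at this
        simpa using this

theorem le_foldr_max (ν : List ℕ) : ∀ i, ν.getD i 0 ≤ ν.foldr max 0 := by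
  induction ν with
  | nil => simp
  | cons a l ih =>
    intro i
    cases i with
    | zero => simp
    | succ i => simpa using Or.inr (ih i)

theorem mem_cells_conj (ν : List ℕ) (hν : ν.Pairwise (· ≥ ·)) (j k : ℕ) : 
    (j, k) ∈ cellsOfPart (conjPart ν) ↔ j < ν.getD k 0 := by
  have h1 : (j, k) ∈ cellsOfPart (conjPart ν) ↔ j < (conjPart ν).length ∧ k < (conjPart ν).getD j 0 := by
    simp [cellsOfPart]
  rw [h1, ← conj_lt ν hν]
  have hl : (conjPart ν).length = ν.foldr max 0 := by simp [conjPart]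
  constructor
  · rintro ⟨h2, h3⟩
    rw [List.getD_eq_getElem _ _ h2] at h3
    simpa [conjPart] using h3
  · intro h
    have h2 : j < (conjPart ν).length := by
      rw [hl]
      exact lt_of_lt_of_le ((conj_lt ν hν k j).mp h) (le_foldr_max ν k)
    refine ⟨h2, ?_⟩
    rw [List.getD_eq_getElem _ _ h2]
    simpa [conjPart] using h

def SSC (C : Finset (ℕ × ℕ)) {m : ℕ} (R : {x // x ∈ C} → Fin m) : Prop :=
  ∀ p q : {x // x ∈ C},
        ((p.1.1 = q.1.1 ∧ p.1.2 + 1 = q.1.2) → R p ≤ R q) ∧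
        ((p.1.1 + 1 = q.1.1 ∧ p.1.2 = q.1.2) → R p < R q)

def hR {C : Finset (ℕ × ℕ)} {m : ℕ} (R : {x // x ∈ C} → Fin m) (p : {x // x ∈ C}) : Fin m ×ₗ ℕ := toLex (R p, p.1.2)

theorem row_mono {C : Finset (ℕ × ℕ)} {lam : ℕ → ℕ} (hC : ∀ j k, (j, k) ∈ C ↔ j < lam k) {m : ℕ} 
    (R : {x // x ∈ C} → Fin m) (h : SSC C R) (k : ℕ) : 
    StrictMono (fun j : Fin (lam k) => R ⟨(j.val, k), (hC _ _).mpr j.2⟩) := by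
  rw [strictMono_steps]
  intro j hj
  exact (h _ _).2 ⟨rfl, rfl⟩

theorem hR_inj {C : Finset (ℕ × ℕ)} {lam : ℕ → ℕ} (hC : ∀ j k, (j, k) ∈ C ↔ j < lam k) {m : ℕ} 
    (R : {x // x ∈ C} → Fin m) (h : SSC C R) : Function.Injective (hR R) := by
  rintro ⟨⟨j, k⟩, hp⟩ ⟨⟨j', k'⟩, hq⟩ he
  simp only [hR, toLex_inj, Prod.mk.injEq] at he
  obtain ⟨h1, rfl⟩ := he
  have := (row_mono hC R h k).injective (a₁ := ⟨j, (hC _ _).mp hp⟩) (a₂ := ⟨j', (hC _ _).mp hq⟩) h1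
  simp only [Fin.mk.injEq] at this
  subst this
  rfl

theorem card_filter_image' {β α : Type*} [Fintype β] [DecidableEq α] (g : β → α) (hg : Function.Injective g) (P : α → Prop) [DecidablePred P] : 
    ((Finset.univ.image g).filter P).card = (Finset.univ.filter (fun i => P (g i))).card := by
  rw [Finset.filter_image, Finset.card_image_of_injective _ hg]

theorem ss_good {C : Finset (ℕ × ℕ)} {lam : ℕ → ℕ} (hC : ∀ j k, (j, k) ∈ C ↔ j < lam k) (hlam : ∀ k, lam (k+1) ≤ lam k) {m : ℕ} 
    (R : {x // x ∈ C} → Fin m) (h : SSC C R) : GoodS lam (Finset.univ.image (hR R)) := by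
  have hi := hR_inj hC R h
  constructor
  · intro k
    rw [card_filter_image' _ hi]
    symm
    rw [← Fintype.card_fin (lam k), ← Finset.card_univ]
    apply Finset.card_bij (fun (j : Fin (lam k)) _ => (⟨(j.val, k), (hC _ _).mpr j.2⟩ : {x // x ∈ C}))
    · intro j _
      exact Finset.mem_filter.mpr ⟨Finset.mem_univ _, rfl⟩
    · intro a _ b _ hab
      simp only [Subtype.mk.injEq, Prod.mk.injEq, and_true] at hab
      exact Fin.ext hab
    · rintro ⟨⟨j, k'⟩, hp⟩ hb
      have hb := (Finset.mem_filter.mp hb).2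
      change k' = k at hb
      subst hb
      exact ⟨⟨j, (hC _ _).mp hp⟩, Finset.mem_univ _, rfl⟩
  · intro b hb k
    rw [card_filter_image' _ hi, card_filter_image' _ hi]
    have hmem : ∀ p : {x // x ∈ C}, (p.1.1, p.1.2 - 1) ∈ C := by
      rintro ⟨⟨j, k'⟩, hp⟩
      rw [hC] at hp ⊢
      cases k' with
      | zero => exact hp
      | succ k' => exact lt_of_lt_of_le hp (hlam _)
    apply Finset.card_le_card_of_injOn (fun p => (⟨(p.1.1, p.1.2 - 1), hmem p⟩ : {x // x ∈ C}))
    · rintro ⟨⟨j, k'⟩, hp⟩ hq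
      have hq := (Finset.mem_filter.mp hq).2
      obtain ⟨h1, h2⟩ := hq
      change k' = k + 1 at h1
      subst h1
      refine Finset.mem_filter.mpr ⟨Finset.mem_univ _, rfl, le_trans ?_ h2⟩
      unfold hR
      rw [Prod.Lex.toLex_le_toLex]
      have := (h ⟨(j, k), by simpa using hmem ⟨(j,k+1), hp⟩⟩ ⟨(j,k+1), hp⟩).1 ⟨rfl, rfl⟩
      rcases this.lt_or_eq with h3 | h3
      · exact Or.inl h3
      · exact Or.inr ⟨h3, by simp⟩
    · rintro ⟨⟨j, k'⟩, hp⟩ hq ⟨⟨j2, k2⟩, hp2⟩ hq2 he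
      have hq := (Finset.mem_filter.mp hq).2.1
      have hq2 := (Finset.mem_filter.mp hq2).2.1
      change k' = k + 1 at hq
      change k2 = k + 1 at hq2
      simp only [Subtype.mk.injEq, Prod.mk.injEq] at he ⊢
      omega

theorem ss_inj {C : Finset (ℕ × ℕ)} {lam : ℕ → ℕ} (hC : ∀ j k, (j, k) ∈ C ↔ j < lam k) {m : ℕ} 
    (R R' : {x // x ∈ C} → Fin m) (h : SSC C R) (h' : SSC C R') 
    (he : Finset.univ.image (hR R) = Finset.univ.image (hR R')) : R = R' := by
  have key : ∀ (R : {x // x ∈ C} → Fin m) k c, 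
      c ∈ Set.range (fun j : Fin (lam k) => R ⟨(j.val, k), (hC _ _).mpr j.2⟩) ↔ toLex (c, k) ∈ Finset.univ.image (hR R) := by
    intro R k c
    simp only [Set.mem_range, Finset.mem_image, Finset.mem_univ, true_and]
    constructor
    · rintro ⟨j, rfl⟩
      exact ⟨_, rfl⟩
    · rintro ⟨⟨⟨j, k'⟩, hp⟩, hq⟩
      simp only [hR, toLex_inj, Prod.mk.injEq] at hq
      obtain ⟨h1, rfl⟩ := hq
      exact ⟨⟨j, (hC _ _).mp hp⟩, h1⟩
  funext p
  obtain ⟨⟨j, k⟩, hp⟩ := p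
  have := (StrictMono.range_inj (row_mono hC R h k) (row_mono hC R' h' k)).mp (by
    ext c
    rw [key, key, he])
  exact congrFun this ⟨j, (hC _ _).mp hp⟩

theorem ss_surj {C : Finset (ℕ × ℕ)} {lam : ℕ → ℕ} (hC : ∀ j k, (j, k) ∈ C ↔ j < lam k) {m : ℕ} 
    (S : Finset (Fin m ×ₗ ℕ)) (hS : GoodS lam S) : ∃ R : {x // x ∈ C} → Fin m, SSC C R ∧ Finset.univ.image (hR R) = S := by
  let F : ℕ → Finset (Fin m) := fun k => (S.filter (fun s => (ofLex s).2 = k)).image (fun s => (ofLex s).1)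
  have hF : ∀ k c, c ∈ F k ↔ toLex (c, k) ∈ S := by
    intro k c
    simp only [F, Finset.mem_image, Finset.mem_filter]
    constructor
    · rintro ⟨s, ⟨h1, rfl⟩, rfl⟩
      exact h1
    · intro h
      exact ⟨_, ⟨h, rfl⟩, rfl⟩
  have hcard : ∀ k, (F k).card = lam k := by
    intro k
    rw [← hS.1 k]
    apply Finset.card_image_of_injOn
    intro a ha b hb hab
    simp only [Finset.coe_filter, Set.mem_setOf_eq] at ha hb
    exact ofLex_inj.mp (Prod.ext hab (ha.2.trans hb.2.symm))
  let e : ∀ k, Fin (lam k) ↪o Fin m := fun k => (F k).orderEmbOfFin (hcard k)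
  have he : ∀ k c, toLex (c, k) ∈ S ↔ ∃ i, e k i = c := by
    intro k c
    rw [← hF, ← Finset.mem_coe, ← Finset.range_orderEmbOfFin (F k) (hcard k)]
    rfl
  refine ⟨fun p => e p.1.2 ⟨p.1.1, (hC _ _).mp p.2⟩, ?_, ?_⟩
  · rintro ⟨⟨j, k⟩, hp⟩ ⟨⟨j', k'⟩, hq⟩
    constructor
    · rintro ⟨h1, h2⟩
      simp only at h1 h2 ⊢
      subst h1 h2
      by_contra hc
      rw [not_le] at hc
      have hjk := (hC _ _).mp hp
      have hjk1 := (hC _ _).mp hq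
      have hb := hS.2 (toLex (e (k+1) ⟨j, hjk1⟩, k+1)) ((he _ _).mpr ⟨_, rfl⟩) k
      have l1 : j + 1 ≤ (S.filter (fun s => (ofLex s).2 = k + 1 ∧ s ≤ toLex (e (k+1) ⟨j, hjk1⟩, k+1))).card := by
        have : (Finset.univ : Finset (Fin (j+1))).card = j + 1 := by simp
        rw [← this]
        apply Finset.card_le_card_of_injOn (fun i => toLex (e (k+1) ⟨i.val, by omega⟩, k+1))
        · intro i _
          simp only [Finset.coe_filter, Set.mem_setOf_eq]
          refine ⟨(he _ _).mpr ⟨_, rfl⟩, rfl, ?_⟩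
          rw [Prod.Lex.toLex_le_toLex]
          have h3 : e (k+1) ⟨i.val, by omega⟩ ≤ e (k+1) ⟨j, hjk1⟩ := (e (k+1)).monotone (by
            rw [Fin.le_def]; have := i.2; simp only; omega)
          rcases h3.lt_or_eq with h3 | h3
          · exact Or.inl h3
          · exact Or.inr ⟨h3, le_rfl⟩
        · intro a _ b _ hab
          simp only [toLex_inj, Prod.mk.injEq, and_true, EmbeddingLike.apply_eq_iff_eq, Fin.mk.injEq] at hab
          exact Fin.ext hab
      have l2 : (S.filter (fun s => (ofLex s).2 = k ∧ s ≤ toLex (e (k+1) ⟨j, hjk1⟩, k+1))).card ≤ j := by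
        have : ((Finset.univ : Finset (Fin j)).image (fun i => (toLex (e k ⟨i.val, by omega⟩, k) : Fin m ×ₗ ℕ))).card ≤ j := by
          refine Finset.card_image_le.trans ?_
          simp
        refine le_trans (Finset.card_le_card ?_) this
        intro x hx
        rw [Finset.mem_filter] at hx
        obtain ⟨c, d⟩ := x
        obtain ⟨hx1, hx2, hx3⟩ := hx
        change d = k at hx2
        subst hx2
        obtain ⟨i, hi⟩ := (he d c).mp hx1
        subst hi
        have h4 : e d i ≤ e (d+1) ⟨j, hjk1⟩ := by
          have := (Prod.Lex.toLex_le_toLex (x := (e d i, d)) (y := (e (d+1) ⟨j, hjk1⟩, d+1))).mp hx3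
          rcases this with h | ⟨h, _⟩
          · exact le_of_lt h
          · exact le_of_eq h
        have h5 : i.val < j := by
          have := (e d).lt_iff_lt.mp (lt_of_le_of_lt h4 hc)
          simpa [Fin.lt_def] using this
        refine Finset.mem_image.mpr ?_
        exact ⟨⟨i.val, h5⟩, Finset.mem_univ _, rfl⟩
      omega
    · rintro ⟨h1, h2⟩
      simp only at h1 h2 ⊢
      subst h1 h2
      apply (e k).strictMono
      simp [Fin.lt_def]
  · ext x
    obtain ⟨c, k⟩ := x
    change toLex (c, k) ∈ _ ↔ toLex (c, k) ∈ S
    rw [he]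
    simp only [Finset.mem_image, Finset.mem_univ, true_and]
    constructor
    · rintro ⟨⟨⟨j, k'⟩, hp⟩, hq⟩
      simp only [hR, toLex_inj, Prod.mk.injEq] at hq
      obtain ⟨h1, rfl⟩ := hq
      exact ⟨_, h1⟩
    · rintro ⟨i, rfl⟩
      exact ⟨⟨(i.val, k), (hC _ _).mpr i.2⟩, rfl⟩

end SSYTSide


theorem part2 {n : ℕ} (γ0 : Equiv.Perm (Fin n)) (m : ℕ) :
    (∑ γ : Equiv.Perm (Fin n), if Qtab γ = Qtab γ0 then FundPoly m n {i | i ∉ DesL0 γ} else 0) =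
      ssytSum (cellsOfPart (conjPart (shapeOf (Qtab γ0)))) m := by
  set T := Qtab γ0 with hT
  have hTab : IsTab T := (ptab_spec _ (wd_nodup γ0⁻¹)).1
  set C := cellsOfPart (conjPart (shapeOf T)) with hCdef
  have hC : ∀ j k, (j, k) ∈ C ↔ j < shf T k := fun j k => mem_cells_conj _ (shape_pairwise hTab) j k
  have key := sum_eq_of_param (A := Equiv.Perm (Fin n) × (Fin n → Fin m)) (B := {x // x ∈ C} → Fin m)
    (fun p => Qtab p.1 = T ∧ StrictMono (gw p.1⁻¹ p.2)) (fun R => SSC C R) (GoodS (shf T))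
    (fun p => Finset.univ.image (gw p.1⁻¹ p.2)) (fun R => Finset.univ.image (hR R)) wS
    (by
      rintro ⟨γ, f⟩ ⟨h1, h2⟩
      have := word_good _ _ h2
      change GoodS (shf (Qtab γ)) _ at this
      rwa [h1] at this)
    (by
      rintro ⟨γ, f⟩ ⟨γ', f'⟩ ⟨h1, h2⟩ ⟨h1', h2'⟩ he
      obtain ⟨h3, h4⟩ := word_inj _ _ _ _ h2 h2' (h1.trans h1'.symm) he
      exact Prod.ext (inv_injective h3) h4)
    (by
      intro S hS
      obtain ⟨σ, f, h1, h2, h3⟩ := word_surj γ0⁻¹ S hS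
      refine ⟨(σ⁻¹, f), ⟨?_, ?_⟩, ?_⟩
      · simp only [Qtab, inv_inv]; exact h1
      · simpa using h2
      · simpa using h3)
    (fun R h => ss_good hC (shf_anti hTab) R h)
    (fun R R' h h' he => ss_inj hC R R' h h' he)
    (fun S hS => ss_surj hC S hS)
  rw [Fintype.sum_prod_type] at key
  have hR' : ssytSum C m = ∑ R : {x // x ∈ C} → Fin m, (if SSC C R then wS (Finset.univ.image (hR R)) else 0) := by
    unfold ssytSum
    apply Finset.sum_congr rfl
    intro R _
    by_cases h : SSC C R
    · refine (if_pos h).trans ?_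
      rw [if_pos h, wS, Finset.prod_image (fun a _ b _ hab => hR_inj hC R h hab)]
      rfl
    · refine (if_neg h).trans ?_
      rw [if_neg h]
  rw [hR', ← key]
  apply Finset.sum_congr rfl
  intro γ _
  by_cases h : Qtab γ = T
  · rw [if_pos h, FundPoly]
    apply Finset.sum_congr rfl
    intro f _
    have hm := gw_mono γ f
    by_cases h2 : StrictMono (gw γ⁻¹ f)
    · rw [if_pos (hm.mpr h2), if_pos ⟨h, h2⟩, wS, Finset.prod_image (fun a _ b _ hab => h2.injective hab)]
      rfl
    · rw [if_neg (fun h3 => h2 (hm.mp h3)), if_neg (fun h3 => h2 h3.2)]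
  · rw [if_neg h]
    symm
    apply Finset.sum_eq_zero
    intro f _
    rw [if_neg (fun h3 => h h3.1)]


end Helpers

/-- For a regular Schur labeled skew shape poset `P`, the `0`-Hecke module `M_P` (with
basis `Σ_L(P)`) admits a distinguished filtration with respect to the Schur basis:
for an enumeration `t 0, …, t (l-1)` of the recording tableaux of `Σ_L(P)` refining
the dominance order on shapes, the spans `M_k` of `B_k = {γ ∈ Σ_L(P) : Q(γ) ∈ {t 0,…,t k}}`
are `H_n(0)`-submodules (closure of `B_k` under the `0`-Hecke action), and each layer
`B_k \ B_{k-1}` has quasisymmetric characteristic equal to the Schur function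
`s_{sh(t k)ᵗ}` (as an identity of polynomials in any number `m` of variables). -/
theorem distinguished_filtration {n : ℕ} (r : Fin n → Fin n → Prop)
    (hpo : IsPartialOrder (Fin n) r) (hreg : RegularRel r)
    (s : SkewShape) (τ : ℕ × ℕ → Fin n) (hschur : IsSchurLabeling s n τ)
    (hrel : ∀ x y, r x y ↔ posetRel s τ x y)
    (l : ℕ) (t : Fin l → List (List ℕ)) (hinj : Function.Injective t)
    (hrange : {x | ∃ γ : Equiv.Perm (Fin n),
        (∀ i j, r i j → γ i ≤ γ j) ∧ Qtab γ = x} = Set.range t)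
    (horder : ∀ i j : Fin l,
      domList (shapeOf (t i)) (shapeOf (t j)) → shapeOf (t i) ≠ shapeOf (t j) → i < j) :
    (∀ k : Fin l, ∀ γ : Equiv.Perm (Fin n), (∀ i j, r i j → γ i ≤ γ j) →
      (∃ i ≤ k, Qtab γ = t i) →
      ∀ (a : ℕ) (h : a + 1 < n), a ∉ DesL0 γ →
        (∀ i j, r i j →
          (Equiv.swap (⟨a, Nat.lt_of_succ_lt h⟩ : Fin n) ⟨a + 1, h⟩ * γ) i ≤
          (Equiv.swap (⟨a, Nat.lt_of_succ_lt h⟩ : Fin n) ⟨a + 1, h⟩ * γ) j) →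
        ∃ i ≤ k, Qtab (Equiv.swap (⟨a, Nat.lt_of_succ_lt h⟩ : Fin n) ⟨a + 1, h⟩ * γ) = t i) ∧
    (∀ k : Fin l, ∀ m : ℕ,
      (∑ γ : Equiv.Perm (Fin n),
        if (∀ i j, r i j → γ i ≤ γ j) ∧ Qtab γ = t k then
          FundPoly m n {i | i ∉ DesL0 γ}
        else 0) =
      ssytSum (cellsOfPart (conjPart (shapeOf (t k)))) m) := by
  constructor
  · rintro k γ hγ ⟨i, hik, hi⟩ a h hd hle
    obtain ⟨hdom, heq⟩ := part1 γ a h hd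
    have hmem : Qtab (Equiv.swap (⟨a, Nat.lt_of_succ_lt h⟩ : Fin n) ⟨a + 1, h⟩ * γ) ∈ Set.range t := by
      rw [← hrange]
      exact ⟨_, hle, rfl⟩
    obtain ⟨i', hi'⟩ := hmem
    by_cases hs : shapeOf (Qtab (Equiv.swap (⟨a, Nat.lt_of_succ_lt h⟩ : Fin n) ⟨a + 1, h⟩ * γ)) = shapeOf (Qtab γ)
    · exact ⟨i, hik, (heq hs).trans hi⟩
    · rw [← hi', hi] at hdom hs
      exact ⟨i', (horder i' i hdom hs).le.trans hik, hi'.symm⟩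
  · intro k m
    have hmem : t k ∈ Set.range t := ⟨k, rfl⟩
    rw [← hrange] at hmem
    obtain ⟨γ0, h0, h1⟩ := hmem
    rw [← h1, ← part2 γ0 m]
    apply Finset.sum_congr rfl
    intro γ _
    by_cases h : Qtab γ = Qtab γ0
    · rw [if_pos h, if_pos ⟨closure_Q hreg hschur hrel γ0 γ h.symm h0, h⟩]
    · rw [if_neg h, if_neg (fun h3 => h h3.2)]
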